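/- Let F be the homotopy fiber of the inclusion S² ∨ S² → S² × S². Then π₃(F) is isomorphic to the integers ℤ. -/

import Mathlib

open Topology

namespace WedgeFiber

open Set

/-! ### The model of the sphere -/

/-- The domain `ℝ⁴` of the maps considered below. -/
abbrev V := Fin 4 → ℝ

/-- The unit sphere, as a subset of `ℂ × ℝ`. -/
def Sph : Set (ℂ × ℝ) := {x | ‖x.1‖ ^ 2 + x.2 ^ 2 = 1}

/-- The north pole. -/
def b0 : Sph := ⟨(0, 1), by simp [Sph]⟩

/-- The product of two spheres. -/
abbrev X := Sph × Sph

/-- The base point of the product of two spheres. -/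
abbrev base : X := (b0, b0)

/-- The wedge inside the product of two spheres. -/
def InA (x : X) : Prop := x.1 = b0 ∨ x.2 = b0

/-- The projection of the line to the unit interval. -/
def cl (x : ℝ) : ℝ := max 0 (min 1 x)

@[fun_prop] lemma continuous_cl : Continuous cl := by unfold cl; fun_prop

lemma cl_nonneg (x : ℝ) : 0 ≤ cl x := le_max_left _ _

lemma cl_le_one (x : ℝ) : cl x ≤ 1 := max_le zero_le_one (min_le_left _ _)

lemma cl_mem (x : ℝ) : cl x ∈ Icc (0 : ℝ) 1 := ⟨cl_nonneg x, cl_le_one x⟩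

lemma cl_of_le_zero {x : ℝ} (h : x ≤ 0) : cl x = 0 := by
  unfold cl; rw [min_eq_right (by linarith), max_eq_left h]

lemma cl_of_one_le {x : ℝ} (h : 1 ≤ x) : cl x = 1 := by
  unfold cl; rw [min_eq_left h, max_eq_right zero_le_one]

lemma cl_of_mem {x : ℝ} (h0 : 0 ≤ x) (h1 : x ≤ 1) : cl x = x := by
  unfold cl; rw [min_eq_right h1, max_eq_right h0]

lemma eq_b0_iff (x : Sph) : x = b0 ↔ x.1.2 = 1 := by
  constructor
  · rintro rfl; rfl
  · intro h
    have hx := x.2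
    simp only [Sph, mem_ofPred_eq, h] at hx
    have : x.1.1 = 0 := by
      have : ‖x.1.1‖ ^ 2 = 0 := by linarith
      simpa using this
    exact Subtype.ext (Prod.ext this h)

lemma isClosed_inA : IsClosed {x : X | InA x} :=
  (isClosed_eq continuous_fst continuous_const).union (isClosed_eq continuous_snd continuous_const)

/-! ### Homotopies through a set of maps -/

section Htpy

variable {Y Z : Type*} [TopologicalSpace Y] [TopologicalSpace Z]

/-- A homotopy from `f` to `g` through maps in `S`, parametrised by the whole line. -/
def Htpy (S : Set (Y → Z)) (f g : Y → Z) : Prop :=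
  ∃ H : ℝ → Y → Z, Continuous (fun p : ℝ × Y => H p.1 p.2) ∧ (∀ u, H u ∈ S) ∧ H 0 = f ∧ H 1 = g

lemma Htpy.of_Icc {S : Set (Y → Z)} {f g : Y → Z} (H : ℝ → Y → Z)
    (hc : Continuous (fun p : ℝ × Y => H (cl p.1) p.2)) (hS : ∀ u, 0 ≤ u → u ≤ 1 → H u ∈ S)
    (h0 : H 0 = f) (h1 : H 1 = g) : Htpy S f g := by
  refine ⟨fun u => H (cl u), hc, fun u => hS _ (cl_nonneg u) (cl_le_one u), ?_, ?_⟩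
  · simpa [cl_of_le_zero le_rfl] using h0
  · simpa [cl_of_one_le le_rfl] using h1

lemma Htpy.of_Icc' {S : Set (Y → Z)} {f g : Y → Z} (H : ℝ → Y → Z)
    (hc : Continuous (fun p : ℝ × Y => H p.1 p.2)) (hS : ∀ u, 0 ≤ u → u ≤ 1 → H u ∈ S)
    (h0 : H 0 = f) (h1 : H 1 = g) : Htpy S f g :=
  Htpy.of_Icc H (hc.comp (by fun_prop : Continuous fun p : ℝ × Y => (cl p.1, p.2))) hS h0 h1

lemma Htpy.symm {S : Set (Y → Z)} {f g : Y → Z} (h : Htpy S f g) : Htpy S g f := by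
  obtain ⟨H, hc, hS, h0, h1⟩ := h
  refine ⟨fun u => H (1 - u), ?_, fun u => hS _, by simpa using h1, by simpa using h0⟩
  exact hc.comp (by fun_prop : Continuous fun p : ℝ × Y => (1 - p.1, p.2))

lemma Htpy.trans {S : Set (Y → Z)} {f g k : Y → Z} (h : Htpy S f g) (h' : Htpy S g k) :
    Htpy S f k := by
  obtain ⟨H, hc, hS, h0, h1⟩ := h
  obtain ⟨H', hc', hS', h0', h1'⟩ := h'
  refine ⟨fun u => if u ≤ 1 / 2 then H (2 * u) else H' (2 * u - 1), ?_, ?_, ?_, ?_⟩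
  · have : (fun p : ℝ × Y => (if p.1 ≤ 1 / 2 then H (2 * p.1) else H' (2 * p.1 - 1)) p.2) =
        fun p : ℝ × Y => if p.1 ≤ 1 / 2 then H (2 * p.1) p.2 else H' (2 * p.1 - 1) p.2 := by
      funext p; split_ifs <;> rfl
    rw [this]
    refine Continuous.if_le ?_ ?_ continuous_fst continuous_const ?_
    · exact hc.comp (by fun_prop : Continuous fun p : ℝ × Y => (2 * p.1, p.2))
    · exact hc'.comp (by fun_prop : Continuous fun p : ℝ × Y => (2 * p.1 - 1, p.2))
    · intro p hp
      rw [hp]; norm_num [h1, h0']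
  · intro u
    by_cases hu : u ≤ 1 / 2
    · simpa only [if_pos hu] using hS _
    · simpa only [if_neg hu] using hS' _
  · norm_num [h0]
  · norm_num [h1']

end Htpy

/-! ### Collapse maps -/

/-- The map of the plane to the sphere that collapses the complement of the unit disc. -/
noncomputable def E (v : ℂ) : Sph :=
  ⟨(((2 * √(max 0 (1 - ‖v‖ ^ 2)) : ℝ) : ℂ) * v, 2 * min 1 (‖v‖ ^ 2) - 1), by
    simp only [Sph, mem_ofPred_eq, norm_mul, Complex.norm_real, Real.norm_eq_abs, mul_pow, sq_abs]
    rw [Real.sq_sqrt (le_max_left _ _)]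
    rcases le_total (‖v‖ ^ 2) 1 with h | h
    · rw [max_eq_right (by linarith), min_eq_right h]; ring
    · rw [max_eq_left (by linarith), min_eq_left h]; ring⟩

@[fun_prop] lemma continuous_E : Continuous E := by
  unfold E; fun_prop

lemma E_eq_b0_iff (v : ℂ) : E v = b0 ↔ 1 ≤ ‖v‖ := by
  rw [eq_b0_iff]
  simp only [E]
  have h : (1 : ℝ) ≤ ‖v‖ ↔ 1 ≤ ‖v‖ ^ 2 := by
    rw [one_le_sq_iff₀ (norm_nonneg v)]
  rw [h]
  constructor
  · intro h'
    by_contra hc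
    rw [min_eq_right (by linarith)] at h'
    linarith
  · intro h'; rw [min_eq_left h']; norm_num

open Classical in
/-- The point of the sphere closest to a nonzero vector. -/
noncomputable def nrm (x : ℂ × ℝ) : Sph :=
  if h : x = 0 then b0 else
    ⟨((√(‖x.1‖ ^ 2 + x.2 ^ 2))⁻¹ • x), by
      have h1 : 0 < ‖x.1‖ ^ 2 + x.2 ^ 2 := by
        by_contra hc
        have h2 : ‖x.1‖ ^ 2 = 0 := by nlinarith [sq_nonneg ‖x.1‖, sq_nonneg x.2]
        have h3 : x.2 ^ 2 = 0 := by nlinarith [sq_nonneg ‖x.1‖, sq_nonneg x.2]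
        exact h (Prod.ext (by simpa using h2) (by simpa using h3))
      simp only [Sph, mem_ofPred_eq, Prod.smul_fst, Prod.smul_snd, norm_smul, norm_inv,
        Real.norm_eq_abs, mul_pow, inv_pow, sq_abs, smul_eq_mul]
      rw [Real.sq_sqrt h1.le, ← mul_add, inv_mul_cancel₀ h1.ne']⟩

lemma nrm_coe (x : Sph) : nrm x.1 = x := by
  have hx : ‖x.1.1‖ ^ 2 + x.1.2 ^ 2 = 1 := x.2
  have h0 : x.1 ≠ 0 := by
    intro h; rw [h] at hx; simp at hx
  rw [nrm, dif_neg h0]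
  ext1
  simp [hx]

lemma sq_add_sq_pos {x : ℂ × ℝ} (h : x ≠ 0) : 0 < ‖x.1‖ ^ 2 + x.2 ^ 2 := by
  by_contra hc
  have h2 : ‖x.1‖ ^ 2 = 0 := by nlinarith [sq_nonneg ‖x.1‖, sq_nonneg x.2]
  have h3 : x.2 ^ 2 = 0 := by nlinarith [sq_nonneg ‖x.1‖, sq_nonneg x.2]
  exact h (Prod.ext (by simpa using h2) (by simpa using h3))

lemma continuous_nrm {Y : Type*} [TopologicalSpace Y] {g : Y → ℂ × ℝ} (hg : Continuous g)
    (h : ∀ y, g y ≠ 0) : Continuous fun y => nrm (g y) := by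
  rw [continuous_induced_rng]
  have : (Subtype.val ∘ fun y => nrm (g y)) =
      fun y => (√(‖(g y).1‖ ^ 2 + (g y).2 ^ 2))⁻¹ • g y := by
    funext y
    simp only [Function.comp, nrm, dif_neg (h y)]
  rw [this]
  have h2 : Continuous fun y => √(‖(g y).1‖ ^ 2 + (g y).2 ^ 2) := by fun_prop
  refine Continuous.smul (h2.inv₀ fun y => ?_) hg
  exact ne_of_gt (Real.sqrt_pos.2 (sq_add_sq_pos (h y)))

/-- The map that collapses the complement of the disc of centre `q` and radius `r` in the
lower half space. -/
noncomputable def col (q : ℂ) (r : ℝ) (x : ℂ × ℝ) : Sph :=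
  if x.2 ≤ 0 then E ((r : ℂ)⁻¹ * (x.1 - q)) else b0

lemma continuous_col {Y : Type*} [TopologicalSpace Y] {q : Y → ℂ} {r : Y → ℝ} {g : Y → ℂ × ℝ}
    (hq : Continuous q) (hr : Continuous r) (hg : Continuous g) (h0 : ∀ y, 0 < r y)
    (h : ∀ y, (g y).2 = 0 → r y ≤ ‖(g y).1 - q y‖) : Continuous fun y => col (q y) (r y) (g y) := by
  unfold col
  refine Continuous.if_le ?_ continuous_const hg.snd continuous_const ?_
  · have : Continuous fun y => ((r y : ℂ))⁻¹ :=
      (Complex.continuous_ofReal.comp hr).inv₀ fun y => by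
        simpa using (h0 y).ne'
    exact continuous_E.comp (this.mul (hg.fst.sub hq))
  · intro y hy
    rw [E_eq_b0_iff, norm_mul, norm_inv, Complex.norm_real, Real.norm_of_nonneg (h0 y).le,
      ← div_eq_inv_mul, one_le_div (h0 y)]
    exact h y hy

lemma col_of_pos {q : ℂ} {r : ℝ} {x : ℂ × ℝ} (h : 0 < x.2) : col q r x = b0 := by
  simp [col, not_le.2 h]

lemma col_ne_b0 {q : ℂ} {r : ℝ} {x : ℂ × ℝ} (hr : 0 < r) (h : col q r x ≠ b0) :
    x.2 ≤ 0 ∧ ‖x.1 - q‖ < r := by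
  unfold col at h
  split_ifs at h with h1
  · refine ⟨h1, ?_⟩
    rw [Ne, E_eq_b0_iff, norm_mul, norm_inv, Complex.norm_real, Real.norm_of_nonneg hr.le,
      ← div_eq_inv_mul, one_le_div hr, not_le] at h
    exact h
  · exact absurd rfl h

/-- A map to the sphere is homotopic to the collapse of any approximation of it. -/
lemma htpy_col {Y : Type*} [TopologicalSpace Y] {f : Y → Sph} (hf : Continuous f)
    {P : Y → ℂ × ℝ} (hP : Continuous P) (hPf : ∀ y, ‖P y - (f y).1‖ < 1 / 4)
    {q : ℂ} {r : ℝ} (hq : ‖q‖ ≤ 1 / 4) (hr0 : 0 < r) (hr : r ≤ 1 / 4) :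
    Htpy {g : Y → Sph | Continuous g ∧ ∀ y, f y = b0 → g y = b0} f (fun y => col q r (P y)) := by
  have S0 : ∀ y, f y = b0 → 0 < (f y).1.2 := fun y hy => by rw [hy]; simp [b0]
  have main : ∀ (H : ℝ → Y → Sph) (k : Y → Sph) (l : Y → Sph),
      Continuous (fun p : ℝ × Y => H (cl p.1) p.2) →
      (∀ u, 0 ≤ u → u ≤ 1 → ∀ y, f y = b0 → H u y = b0) → H 0 = k → H 1 = l →
      Htpy {g : Y → Sph | Continuous g ∧ ∀ y, f y = b0 → g y = b0} k l := by
    intro H k l hc hS h0 h1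
    refine Htpy.of_Icc H hc (fun u hu hu' => ⟨?_, hS u hu hu'⟩) h0 h1
    have := hc.comp (by fun_prop : Continuous fun y : Y => (u, y))
    simpa [Function.comp_def, cl_of_mem hu hu'] using this
  have a1 : Htpy {g : Y → Sph | Continuous g ∧ ∀ y, f y = b0 → g y = b0} f
      (fun y => col 0 1 (f y).1) := by
    have hcol : Continuous fun p : ℝ × Y => col 0 1 (f p.2).1 := by
      refine continuous_col (by fun_prop) (by fun_prop) (by fun_prop) (fun _ => one_pos) ?_
      intro p hp
      have := (f p.2).2
      simp only [Sph, mem_ofPred_eq, hp] at this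
      have h' : ‖(f p.2).1.1‖ = 1 := by nlinarith [norm_nonneg (f p.2).1.1]
      simp [h']
    refine main (fun u y => nrm ((1 - u) • (f y).1 + u • (col 0 1 (f y).1).1)) _ _ ?_ ?_ ?_ ?_
    · refine continuous_nrm (by fun_prop) ?_
      rintro ⟨u, y⟩ h
      simp only at h
      have hu0 := cl_nonneg u
      have hu1 := cl_le_one u
      generalize cl u = v at *
      have hx : ‖(f y).1.1‖ ^ 2 + (f y).1.2 ^ 2 = 1 := (f y).2
      generalize (f y).1 = x at *
      by_cases hx2 : x.2 ≤ 0
      · simp only [col, if_pos hx2, E] at h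
        have hA := congrArg Prod.fst h
        have hB := congrArg Prod.snd h
        simp only [Prod.fst_add, Prod.snd_add, Prod.smul_fst, Prod.smul_snd, smul_eq_mul,
          Prod.fst_zero, Prod.snd_zero, Complex.real_smul] at hA hB
        simp only [Complex.ofReal_one, inv_one, one_mul, sub_zero] at hA hB
        set m := 2 * √(max 0 (1 - ‖x.1‖ ^ 2)) with hm
        have hm0 : 0 ≤ m := by positivity
        have h1 : (((1 - v) + v * m : ℝ) : ℂ) * x.1 = 0 := by
          push_cast; push_cast at hA; linear_combination hA
        rcases mul_eq_zero.1 h1 with h2 | h2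
        · have h2' : (1 - v) + v * m = 0 := by exact_mod_cast h2
          have hvm : 0 ≤ v * m := mul_nonneg hu0 hm0
          have hv : v = 1 := by linarith
          rw [hv] at h2'
          have hm' : m = 0 := by linarith
          have : √(max 0 (1 - ‖x.1‖ ^ 2)) = 0 := by linarith
          rw [Real.sqrt_eq_zero (le_max_left _ _)] at this
          have h5 : 1 ≤ ‖x.1‖ ^ 2 := by
            have := le_max_right 0 (1 - ‖x.1‖ ^ 2); linarith
          rw [hv, min_eq_left h5] at hB
          norm_num at hB
        · have hx1 : ‖x.1‖ ^ 2 = 0 := by simp [h2]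
          rw [hx1] at hB hx
          have hx3 : x.2 = -1 := by nlinarith
          rw [hx3] at hB
          norm_num at hB
          linarith
      · rw [col_of_pos (not_le.1 hx2)] at h
        have hB := congrArg Prod.snd h
        simp only [b0, Prod.snd_add, Prod.smul_snd, smul_eq_mul, Prod.snd_zero] at hB
        nlinarith [not_le.1 hx2]
    · intro u _ _ y hy
      have hb : col 0 1 b0.1 = b0 := col_of_pos (by simp [b0])
      simp only [hy, hb]
      rw [← add_smul]; simpa using nrm_coe b0
    · funext y; simpa using nrm_coe _
    · funext y; simpa using nrm_coe _
  have a2 : Htpy {g : Y → Sph | Continuous g ∧ ∀ y, f y = b0 → g y = b0}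
      (fun y => col 0 1 (f y).1) (fun y => col q r (f y).1) := by
    refine main (fun u y => col (u * q) ((1 - u) + u * r) (f y).1) _ _ ?_ ?_ ?_ ?_
    · refine continuous_col (by fun_prop) (by fun_prop) (by fun_prop) ?_ ?_
      · rintro ⟨u, y⟩
        have hu0 := cl_nonneg u
        have hu1 := cl_le_one u
        simp only
        nlinarith
      · rintro ⟨u, y⟩ hp
        have hu0 := cl_nonneg u
        have hu1 := cl_le_one u
        simp only at hp ⊢
        have := (f y).2
        simp only [Sph, mem_ofPred_eq, hp] at this
        have h' : ‖(f y).1.1‖ = 1 := by nlinarith [norm_nonneg (f y).1.1]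
        have h2 := norm_sub_norm_le (f y).1.1 (cl u * q)
        rw [norm_mul, Complex.norm_real, Real.norm_of_nonneg hu0, h'] at h2
        nlinarith
    · intro u _ _ y hy
      exact col_of_pos (S0 y hy)
    · funext y; simp
    · funext y; simp
  have a3 : Htpy {g : Y → Sph | Continuous g ∧ ∀ y, f y = b0 → g y = b0}
      (fun y => col q r (f y).1) (fun y => col q r (P y)) := by
    have key : ∀ u : ℝ, 0 ≤ u → u ≤ 1 → ∀ y,
        ‖((f y).1 + u • (P y - (f y).1)) - (f y).1‖ < 1 / 4 := by
      intro u hu hu' y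
      rw [add_sub_cancel_left, norm_smul, Real.norm_of_nonneg hu]
      have := hPf y
      nlinarith [norm_nonneg (P y - (f y).1)]
    refine main (fun u y => col q r ((f y).1 + u • (P y - (f y).1))) _ _ ?_ ?_ ?_ ?_
    · refine continuous_col (by fun_prop) (by fun_prop) (by fun_prop) (fun _ => hr0) ?_
      rintro ⟨u, y⟩ hp
      have hk := key (cl u) (cl_nonneg u) (cl_le_one u) y
      simp only at hp ⊢
      generalize (f y).1 + cl u • (P y - (f y).1) = z at *
      have hx : ‖(f y).1.1‖ ^ 2 + (f y).1.2 ^ 2 = 1 := (f y).2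
      generalize (f y).1 = x at *
      have h1 := (norm_fst_le _).trans_lt hk
      have h2 := (norm_snd_le _).trans_lt hk
      simp only [Prod.fst_sub, Prod.snd_sub, hp, zero_sub, norm_neg, Real.norm_eq_abs] at h1 h2
      have h3 : x.2 ^ 2 < 1 / 16 := by rw [← sq_abs]; nlinarith [abs_nonneg x.2]
      have h4 : 3 / 4 ≤ ‖x.1‖ := by nlinarith [norm_nonneg x.1]
      have h5 := norm_sub_norm_le x.1 (x.1 - z.1)
      have h6 := norm_sub_norm_le z.1 q
      rw [sub_sub_cancel] at h5
      rw [norm_sub_rev] at h1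
      linarith
    · intro u hu hu' y hy
      refine col_of_pos ?_
      have hk := (norm_snd_le _).trans_lt (key u hu hu' y)
      rw [Prod.snd_sub, Real.norm_eq_abs, abs_lt] at hk
      have : (f y).1.2 = 1 := by rw [hy]; rfl
      linarith [hk.1]
    · funext y; simp
    · funext y; simp
  exact (a1.trans a2).trans a3

/-- Smooth approximation of maps to the sphere by maps to the ambient space. -/
lemma exists_contDiff_near {Y : Type*} [NormedAddCommGroup Y] [NormedSpace ℝ Y]
    [FiniteDimensional ℝ Y] {f : Y → Sph} (hf : Continuous f) :
    ∃ P : Y → ℂ × ℝ, ContDiff ℝ 2 P ∧ ∀ y, ‖P y - (f y).1‖ < 1 / 4 := by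
  obtain ⟨P, h1, h2, -⟩ := Continuous.exists_contDiff_approx 2
    (continuous_subtype_val.comp hf) (continuous_const (y := (1 / 4 : ℝ))) (fun _ => by norm_num)
  exact ⟨P, h1, fun y => by simpa [dist_eq_norm] using h2 y⟩

/-- A loop in the sphere can be contracted without moving the points at the base point. -/
lemma htpy_loop {γ : ℝ → Sph} (hγ : Continuous γ) (h0 : ∀ u, u ≤ 0 ∨ 1 ≤ u → γ u = b0) :
    Htpy {g : ℝ → Sph | Continuous g ∧ ∀ u, γ u = b0 → g u = b0} γ (fun _ => b0) := by
  obtain ⟨P, hP, hPγ⟩ : ∃ P : ℝ → ℂ × ℝ, ContDiff ℝ 2 P ∧ ∀ u, ‖P u - (γ u).1‖ < 1 / 4 :=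
    exists_contDiff_near hγ
  obtain ⟨q, hq, hqP⟩ : ∃ q : ℂ, ‖q‖ ≤ 1 / 4 ∧ ∀ u, (P u).1 ≠ q := by
    have h1 : Dense (range fun u => (P u).1)ᶜ := by
      refine ContDiff.dense_compl_range_of_finrank_lt_finrank ?_ ?_
      · exact contDiff_fst.comp (hP.of_le one_le_two)
      · simp
    obtain ⟨q, hq, hq'⟩ := h1.inter_open_nonempty (Metric.ball 0 (1 / 4)) Metric.isOpen_ball
      ⟨0, by simp⟩
    refine ⟨q, by simpa using (mem_ball_zero_iff.1 hq).le, fun u hu => hq' ⟨u, hu⟩⟩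
  obtain ⟨u₀, -, hu₀⟩ := isCompact_Icc.exists_isMinOn (nonempty_Icc.2 zero_le_one)
    (f := fun u : ℝ => ‖(P u).1 - q‖) (by have := hP.continuous; fun_prop)
  have hr0 : 0 < min (1 / 4) ‖(P u₀).1 - q‖ :=
    lt_min (by norm_num) (norm_pos_iff.2 (sub_ne_zero.2 (hqP _)))
  have := htpy_col hγ hP.continuous hPγ hq hr0 (min_le_left _ _)
  convert this using 1
  funext u
  by_contra hc
  obtain ⟨h1, h2⟩ := col_ne_b0 hr0 (Ne.symm hc)
  have hu : u ∈ Icc (0 : ℝ) 1 := by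
    by_contra hu
    have h3 : γ u = b0 := by
      apply h0
      by_contra! h4
      exact hu ⟨h4.1.le, h4.2.le⟩
    have h5 := (norm_snd_le _).trans_lt (hPγ u)
    rw [Prod.snd_sub, Real.norm_eq_abs, abs_lt, h3] at h5
    have : b0.1.2 = 1 := rfl
    linarith [h5.1]
  have := hu₀ hu
  simp only [mem_ofPred_eq] at this
  exact absurd (h2.trans_le (min_le_right _ _)) (not_lt.2 this)

/-! ### Based and free maps -/

/-- A function that is nonnegative exactly outside the open faces of the cube other than the
bottom one. -/
def jv (y : V) : ℝ :=
  max (-y 0) (max (y 0 - 1) (max (-y 1) (max (y 1 - 1) (max (-y 2) (max (y 2 - 1) (y 3 - 1))))))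

@[fun_prop] lemma continuous_jv : Continuous jv := by unfold jv; fun_prop

/-- The region that based maps send to the base point. -/
def InJ (y : V) : Prop := 0 ≤ jv y

/-- The complement of the open cube. -/
def InB (y : V) : Prop := InJ y ∨ y 3 ≤ 0

lemma le_jv_iff {c : ℝ} {y : V} : c ≤ jv y ↔ c ≤ -y 0 ∨ 1 + c ≤ y 0 ∨ c ≤ -y 1 ∨ 1 + c ≤ y 1 ∨
    c ≤ -y 2 ∨ 1 + c ≤ y 2 ∨ 1 + c ≤ y 3 := by
  simp only [jv, le_max_iff, le_sub_iff_add_le, add_comm c 1]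

lemma inJ_iff {y : V} : InJ y ↔ y 0 ≤ 0 ∨ 1 ≤ y 0 ∨ y 1 ≤ 0 ∨ 1 ≤ y 1 ∨ y 2 ≤ 0 ∨ 1 ≤ y 2 ∨
    1 ≤ y 3 := by
  simp [InJ, le_jv_iff]

/-- The based maps: they represent elements of the third homotopy group of the fibre. -/
def BasedS : Set (V → X) :=
  {f | Continuous f ∧ (∀ y, InJ y → f y = base) ∧ ∀ y, y 3 ≤ 0 → InA (f y)}

/-- The maps that send the complement of the open cube to the wedge. -/
def FreeS : Set (V → X) := {f | Continuous f ∧ ∀ y, InB y → InA (f y)}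

lemma inA_base : InA base := Or.inl rfl

lemma basedS_subset_freeS : BasedS ⊆ FreeS := by
  rintro f ⟨hc, hJ, h3⟩
  refine ⟨hc, fun y hy => ?_⟩
  rcases hy with hy | hy
  · rw [hJ y hy]; exact inA_base
  · exact h3 y hy

lemma continuous_vec4 {Y : Type*} [TopologicalSpace Y] {a b c d : Y → ℝ} (ha : Continuous a)
    (hb : Continuous b) (hc : Continuous c) (hd : Continuous d) :
    Continuous fun y => (![a y, b y, c y, d y] : V) := by
  refine continuous_pi fun i => ?_
  fin_cases i <;> assumption

lemma htpy_comp_of_faces {f : V → X} (hf : f ∈ BasedS) {e : V → V} (he : Continuous e)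
    (h0 : ∀ y i, y i ≤ 0 → e y i ≤ 0) (h1 : ∀ y i, 1 ≤ y i → 1 ≤ e y i) :
    Htpy BasedS (fun y => f (e y)) f := by
  obtain ⟨hc, hJ, h3⟩ := hf
  have k0 : ∀ u : ℝ, 0 ≤ u → u ≤ 1 → ∀ (y : V) i, y i ≤ 0 → ((1 - u) • e y + u • y) i ≤ 0 := by
    intro u hu hu' y i hi
    have := h0 y i hi
    simp only [Pi.add_apply, Pi.smul_apply, smul_eq_mul]
    nlinarith
  have k1 : ∀ u : ℝ, 0 ≤ u → u ≤ 1 → ∀ (y : V) i, 1 ≤ y i → 1 ≤ ((1 - u) • e y + u • y) i := by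
    intro u hu hu' y i hi
    have := h1 y i hi
    simp only [Pi.add_apply, Pi.smul_apply, smul_eq_mul]
    nlinarith
  refine Htpy.of_Icc' (fun u y => f ((1 - u) • e y + u • y)) (by fun_prop) ?_ (by simp) (by simp)
  intro u hu hu'
  refine ⟨by fun_prop, fun y hy => hJ _ ?_, fun y hy => h3 _ (k0 u hu hu' y 3 hy)⟩
  rw [inJ_iff] at hy ⊢
  rcases hy with h | h | h | h | h | h | h
  · exact Or.inl (k0 u hu hu' y _ h)
  · exact Or.inr (Or.inl (k1 u hu hu' y _ h))
  · exact Or.inr (Or.inr (Or.inl (k0 u hu hu' y _ h)))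
  · exact Or.inr (Or.inr (Or.inr (Or.inl (k1 u hu hu' y _ h))))
  · exact Or.inr (Or.inr (Or.inr (Or.inr (Or.inl (k0 u hu hu' y _ h)))))
  · exact Or.inr (Or.inr (Or.inr (Or.inr (Or.inr (Or.inl (k1 u hu hu' y _ h))))))
  · exact Or.inr (Or.inr (Or.inr (Or.inr (Or.inr (Or.inr (k1 u hu hu' y _ h))))))

lemma htpy_loop_wedge {γ : ℝ → X} (hγ : Continuous γ) (hA : ∀ u, InA (γ u))
    (h0 : ∀ u, u ≤ 0 ∨ 1 ≤ u → γ u = base) :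
    Htpy {g : ℝ → X | ∀ u, InA (g u) ∧ (u ≤ 0 ∨ 1 ≤ u → g u = base)} γ (fun _ => base) := by
  obtain ⟨H, hH, hHS, hH0, hH1⟩ := htpy_loop hγ.fst fun u hu => by rw [h0 u hu]
  obtain ⟨K, hK, hKS, hK0, hK1⟩ := htpy_loop hγ.snd fun u hu => by rw [h0 u hu]
  refine ⟨fun v u => (H v u, K v u), hH.prodMk hK, fun v u => ⟨?_, fun hu => ?_⟩, ?_, ?_⟩
  · exact (hA u).imp ((hHS v).2 u) ((hKS v).2 u)
  · exact Prod.ext ((hHS v).2 u (by rw [h0 u hu])) ((hKS v).2 u (by rw [h0 u hu]))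
  · funext u; simp only [hH0, hK0]
  · funext u; simp only [hH1, hK1]

/-- The shrinking of the cube used in `htpy_of_free`. -/
def shr (y : V) : V := ![3 * y 0 - 1, 3 * y 1 - 1, 3 * y 2 - 1, 2 * y 3]

lemma continuous_shr : Continuous shr := by
  unfold shr
  apply continuous_vec4 <;> fun_prop

/-- The map of domains used in `htpy_of_free`. -/
def collar (v : ℝ) (e : V) : V :=
  ![(1 - cl (3 * v - 1)) * e 0, (1 - cl (3 * v - 1)) * e 1, (1 - cl (3 * v - 1)) * e 2,
    (1 - cl (3 * v - 1)) * (e 3 + cl (3 * v) * max 0 (1 - e 3)) + cl (3 * v - 1)]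

lemma continuous_collar {Y : Type*} [TopologicalSpace Y] {v : Y → ℝ} {e : Y → V}
    (hv : Continuous v) (he : Continuous e) : Continuous fun y => collar (v y) (e y) := by
  unfold collar
  apply continuous_vec4 <;> fun_prop

lemma collar_zero (e : V) : collar 0 e = e := by
  have h1 : cl (-1) = 0 := cl_of_le_zero (by norm_num)
  have h2 : cl 0 = 0 := cl_of_le_zero le_rfl
  ext i
  fin_cases i <;> simp [collar, h1, h2]

lemma collar_two_thirds (e : V) : collar (2 / 3) e = ![0, 0, 0, 1] := by
  have h1 : cl (3 * (2 / 3) - 1) = 1 := cl_of_one_le (by norm_num)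
  ext i
  fin_cases i <;> simp [collar, h1]

lemma inJ_collar {v : ℝ} {e : V} (he : InJ e) : InJ (collar v e) := by
  rw [inJ_iff] at he ⊢
  by_cases hv : v ≤ 1 / 3
  · have h1 : cl (3 * v - 1) = 0 := cl_of_le_zero (by linarith)
    simp only [collar, h1, sub_zero, one_mul, add_zero]
    rcases he with h | h | h | h | h | h | h
    iterate 6 simp [h]
    simp [h]
  · have h1 : cl (3 * v) = 1 := cl_of_one_le (by linarith)
    refine Or.inr (Or.inr (Or.inr (Or.inr (Or.inr (Or.inr ?_)))))
    simp only [collar, h1, one_mul]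
    have h2 := le_max_right 0 (1 - e 3)
    have h3 := cl_le_one (3 * v - 1)
    simp
    nlinarith

/-- Freely homotopic based maps are homotopic through based maps. -/
lemma htpy_of_free {f g : V → X} (hf : f ∈ BasedS) (hg : g ∈ BasedS) (h : Htpy FreeS f g) :
    Htpy BasedS f g := by
  have hshr : ∀ k ∈ BasedS, Htpy BasedS (fun y => k (shr y)) k := by
    intro k hk
    refine htpy_comp_of_faces hk continuous_shr ?_ ?_
    · intro y i hi
      fin_cases i <;> simp [shr] at hi ⊢ <;> linarith
    · intro y i hi
      fin_cases i <;> simp [shr] at hi ⊢ <;> linarith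
  refine ((hshr f hf).symm.trans ?_).trans (hshr g hg)
  obtain ⟨H, hc, hS, h0, h1⟩ := h
  have hB : ∀ u y, InB y → InA (H u y) := fun u => (hS u).2
  have hJ0 : InJ (![0, 0, 0, 1] : V) := by rw [inJ_iff]; simp
  obtain ⟨Γ, hΓ, hΓS, hΓ0, hΓ1⟩ := htpy_loop_wedge (γ := fun u => H (cl u) ![0, 0, 0, 1])
    (hc.comp (by fun_prop : Continuous fun u : ℝ => (cl u, (![0, 0, 0, 1] : V))))
    (fun u => hB _ _ (Or.inl hJ0)) (by
      rintro u (hu | hu)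
      · rw [cl_of_le_zero hu, h0]; exact hf.2.1 _ hJ0
      · rw [cl_of_one_le hu, h1]; exact hg.2.1 _ hJ0)
  set v : V → ℝ := fun y => max 0 (jv (shr y)) with hv
  have hvc : Continuous v := continuous_const.max (continuous_jv.comp continuous_shr)
  set K : ℝ → V → X := fun u y =>
    if v y ≤ 2 / 3 then H (cl u) (collar (v y) (shr y)) else Γ (cl (3 * v y - 2)) u with hK
  have hKc : Continuous fun p : ℝ × V => K p.1 p.2 := by
    refine Continuous.if_le ?_ ?_ (hvc.comp continuous_snd) continuous_const ?_
    · exact hc.comp ((continuous_cl.comp continuous_fst).prodMk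
        ((continuous_collar hvc continuous_shr).comp continuous_snd))
    · exact hΓ.comp ((continuous_cl.comp (by fun_prop)).prodMk continuous_fst)
    · intro p hp
      have h5 : cl (3 * (2 / 3) - 2) = 0 := cl_of_le_zero (by norm_num)
      rw [hp, collar_two_thirds, h5, hΓ0]
  have hend : ∀ k ∈ BasedS, ∀ u, (u ≤ 0 ∨ 1 ≤ u) → H (cl u) = k → K u = fun y => k (shr y) := by
    intro k hk u hu hHk
    funext y
    simp only [hK, hHk]
    by_cases hj : InJ (shr y)
    · rw [hk.2.1 _ hj, hk.2.1 _ (inJ_collar hj), (hΓS _ u).2 hu, ite_self]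
    · have : v y = 0 := max_eq_left (not_le.1 hj).le
      rw [this, if_pos (by norm_num), collar_zero]
  refine Htpy.of_Icc' K hKc ?_ ?_ ?_
  · intro u hu hu'
    refine ⟨hKc.comp (by fun_prop : Continuous fun y : V => (u, y)), fun y hy => ?_, fun y hy => ?_⟩
    · have h4 : 1 ≤ v y := by
        refine le_max_of_le_right ?_
        rw [le_jv_iff]
        rw [inJ_iff] at hy
        simp only [shr]
        rcases hy with h | h | h | h | h | h | h
        · left; simp; linarith
        · right; left; simp; linarith
        · right; right; left; simp; linarith
        · right; right; right; left; simp; linarith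
        · right; right; right; right; left; simp; linarith
        · right; right; right; right; right; left; simp; linarith
        · right; right; right; right; right; right; simp; linarith
      simp only [hK]
      rw [if_neg (by linarith), cl_of_one_le (by linarith), hΓ1]
    · simp only [hK]
      split_ifs with h4
      · apply hB
        by_cases hj : InJ (shr y)
        · exact Or.inl (inJ_collar hj)
        · have : v y = 0 := max_eq_left (not_le.1 hj).le
          rw [this, collar_zero]
          right
          simp [shr]; linarith
      · exact (hΓS _ u).1
  · exact hend f hf 0 (Or.inl le_rfl) (by rw [cl_of_le_zero le_rfl, h0])
  · exact hend g hg 1 (Or.inr le_rfl) (by rw [cl_of_one_le le_rfl, h1])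

section

open scoped unitInterval

/-! ### Based maps represent elements of the homotopy group -/

section Bridge

variable {S : Type} [TopologicalSpace S] (b : S)

/-- The wedge as a subspace of the product. -/
abbrev Wdg : Set (S × S) := {p : S × S | p.1 = b ∨ p.2 = b}

/-- The homotopy fibre of the inclusion of the wedge. -/
abbrev Fib : Set (Wdg b × C(I, S × S)) :=
  {q : Wdg b × C(I, S × S) | q.2 0 = (q.1 : S × S) ∧ q.2 1 = (b, b)}

variable {b}

/-- The map to the homotopy fibre given by a family of paths. -/
noncomputable def toFib (Φ : S ≃ₜ Sph) (hΦ : Φ b = b0) {Z : Type*} [TopologicalSpace Z]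
    (h : C(Z × I, X)) (h0 : ∀ z, InA (h (z, 0))) (h1 : ∀ z, h (z, 1) = base) : C(Z, Fib b) where
  toFun z := ⟨(⟨(Φ.symm (h (z, 0)).1, Φ.symm (h (z, 0)).2), by
      have hb : Φ.symm b0 = b := by rw [← hΦ, Φ.symm_apply_apply]
      rcases h0 z with h | h
      · exact Or.inl (by simp only [h, hb])
      · exact Or.inr (by simp only [h, hb])⟩,
      (ContinuousMap.mk (fun p : Z × I => (Φ.symm (h p).1, Φ.symm (h p).2))
        (by fun_prop)).curry z), rfl, by
      have hb : Φ.symm b0 = b := by rw [← hΦ, Φ.symm_apply_apply]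
      simp [h1 z, hb]⟩
  continuous_toFun := by
    refine Continuous.subtype_mk (Continuous.prodMk (Continuous.subtype_mk ?_ _) ?_) _
    · fun_prop
    · exact ContinuousMap.continuous _

lemma toFib_path (Φ : S ≃ₜ Sph) (hΦ : Φ b = b0) {Z : Type*} [TopologicalSpace Z]
    (h : C(Z × I, X)) (h0 : ∀ z, InA (h (z, 0))) (h1 : ∀ z, h (z, 1) = base) (z : Z) (t : I) :
    (toFib Φ hΦ h h0 h1 z).1.2 t = (Φ.symm (h (z, t)).1, Φ.symm (h (z, t)).2) := rfl

lemma fib_ext {x y : Fib b} (h : ∀ t, x.1.2 t = y.1.2 t) : x = y := by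
  have h2 : x.1.2 = y.1.2 := ContinuousMap.ext h
  have h1 : x.1.1 = y.1.1 := by
    apply Subtype.ext
    rw [← x.2.1, ← y.2.1, h2]
  exact Subtype.ext (Prod.ext h1 h2)

/-- The point of `ℝ⁴` with the given coordinates in the cube. -/
def vec (s : Fin 3 → I) (t : I) : V := ![s 0, s 1, s 2, t]

lemma continuous_vec : Continuous fun p : (Fin 3 → I) × I => vec p.1 p.2 := by
  unfold vec
  apply continuous_vec4 <;> fun_prop

/-- The projection to the side of the cube. -/
noncomputable def prs (y : V) : Fin 3 → I :=
  ![projIcc 0 1 zero_le_one (y 0), projIcc 0 1 zero_le_one (y 1), projIcc 0 1 zero_le_one (y 2)]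

/-- The projection to the height of the cube. -/
noncomputable def prt (y : V) : I := projIcc 0 1 zero_le_one (y 3)

lemma continuous_prs : Continuous prs := by
  refine continuous_pi fun i => ?_
  fin_cases i <;> exact (continuous_projIcc (h := zero_le_one)).comp (continuous_apply _)

lemma continuous_prt : Continuous prt := continuous_projIcc.comp (continuous_apply _)

lemma prs_vec (s : Fin 3 → I) (t : I) : prs (vec s t) = s := by
  ext i; fin_cases i <;> simp [prs, vec]

lemma prt_vec (s : Fin 3 → I) (t : I) : prt (vec s t) = t := by
  simp [prt, vec]

/-- The retraction to the cube. -/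
def clV (y : V) : V := fun i => cl (y i)

lemma continuous_clV : Continuous clV := by unfold clV; fun_prop

lemma vec_prs_prt (y : V) : vec (prs y) (prt y) = clV y := by
  ext i; fin_cases i <;> rfl

lemma inJ_vec_of_boundary {s : Fin 3 → I} (hs : s ∈ Cube.boundary (Fin 3)) (t : I) :
    InJ (vec s t) := by
  obtain ⟨i, hi⟩ := hs
  rw [inJ_iff]
  fin_cases i <;> rcases hi with hi | hi <;> simp at hi <;> simp [vec, hi]

lemma prs_boundary {y : V} (hy : InJ y) : prs y ∈ Cube.boundary (Fin 3) ∨ prt y = 1 := by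
  rw [inJ_iff] at hy
  rcases hy with h | h | h | h | h | h | h
  · exact Or.inl ⟨0, Or.inl (projIcc_of_le_left zero_le_one h)⟩
  · exact Or.inl ⟨0, Or.inr (projIcc_of_right_le zero_le_one h)⟩
  · exact Or.inl ⟨1, Or.inl (projIcc_of_le_left zero_le_one h)⟩
  · exact Or.inl ⟨1, Or.inr (projIcc_of_right_le zero_le_one h)⟩
  · exact Or.inl ⟨2, Or.inl (projIcc_of_le_left zero_le_one h)⟩
  · exact Or.inl ⟨2, Or.inr (projIcc_of_right_le zero_le_one h)⟩
  · exact Or.inr (projIcc_of_right_le zero_le_one h)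

variable (Φ : S ≃ₜ Sph) (hΦ : Φ b = b0) {pt : Fib b} (hpt : ∀ t, pt.1.2 t = (b, b))

lemma inJ_vec_one (s : Fin 3 → I) : InJ (vec s 1) := by rw [inJ_iff]; simp [vec]

/-- The loop in the homotopy fibre given by a based map. -/
noncomputable def toLoop (f : BasedS) : GenLoop (Fin 3) (Fib b) pt :=
  ⟨toFib Φ hΦ ⟨fun p => f.1 (vec p.1 p.2), f.2.1.comp continuous_vec⟩
    (fun s => f.2.2.2 _ (by simp [vec])) (fun s => f.2.2.1 _ (inJ_vec_one s)), fun s hs => by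
      refine fib_ext fun t => ?_
      have hb : Φ.symm b0 = b := by rw [← hΦ, Φ.symm_apply_apply]
      rw [toFib_path, hpt]
      simp [f.2.2.1 _ (inJ_vec_of_boundary hs t), hb]⟩

lemma toLoop_path (f : BasedS) (s : Fin 3 → I) (t : I) :
    ((toLoop Φ hΦ hpt f).1 s).1.2 t = (Φ.symm (f.1 (vec s t)).1, Φ.symm (f.1 (vec s t)).2) := rfl

/-- The family of paths given by a family of points in the homotopy fibre. -/
noncomputable def ofFib {Z : Type*} [TopologicalSpace Z] (G : C(Z, Fib b)) (z : Z) (t : I) : X :=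
  (Φ ((G z).1.2 t).1, Φ ((G z).1.2 t).2)

lemma continuous_ofFib {Z : Type*} [TopologicalSpace Z] (G : C(Z, Fib b)) :
    Continuous fun p : Z × I => ofFib Φ G p.1 p.2 := by
  have : Continuous fun p : Z × I => (G p.1).1.2 p.2 := by
    have h1 : Continuous fun p : Z × I => (G p.1).1.2 := by fun_prop
    fun_prop
  unfold ofFib
  fun_prop

lemma inA_ofFib (hΦ : Φ b = b0) {Z : Type*} [TopologicalSpace Z] (G : C(Z, Fib b)) (z : Z) :
    InA (ofFib Φ G z 0) := by
  unfold ofFib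
  rw [(G z).2.1]
  rcases (G z).1.1.2 with h | h
  · exact Or.inl (by simp only [h, hΦ])
  · exact Or.inr (by simp only [h, hΦ])

lemma ofFib_one (hΦ : Φ b = b0) {Z : Type*} [TopologicalSpace Z] (G : C(Z, Fib b)) (z : Z) :
    ofFib Φ G z 1 = base := by
  unfold ofFib
  rw [(G z).2.2, hΦ]

lemma ofFib_pt (hΦ : Φ b = b0) (hpt : ∀ t, pt.1.2 t = (b, b)) {Z : Type*} [TopologicalSpace Z]
    (G : C(Z, Fib b)) {z : Z} (hz : G z = pt) (t : I) :
    ofFib Φ G z t = base := by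
  unfold ofFib
  rw [hz, hpt, hΦ]

lemma ofFib_mem_basedS (hΦ : Φ b = b0) (hpt : ∀ t, pt.1.2 t = (b, b)) (G : C(Fin 3 → I, Fib b))
    (hG : ∀ s ∈ Cube.boundary (Fin 3), G s = pt) :
    (fun y => ofFib Φ G (prs y) (prt y)) ∈ BasedS := by
  refine ⟨(continuous_ofFib Φ G).comp (continuous_prs.prodMk continuous_prt), fun y hy => ?_,
    fun y hy => ?_⟩
  · rcases prs_boundary hy with h | h
    · exact ofFib_pt Φ hΦ hpt G (hG _ h) _
    · simp only [h]; exact ofFib_one Φ hΦ G _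
  · have : prt y = 0 := projIcc_of_le_left zero_le_one hy
    simp only [this]; exact inA_ofFib Φ hΦ G _

/-- The homotopy class of a based map. -/
noncomputable def mk (f : BasedS) : π_ 3 (Fib b) pt :=
  (⟦toLoop Φ hΦ hpt f⟧ : HomotopyGroup (Fin 3) (Fib b) pt)

lemma mk_surjective : Function.Surjective (mk Φ hΦ hpt) := by
  intro x
  induction x using Quotient.inductionOn with
  | h g =>
    refine ⟨⟨_, ofFib_mem_basedS Φ hΦ hpt g.1 g.2⟩, ?_⟩
    refine congrArg _ (Subtype.ext (ContinuousMap.ext fun s => fib_ext fun t => ?_))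
    refine (toLoop_path Φ hΦ hpt _ s t).trans ?_
    simp [prs_vec, prt_vec, ofFib]

lemma mk_eq_of_htpy {f g : BasedS} (h : Htpy BasedS f.1 g.1) : mk Φ hΦ hpt f = mk Φ hΦ hpt g := by
  obtain ⟨H, hc, hS, h0, h1⟩ := h
  have hcc : Continuous fun p : (I × (Fin 3 → I)) × I => H p.1.1 (vec p.1.2 p.2) :=
    hc.comp ((by fun_prop : Continuous fun p : (I × (Fin 3 → I)) × I => (p.1.1 : ℝ)).prodMk
      (continuous_vec.comp (continuous_fst.snd.prodMk continuous_snd)))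
  obtain ⟨G, hp⟩ : ∃ G : C(I × (Fin 3 → I), Fib b), ∀ z t, (G z).1.2 t =
      (Φ.symm (H z.1 (vec z.2 t)).1, Φ.symm (H z.1 (vec z.2 t)).2) :=
    ⟨toFib Φ hΦ ⟨_, hcc⟩ (fun z => (hS _).2.2 _ (by simp [vec]))
      (fun z => (hS _).2.1 _ (inJ_vec_one _)), fun _ _ => rfl⟩
  refine Quotient.sound ⟨⟨⟨G, ?_, ?_⟩, ?_⟩⟩
  · intro s
    refine fib_ext fun t => ?_
    refine (hp _ t).trans (Eq.trans ?_ (toLoop_path Φ hΦ hpt _ s t).symm)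
    simp [h0]
  · intro s
    refine fib_ext fun t => ?_
    refine (hp _ t).trans (Eq.trans ?_ (toLoop_path Φ hΦ hpt _ s t).symm)
    simp [h1]
  · intro u s hs
    refine fib_ext fun t => ?_
    refine (hp _ t).trans (Eq.trans ?_ (toLoop_path Φ hΦ hpt _ s t).symm)
    simp [(hS _).2.1 _ (inJ_vec_of_boundary hs t), f.2.2.1 _ (inJ_vec_of_boundary hs t)]

lemma ofFib_toLoop (f : BasedS) (y : V) :
    ofFib Φ (toLoop Φ hΦ hpt f).1 (prs y) (prt y) = f.1 (clV y) := by
  unfold ofFib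
  rw [toLoop_path]
  simp [vec_prs_prt]

lemma htpy_of_mk_eq {f g : BasedS} (h : mk Φ hΦ hpt f = mk Φ hΦ hpt g) : Htpy BasedS f.1 g.1 := by
  have hcl : ∀ k ∈ BasedS, Htpy BasedS (fun y => k (clV y)) k := by
    intro k hk
    refine htpy_comp_of_faces hk continuous_clV ?_ ?_
    · intro y i hi
      exact (cl_of_le_zero hi).le
    · intro y i hi
      exact (cl_of_one_le hi).ge
  refine ((hcl f.1 f.2).symm.trans ?_).trans (hcl g.1 g.2)
  obtain ⟨H⟩ : GenLoop.Homotopic _ _ := Quotient.exact h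
  refine Htpy.of_Icc' (fun u y =>
    ofFib Φ H.toContinuousMap (projIcc 0 1 zero_le_one u, prs y) (prt y))
    ?_ ?_ ?_ ?_
  · refine (continuous_ofFib Φ _).comp (((continuous_projIcc.comp continuous_fst).prodMk
      (continuous_prs.comp continuous_snd)).prodMk (continuous_prt.comp continuous_snd))
  · intro u _ _
    refine ofFib_mem_basedS Φ hΦ hpt (H.toContinuousMap.comp
      ⟨fun s => (projIcc 0 1 zero_le_one u, s), by fun_prop⟩) ?_
    intro s hs
    refine (H.eq_fst _ hs).trans ?_
    exact (toLoop Φ hΦ hpt f).2 s hs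
  · funext y
    rw [← ofFib_toLoop Φ hΦ hpt f]
    simp [ofFib]
  · funext y
    rw [← ofFib_toLoop Φ hΦ hpt g]
    simp [ofFib]

end Bridge

/-- The concatenation of two maps in the first coordinate. -/
noncomputable def concat (f g : V → X) (y : V) : X :=
  if y 0 ≤ 1 / 2 then f ![2 * y 0, y 1, y 2, y 3] else g ![2 * y 0 - 1, y 1, y 2, y 3]

lemma concat_mem {f g : V → X} (hf : f ∈ BasedS) (hg : g ∈ BasedS) : concat f g ∈ BasedS := by
  refine ⟨?_, fun y hy => ?_, fun y hy => ?_⟩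
  · refine Continuous.if_le ?_ ?_ (continuous_apply 0) continuous_const ?_
    · refine hf.1.comp ?_
      apply continuous_vec4 <;> fun_prop
    · refine hg.1.comp ?_
      apply continuous_vec4 <;> fun_prop
    · intro y hy
      rw [hf.2.1, hg.2.1]
      · rw [inJ_iff]; simp [hy]
      · rw [inJ_iff]; simp [hy]
  · rw [inJ_iff] at hy
    unfold concat
    split_ifs with h
    · refine hf.2.1 _ (inJ_iff.2 ?_)
      simp
      rcases hy with h | h | h | h | h | h | h <;> first | simp [h] | (left; linarith)
    · refine hg.2.1 _ (inJ_iff.2 ?_)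
      simp
      rcases hy with h | h | h | h | h | h | h <;>
        first | simp [h] | (exfalso; linarith) | (right; left; linarith)
  · unfold concat
    split_ifs with h
    · exact hf.2.2 _ (by simpa using hy)
    · exact hg.2.2 _ (by simpa using hy)

/-- The reflection in the first coordinate. -/
def rfl0 (y : V) : V := ![1 - y 0, y 1, y 2, y 3]

lemma continuous_rfl0 : Continuous rfl0 := by
  unfold rfl0
  apply continuous_vec4 <;> fun_prop

lemma comp_rfl0_mem {f : V → X} (hf : f ∈ BasedS) : (fun y => f (rfl0 y)) ∈ BasedS := by
  refine ⟨hf.1.comp continuous_rfl0, fun y hy => hf.2.1 _ (inJ_iff.2 ?_),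
    fun y hy => hf.2.2 _ (by simpa [rfl0] using hy)⟩
  rw [inJ_iff] at hy
  simp [rfl0]
  tauto

lemma const_mem : (fun _ => base) ∈ BasedS :=
  ⟨continuous_const, fun _ _ => rfl, fun _ _ => inA_base⟩

section Classes

variable {S : Type} [TopologicalSpace S] {b : S} (Φ : S ≃ₜ Sph) (hΦ : Φ b = b0) {pt : Fib b}
  (hpt : ∀ t, pt.1.2 t = (b, b))

lemma mk_const : mk Φ hΦ hpt ⟨_, const_mem⟩ = 1 := by
  refine Eq.trans ?_ HomotopyGroup.one_def.symm
  refine congrArg _ (Subtype.ext (ContinuousMap.ext fun s => fib_ext fun t => ?_))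
  refine (toLoop_path Φ hΦ hpt _ s t).trans ?_
  have hb : Φ.symm b0 = b := by rw [← hΦ, Φ.symm_apply_apply]
  refine Eq.trans ?_ (hpt t).symm
  simp [hb]

lemma mk_concat (f g : BasedS) :
    mk Φ hΦ hpt ⟨_, concat_mem f.2 g.2⟩ = mk Φ hΦ hpt g * mk Φ hΦ hpt f := by
  refine Eq.trans ?_ (HomotopyGroup.mul_spec (i := (0 : Fin 3))).symm
  refine congrArg _ (Subtype.ext (ContinuousMap.ext fun s => fib_ext fun t => ?_))
  refine (toLoop_path Φ hΦ hpt _ s t).trans ?_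
  have h1 : (GenLoop.transAt (0 : Fin 3) (toLoop Φ hΦ hpt f) (toLoop Φ hΦ hpt g)).1 s =
      if (s 0 : ℝ) ≤ 1 / 2
        then (toLoop Φ hΦ hpt f).1 (Function.update s 0 (projIcc 0 1 zero_le_one (2 * s 0)))
        else (toLoop Φ hΦ hpt g).1 (Function.update s 0 (projIcc 0 1 zero_le_one (2 * s 0 - 1))) :=
    congrFun (GenLoop.coe_copy _ _) s
  rw [h1]
  have h2 := (s 0).2.1
  have h3 := (s 0).2.2
  by_cases hs : (s 0 : ℝ) ≤ 1 / 2
  · have h5 : vec (Function.update s 0 (projIcc 0 1 zero_le_one (2 * (s 0 : ℝ)))) t =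
        ![2 * (s 0 : ℝ), s 1, s 2, t] := by
      ext i; fin_cases i <;> simp [vec, coe_projIcc, Function.update]
      rw [min_eq_right (by linarith), max_eq_right (by linarith)]
    have h6 : concat f.1 g.1 (vec s t) = f.1 ![2 * (s 0 : ℝ), s 1, s 2, t] := if_pos hs
    rw [if_pos hs, toLoop_path, h5, ← h6]
  · have h5 : vec (Function.update s 0 (projIcc 0 1 zero_le_one (2 * (s 0 : ℝ) - 1))) t =
        ![2 * (s 0 : ℝ) - 1, s 1, s 2, t] := by
      ext i; fin_cases i <;> simp [vec, coe_projIcc, Function.update]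
      rw [min_eq_right (by linarith), max_eq_right (by linarith)]
    have h6 : concat f.1 g.1 (vec s t) = g.1 ![2 * (s 0 : ℝ) - 1, s 1, s 2, t] := if_neg hs
    rw [if_neg hs, toLoop_path, h5, ← h6]

lemma mk_comp_rfl0 (f : BasedS) :
    mk Φ hΦ hpt ⟨_, comp_rfl0_mem f.2⟩ = (mk Φ hΦ hpt f)⁻¹ := by
  refine Eq.trans ?_ (HomotopyGroup.inv_spec (i := (0 : Fin 3))).symm
  refine congrArg _ (Subtype.ext (ContinuousMap.ext fun s => fib_ext fun t => ?_))
  refine (toLoop_path Φ hΦ hpt _ s t).trans ?_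
  have h5 : rfl0 (vec s t) = vec (fun j => if j = 0 then unitInterval.symm (s 0) else s j) t := by
    ext i; fin_cases i <;> simp [vec, rfl0]
  simp only [h5]
  rfl

end Classes

end

/-! ### Cutting a map into slabs -/

/-- The hyperplane where the first coordinate is `c` is sent to the wedge. -/
def Wall (f : V → X) (c : ℝ) : Prop := ∀ y : V, y 0 = c → InA (f y)

/-- Reparametrisation of the first coordinate by `α`, pushing upwards by `β`. -/
def rep (α β : ℝ → ℝ) (f : V → X) (y : V) : X :=
  f ![α (y 0), y 1, y 2, y 3 + β (y 0) * (1 - y 3)]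

lemma wall_of_le {f : V → X} (hf : f ∈ BasedS) {c : ℝ} (hc : c ≤ 0) : Wall f c := by
  intro y hy
  rw [hf.2.1 y (inJ_iff.2 (Or.inl (hy ▸ hc)))]
  exact inA_base

lemma wall_of_ge {f : V → X} (hf : f ∈ BasedS) {c : ℝ} (hc : 1 ≤ c) : Wall f c := by
  intro y hy
  rw [hf.2.1 y (inJ_iff.2 (Or.inr (Or.inl (hy ▸ hc))))]
  exact inA_base

lemma htpy_rep {f : V → X} (hf : f ∈ BasedS) {α β α' β' : ℝ → ℝ} (hα : Continuous α)
    (hβ : Continuous β) (hα' : Continuous α') (hβ' : Continuous β')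
    (h0 : ∀ s, 0 ≤ β s) (h1 : ∀ s, β s ≤ 1) (h0' : ∀ s, 0 ≤ β' s) (h1' : ∀ s, β' s ≤ 1)
    (hw : ∀ s, (β s = 0 ∧ β' s = 0) ∨ (α s = α' s ∧ Wall f (α s)))
    (hend : ∀ s, (s ≤ 0 ∨ 1 ≤ s) →
      (β s = 1 ∧ β' s = 1) ∨ (α s ≤ 0 ∧ α' s ≤ 0) ∨ (1 ≤ α s ∧ 1 ≤ α' s)) :
    Htpy BasedS (rep α β f) (rep α' β' f) := by
  have hc := hf.1
  refine Htpy.of_Icc' (fun u => rep (fun s => (1 - u) * α s + u * α' s)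
    (fun s => (1 - u) * β s + u * β' s) f) ?_ ?_ (by simp) (by simp)
  · unfold rep
    refine hc.comp ?_
    apply continuous_vec4 <;> fun_prop
  · intro u hu hu'
    have b0 : ∀ s, 0 ≤ (1 - u) * β s + u * β' s := fun s => by
      have := h0 s; have := h0' s
      have := mul_nonneg hu (h0' s)
      have := mul_nonneg (sub_nonneg.2 hu') (h0 s)
      linarith
    have b1 : ∀ s, (1 - u) * β s + u * β' s ≤ 1 := fun s => by
      have := mul_nonneg hu (sub_nonneg.2 (h1' s))
      have := mul_nonneg (sub_nonneg.2 hu') (sub_nonneg.2 (h1 s))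
      linarith
    refine ⟨?_, fun y hy => ?_, fun y hy => ?_⟩
    · unfold rep
      refine hc.comp ?_
      apply continuous_vec4 <;> fun_prop
    · refine hf.2.1 _ (inJ_iff.2 ?_)
      rw [inJ_iff] at hy
      have hend' : (y 0 ≤ 0 ∨ 1 ≤ y 0) → (1 - u) * α (y 0) + u * α' (y 0) ≤ 0 ∨
          1 ≤ (1 - u) * α (y 0) + u * α' (y 0) ∨
          1 ≤ y 3 + ((1 - u) * β (y 0) + u * β' (y 0)) * (1 - y 3) := by
        intro h
        rcases hend _ h with ⟨e1, e2⟩ | ⟨e1, e2⟩ | ⟨e1, e2⟩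
        · right; right; rw [e1, e2]; linarith
        · left; nlinarith
        · right; left; nlinarith
      simp
      rcases hy with h | h | h | h | h | h | h
      · have := hend' (Or.inl h); tauto
      · have := hend' (Or.inr h); tauto
      · tauto
      · tauto
      · tauto
      · tauto
      · right; right; right; right; right; right
        nlinarith [b1 (y 0)]
    · rcases hw (y 0) with ⟨e1, e2⟩ | ⟨e1, e2⟩
      · exact hf.2.2 _ (by simp [e1, e2, hy])
      · refine e2 _ ?_
        simp only [← e1, Matrix.cons_val_zero]
        ring

/-- The first coordinate of a slab. -/
def sα (a c s : ℝ) : ℝ := a + (c - a) * cl (3 * s - 1)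

/-- The push of a slab. -/
def sβ (s : ℝ) : ℝ := cl (max (1 - 3 * s) (3 * s - 2))

/-- The part of `f` between two walls. -/
def slab (f : V → X) (a c : ℝ) : V → X := rep (sα a c) sβ f

@[fun_prop] lemma continuous_sα (a c : ℝ) : Continuous (sα a c) := by unfold sα; fun_prop

@[fun_prop] lemma continuous_sβ : Continuous sβ := by unfold sβ; fun_prop

lemma sα_left {a c s : ℝ} (h : s ≤ 1 / 3) : sα a c s = a := by
  simp [sα, cl_of_le_zero (show 3 * s - 1 ≤ 0 by linarith)]

lemma sα_right {a c s : ℝ} (h : 2 / 3 ≤ s) : sα a c s = c := by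
  simp [sα, cl_of_one_le (show 1 ≤ 3 * s - 1 by linarith)]

lemma sβ_mid {s : ℝ} (h : 1 / 3 ≤ s) (h' : s ≤ 2 / 3) : sβ s = 0 :=
  cl_of_le_zero (max_le (by linarith) (by linarith))

lemma sβ_end {s : ℝ} (h : s ≤ 0 ∨ 1 ≤ s) : sβ s = 1 := by
  rcases h with h | h
  · exact cl_of_one_le (le_max_of_le_left (by linarith))
  · exact cl_of_one_le (le_max_of_le_right (by linarith))

lemma htpy_slab_zero_one {f : V → X} (hf : f ∈ BasedS) : Htpy BasedS f (slab f 0 1) := by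
  have e1 : f = rep id 0 f := by
    funext y
    simp only [rep, id, Pi.zero_apply, zero_mul, add_zero]
    congr 1
    ext i; fin_cases i <;> rfl
  have h1 : Htpy BasedS (rep id 0 f) (rep (sα 0 1) 0 f) := by
    refine htpy_rep hf continuous_id continuous_zero (by fun_prop) continuous_zero (by simp)
      (by simp) (by simp) (by simp) (by simp) ?_
    rintro s (h | h)
    · right; left; exact ⟨h, (sα_left (by linarith)).le⟩
    · right; right; exact ⟨h, (sα_right (by linarith)).ge⟩
  have h2 : Htpy BasedS (rep (sα 0 1) 0 f) (rep (sα 0 1) sβ f) := by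
    refine htpy_rep hf (by fun_prop) continuous_zero (by fun_prop) (by fun_prop) (by simp)
      (by simp) (fun _ => cl_nonneg _) (fun _ => cl_le_one _) ?_ ?_
    · intro s
      by_cases h : s ≤ 1 / 3
      · right; exact ⟨rfl, wall_of_le hf (sα_left h).le⟩
      by_cases h' : 2 / 3 ≤ s
      · right; exact ⟨rfl, wall_of_ge hf (sα_right h').ge⟩
      · left; exact ⟨rfl, sβ_mid (by linarith) (by linarith)⟩
    · rintro s (h | h)
      · right; left; exact ⟨(sα_left (by linarith)).le, (sα_left (by linarith)).le⟩
      · right; right; exact ⟨(sα_right (by linarith)).ge, (sα_right (by linarith)).ge⟩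
  rw [← e1] at h1
  exact h1.trans h2

lemma slab_self {f : V → X} (hf : f ∈ BasedS) {a c : ℝ} (ha : Wall f a) (hc : Wall f c) :
    Htpy BasedS (slab f a c) (slab f a c) := by
  refine htpy_rep hf (by fun_prop) (by fun_prop) (by fun_prop) (by fun_prop) (fun _ => cl_nonneg _)
    (fun _ => cl_le_one _) (fun _ => cl_nonneg _) (fun _ => cl_le_one _) (fun s => ?_)
    (fun s hs => Or.inl ⟨sβ_end hs, sβ_end hs⟩)
  by_cases h : s ≤ 1 / 3
  · right; exact ⟨rfl, by rwa [sα_left h]⟩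
  by_cases h' : 2 / 3 ≤ s
  · right; exact ⟨rfl, by rwa [sα_right h']⟩
  · left; exact ⟨sβ_mid (by linarith) (by linarith), sβ_mid (by linarith) (by linarith)⟩

lemma slab_mem {f : V → X} (hf : f ∈ BasedS) {a c : ℝ} (ha : Wall f a) (hc : Wall f c) :
    slab f a c ∈ BasedS := by
  obtain ⟨H, -, hS, h0, -⟩ := slab_self hf ha hc
  exact h0 ▸ hS 0

lemma htpy_slab_const {f : V → X} (hf : f ∈ BasedS) {a c : ℝ} (hac : a ≤ c)
    (hw : ∀ t, a ≤ t → t ≤ c → Wall f t) : Htpy BasedS (slab f a c) (fun _ => base) := by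
  have h : Htpy BasedS (slab f a c) (rep (sα a c) 1 f) := by
    refine htpy_rep hf (by fun_prop) (by fun_prop) (by fun_prop) continuous_one
      (fun _ => cl_nonneg _) (fun _ => cl_le_one _) (by simp) (by simp) (fun s => ?_)
      (fun s hs => Or.inl ⟨sβ_end hs, rfl⟩)
    right
    refine ⟨rfl, hw _ ?_ ?_⟩
    · unfold sα; nlinarith [cl_nonneg (3 * s - 1)]
    · unfold sα; nlinarith [cl_le_one (3 * s - 1)]
  convert h using 1
  funext y
  exact (hf.2.1 _ (inJ_iff.2 (by simp))).symm

/-- The first coordinate of the concatenation of two slabs. -/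
def cα (a b c s : ℝ) : ℝ := a + (b - a) * cl (6 * s - 1) + (c - b) * cl (6 * s - 4)

/-- The push of the concatenation of two slabs. -/
def cβ (s : ℝ) : ℝ := cl (max (max (1 - 6 * s) (6 * s - 5)) (min (6 * s - 2) (4 - 6 * s)))

/-- The push of the concatenation of two slabs, without the central one. -/
def cβ' (s : ℝ) : ℝ := cl (max (1 - 6 * s) (6 * s - 5))

lemma concat_slab (f : V → X) (a b c : ℝ) :
    concat (slab f a b) (slab f b c) = rep (cα a b c) cβ f := by
  funext y
  unfold concat
  split_ifs with h
  · have h1 : sα a b (2 * y 0) = cα a b c (y 0) := by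
      have : cl (6 * y 0 - 4) = 0 := cl_of_le_zero (by linarith)
      simp only [sα, cα, this]
      ring_nf
    have h2 : sβ (2 * y 0) = cβ (y 0) := by
      unfold sβ cβ
      rw [min_eq_left (by linarith), max_assoc, max_eq_right (a := 6 * y 0 - 5) (by linarith)]
      ring_nf
    simp [slab, rep, h1, h2]
  · have h1 : sα b c (2 * y 0 - 1) = cα a b c (y 0) := by
      have : cl (6 * y 0 - 1) = 1 := cl_of_one_le (by linarith)
      simp only [sα, cα, this]
      ring_nf
    have h2 : sβ (2 * y 0 - 1) = cβ (y 0) := by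
      unfold sβ cβ
      rw [min_eq_right (by linarith), max_comm _ (4 - 6 * y 0), ← max_assoc,
        max_eq_left (a := 4 - 6 * y 0) (by linarith)]
      ring_nf
    simp [slab, rep, h1, h2]

lemma htpy_concat_slab {f : V → X} (hf : f ∈ BasedS) {a b c : ℝ} (ha : Wall f a) (hb : Wall f b)
    (hc : Wall f c) : Htpy BasedS (slab f a c) (concat (slab f a b) (slab f b c)) := by
  rw [concat_slab]
  have k0 : Continuous (cα a b c) := by unfold cα; fun_prop
  have k1 : Continuous cβ := by unfold cβ; fun_prop
  have k2 : Continuous cβ' := by unfold cβ'; fun_prop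
  have eβ : ∀ s, (s ≤ 0 ∨ 1 ≤ s) → cβ s = 1 := by
    rintro s (h | h)
    · exact cl_of_one_le (le_max_of_le_left (le_max_of_le_left (by linarith)))
    · exact cl_of_one_le (le_max_of_le_left (le_max_of_le_right (by linarith)))
  have eβ' : ∀ s, (s ≤ 0 ∨ 1 ≤ s) → cβ' s = 1 := by
    rintro s (h | h)
    · exact cl_of_one_le (le_max_of_le_left (by linarith))
    · exact cl_of_one_le (le_max_of_le_right (by linarith))
  have β'mid : ∀ s, 1 / 6 ≤ s → s ≤ 5 / 6 → cβ' s = 0 := fun s h h' =>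
    cl_of_le_zero (max_le (by linarith) (by linarith))
  have αl : ∀ s, s ≤ 1 / 6 → cα a b c s = a := fun s h => by
    simp [cα, cl_of_le_zero (show 6 * s - 1 ≤ 0 by linarith),
      cl_of_le_zero (show 6 * s - 4 ≤ 0 by linarith)]
  have αr : ∀ s, 5 / 6 ≤ s → cα a b c s = c := fun s h => by
    simp [cα, cl_of_one_le (show 1 ≤ 6 * s - 1 by linarith),
      cl_of_one_le (show 1 ≤ 6 * s - 4 by linarith)]
  have αm : ∀ s, 1 / 3 ≤ s → s ≤ 2 / 3 → cα a b c s = b := fun s h h' => by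
    simp [cα, cl_of_one_le (show 1 ≤ 6 * s - 1 by linarith),
      cl_of_le_zero (show 6 * s - 4 ≤ 0 by linarith)]
  have h1 : Htpy BasedS (slab f a c) (rep (sα a c) cβ' f) := by
    refine htpy_rep hf (by fun_prop) (by fun_prop) (by fun_prop) k2 (fun _ => cl_nonneg _)
      (fun _ => cl_le_one _) (fun _ => cl_nonneg _) (fun _ => cl_le_one _) (fun s => ?_)
      (fun s hs => Or.inl ⟨sβ_end hs, eβ' s hs⟩)
    by_cases h : s ≤ 1 / 3
    · right; exact ⟨rfl, by rwa [sα_left h]⟩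
    by_cases h' : 2 / 3 ≤ s
    · right; exact ⟨rfl, by rwa [sα_right h']⟩
    · left; exact ⟨sβ_mid (by linarith) (by linarith), β'mid s (by linarith) (by linarith)⟩
  have h2 : Htpy BasedS (rep (sα a c) cβ' f) (rep (cα a b c) cβ' f) := by
    refine htpy_rep hf (by fun_prop) k2 k0 k2 (fun _ => cl_nonneg _)
      (fun _ => cl_le_one _) (fun _ => cl_nonneg _) (fun _ => cl_le_one _) (fun s => ?_)
      (fun s hs => Or.inl ⟨eβ' s hs, eβ' s hs⟩)
    by_cases h : s ≤ 1 / 6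
    · right
      rw [sα_left (by linarith), αl s h]
      exact ⟨rfl, ha⟩
    by_cases h' : 5 / 6 ≤ s
    · right
      rw [sα_right (by linarith), αr s h']
      exact ⟨rfl, hc⟩
    · left
      have := β'mid s (by linarith) (by linarith)
      exact ⟨this, this⟩
  have h3 : Htpy BasedS (rep (cα a b c) cβ' f) (rep (cα a b c) cβ f) := by
    refine htpy_rep hf k0 k2 k0 k1 (fun _ => cl_nonneg _)
      (fun _ => cl_le_one _) (fun _ => cl_nonneg _) (fun _ => cl_le_one _) (fun s => ?_)
      (fun s hs => Or.inl ⟨eβ' s hs, eβ s hs⟩)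
    by_cases g1 : s ≤ 1 / 6
    · right; rw [αl s g1]; exact ⟨rfl, ha⟩
    by_cases g2 : 5 / 6 ≤ s
    · right; rw [αr s g2]; exact ⟨rfl, hc⟩
    by_cases g3 : 1 / 3 ≤ s ∧ s ≤ 2 / 3
    · right; rw [αm s g3.1 g3.2]; exact ⟨rfl, hb⟩
    · left
      refine ⟨β'mid s (by linarith) (by linarith), cl_of_le_zero (max_le (max_le (by linarith)
        (by linarith)) ?_)⟩
      by_cases g4 : s ≤ 1 / 3
      · exact (min_le_left _ _).trans (by linarith)
      · have : 2 / 3 < s := by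
          by_contra g5
          exact g3 ⟨by linarith, by linarith⟩
        exact (min_le_right _ _).trans (by linarith)
  exact (h1.trans h2).trans h3

/-- If all slabs around the centres lie in a subgroup, so does the map. -/
lemma mem_of_slabs {G : Type*} [Group G] {mk : BasedS → G}
    (hm : ∀ f g : BasedS, Htpy BasedS f.1 g.1 → mk f = mk g)
    (hconcat : ∀ f g : BasedS, mk ⟨_, concat_mem f.2 g.2⟩ = mk g * mk f)
    (hconst : mk ⟨_, const_mem⟩ = 1) (H : Subgroup G) (f : BasedS) (P : Finset ℝ) {ρ : ℝ}
    (hρ : 0 < ρ) (hP0 : ∀ x ∈ P, ρ ≤ x) (hP1 : ∀ x ∈ P, x + ρ ≤ 1)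
    (hsep : ∀ x ∈ P, ∀ x' ∈ P, x < x' → x + 2 * ρ ≤ x')
    (hwall : ∀ c, (∀ x ∈ P, ρ ≤ |c - x|) → Wall f.1 c)
    (hslab : ∀ x ∈ P, ∀ h : slab f.1 (x - ρ) (x + ρ) ∈ BasedS, mk ⟨_, h⟩ ∈ H) : mk f ∈ H := by
  have hw0 : Wall f.1 0 := wall_of_le f.2 le_rfl
  have hw1 : Wall f.1 1 := wall_of_ge f.2 le_rfl
  have hfar : ∀ x ∈ P, Wall f.1 (x - ρ) ∧ Wall f.1 (x + ρ) := by
    intro x hx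
    constructor
    · refine hwall _ fun x' hx' => ?_
      rcases lt_trichotomy x x' with h | h | h
      · have := hsep x hx x' hx' h
        rw [le_abs]; right; linarith
      · rw [le_abs]; right; linarith
      · have := hsep x' hx' x hx h
        rw [le_abs]; left; linarith
    · refine hwall _ fun x' hx' => ?_
      rcases lt_trichotomy x x' with h | h | h
      · have := hsep x hx x' hx' h
        rw [le_abs]; right; linarith
      · rw [le_abs]; left; linarith
      · have := hsep x' hx' x hx h
        rw [le_abs]; left; linarith
  have key : ∀ s : Finset ℝ, s ⊆ P → ∀ c, 0 ≤ c → (∀ x ∈ s, x + ρ ≤ c) →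
      (∀ x ∈ P, x ∉ s → c + ρ ≤ x) → ∀ h : slab f.1 0 c ∈ BasedS, mk ⟨_, h⟩ ∈ H := by
    intro s
    induction s using Finset.induction_on_max with
    | empty =>
      intro _ c hc _ hfr h
      have : mk ⟨_, h⟩ = mk ⟨_, const_mem⟩ := by
        refine hm _ _ (htpy_slab_const f.2 hc fun t ht ht' => hwall t fun x hx => ?_)
        have := hfr x hx (by simp)
        rw [le_abs]; right; linarith
      rw [this, hconst]
      exact H.one_mem
    | insert a s hlt ih =>
      intro hs c hc hin hout h
      have ha : a ∈ P := hs (Finset.mem_insert_self _ _)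
      have hca := hin a (Finset.mem_insert_self _ _)
      have hwc : Wall f.1 c := by
        refine hwall c fun x hx => ?_
        by_cases hxs : x ∈ insert a s
        · have := hin x hxs
          rw [le_abs]; left; linarith
        · have := hout x hx hxs
          rw [le_abs]; right; linarith
      have m1 := slab_mem f.2 hw0 (hfar a ha).1
      have m2 := slab_mem f.2 (hfar a ha).1 (hfar a ha).2
      have m3 := slab_mem f.2 (hfar a ha).2 hwc
      have m4 := slab_mem f.2 (hfar a ha).1 hwc
      have e1 : mk ⟨_, h⟩ = mk ⟨_, m4⟩ * mk ⟨_, m1⟩ :=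
        (hm _ ⟨_, concat_mem m1 m4⟩ (htpy_concat_slab f.2 hw0 (hfar a ha).1 hwc)).trans
          (hconcat ⟨_, m1⟩ ⟨_, m4⟩)
      have e2 : mk ⟨_, m4⟩ = mk ⟨_, m3⟩ * mk ⟨_, m2⟩ :=
        (hm _ ⟨_, concat_mem m2 m3⟩ (htpy_concat_slab f.2 (hfar a ha).1 (hfar a ha).2 hwc)).trans
          (hconcat ⟨_, m2⟩ ⟨_, m3⟩)
      have e3 : mk ⟨_, m3⟩ = 1 := by
        rw [← hconst]
        refine hm _ _ (htpy_slab_const f.2 hca fun t ht ht' => hwall t fun x hx => ?_)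
        by_cases hxs : x ∈ insert a s
        · rcases Finset.mem_insert.1 hxs with rfl | hxs
          · rw [le_abs]; left; linarith
          · have := hlt x hxs
            rw [le_abs]; left; linarith
        · have := hout x hx hxs
          rw [le_abs]; right; linarith
      rw [e1, e2, e3, one_mul]
      refine H.mul_mem (hslab a ha m2) (ih (fun x hx => hs (Finset.mem_insert_of_mem hx)) _
        (by linarith [hP0 a ha]) (fun x hx => ?_) (fun x hx hxs => ?_) m1)
      · have := hsep x (hs (Finset.mem_insert_of_mem hx)) a ha (hlt x hx)
        linarith
      · by_cases hxa : x = a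
        · linarith
        · have := hout x hx (by simp [hxa, hxs])
          linarith
  have hmem := slab_mem f.2 hw0 hw1
  rw [hm f ⟨_, hmem⟩ (htpy_slab_zero_one f.2)]
  exact key P le_rfl 1 zero_le_one hP1 (fun x hx hx' => absurd hx hx') hmem

/-! ### Paths of invertible matrices -/

/-- Real square matrices of size four. -/
abbrev Mat := Matrix (Fin 4) (Fin 4) ℝ

/-- Two matrices are joined by a path of invertible matrices. -/
def Conn (M N : Mat) : Prop := Htpy {f : Unit → Mat | (f ()).det ≠ 0} (fun _ => M) (fun _ => N)

lemma Conn.of_path {M N : Mat} (γ : ℝ → Mat) (hγ : Continuous γ)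
    (h : ∀ u, 0 ≤ u → u ≤ 1 → (γ u).det ≠ 0) (h0 : γ 0 = M) (h1 : γ 1 = N) : Conn M N :=
  Htpy.of_Icc' (fun u _ => γ u) (hγ.comp continuous_fst) h (by rw [h0]) (by rw [h1])

lemma Conn.exists_path {M N : Mat} (h : Conn M N) :
    ∃ γ : ℝ → Mat, Continuous γ ∧ (∀ u, (γ u).det ≠ 0) ∧ γ 0 = M ∧ γ 1 = N := by
  obtain ⟨H, hc, hS, h0, h1⟩ := h
  exact ⟨fun u => H u (), hc.comp (by fun_prop : Continuous fun u : ℝ => (u, ())), hS,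
    congrFun h0 (), congrFun h1 ()⟩

lemma Conn.mul {M N M' N' : Mat} (h : Conn M N) (h' : Conn M' N') : Conn (M * M') (N * N') := by
  obtain ⟨γ, hc, hS, h0, h1⟩ := h.exists_path
  obtain ⟨γ', hc', hS', h0', h1'⟩ := h'.exists_path
  refine Conn.of_path (fun u => γ u * γ' u) (hc.mul hc') (fun u _ _ => ?_) (by simp [h0, h0'])
    (by simp [h1, h1'])
  rw [Matrix.det_mul]
  exact mul_ne_zero (hS u) (hS' u)

/-- The reflection of a coordinate. -/
def flip (i : Fin 4) : Mat := Matrix.diagonal (Function.update 1 i (-1))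

lemma flip_mul_flip (i : Fin 4) : flip i * flip i = 1 := by
  rw [flip, Matrix.diagonal_mul_diagonal, ← Matrix.diagonal_one]
  congr 1
  ext j
  by_cases h : j = i
  · subst h; simp
  · simp [Function.update_of_ne h]

lemma conn_flip (i : Fin 4) : Conn (flip i) (flip 0) := by
  set v : ℝ → V := fun u => (1 - u) • Pi.single i 1 + u • Pi.single 0 1 with hv
  have hvc : Continuous v := by fun_prop
  have key : ∀ u : ℝ, 0 ≤ u → u ≤ 1 → v u ⬝ᵥ v u ≠ 0 := by
    intro u hu hu'
    simp only [hv, dotProduct_add, add_dotProduct, smul_dotProduct, dotProduct_smul,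
      single_dotProduct, smul_eq_mul]
    by_cases h : i = 0
    · subst h; simp
    · simp [Pi.single_eq_of_ne h, Pi.single_eq_of_ne (Ne.symm h)]
      nlinarith [sq_nonneg (1 - 2 * u)]
  refine Conn.of_path
    (fun u => (v u ⬝ᵥ v u) • (1 : Mat) - (2 : ℝ) • Matrix.vecMulVec (v u) (v u)) ?_ ?_ ?_ ?_
  · have h1 : Continuous fun u => v u ⬝ᵥ v u := hvc.dotProduct hvc
    have h2 : Continuous fun u => Matrix.vecMulVec (v u) (v u) := hvc.matrix_vecMulVec hvc
    fun_prop
  · intro u hu hu' h0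
    have h1 : ((v u ⬝ᵥ v u) • (1 : Mat) - (2 : ℝ) • Matrix.vecMulVec (v u) (v u)) *
        ((v u ⬝ᵥ v u) • (1 : Mat) - (2 : ℝ) • Matrix.vecMulVec (v u) (v u)) =
        (v u ⬝ᵥ v u) ^ 2 • (1 : Mat) := by
      simp only [sub_mul, mul_sub, smul_mul_assoc, mul_smul_comm, one_mul, mul_one,
        Matrix.vecMulVec_mul_vecMulVec, Matrix.vecMulVec_smul, smul_smul]
      module
    have h2 := congrArg Matrix.det h1
    rw [Matrix.det_mul, h0, Matrix.det_smul] at h2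
    simp at h2
    exact key u hu hu' (pow_eq_zero_iff (by norm_num) |>.1
      (pow_eq_zero_iff (by norm_num) |>.1 h2.symm))
  all_goals
    ext j k
    simp [hv, flip, Matrix.vecMulVec_apply, Matrix.diagonal_apply, Matrix.one_apply,
      Function.update_apply, Pi.single_apply]
    split_ifs <;> simp_all <;> norm_num

lemma conn_diagonal_update (i : Fin 4) {d : ℝ} (hd : d ≠ 0) :
    Conn (Matrix.diagonal (Function.update 1 i d)) 1 ∨
      Conn (Matrix.diagonal (Function.update 1 i d)) (flip 0) := by
  have key : ∀ e : ℝ, 0 < d * e → Conn (Matrix.diagonal (Function.update 1 i d))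
      (Matrix.diagonal (Function.update 1 i e)) := by
    intro e he
    refine Conn.of_path
      (fun u => Matrix.diagonal (Function.update 1 i ((1 - u) * d + u * e))) ?_ ?_ (by simp)
      (by simp)
    · refine Continuous.matrix_diagonal (continuous_const.update i ?_)
      fun_prop
    · intro u hu hu'
      rw [Matrix.det_diagonal, Finset.prod_update_of_mem (Finset.mem_univ _)]
      simp only [Pi.one_apply, Finset.prod_const_one, mul_one]
      intro h
      have h1 : (1 - u) * d ^ 2 + u * (d * e) = 0 := by linear_combination d * h
      have h2 : 0 < d ^ 2 := by positivity
      rcases eq_or_lt_of_le hu with rfl | hu0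
      · simp at h1; exact hd h1
      · nlinarith [mul_pos hu0 he, mul_nonneg (sub_nonneg.2 hu') h2.le]
  rcases lt_or_gt_of_ne hd with h | h
  · right; exact (key (-1) (by linarith)).trans (conn_flip i)
  · left
    have := key 1 (by linarith)
    have e : Matrix.diagonal (Function.update (1 : V) i 1) = 1 := by
      rw [← Matrix.diagonal_one]; congr 1; simp; rfl
    rwa [e] at this

lemma Conn.mul_or {A B : Mat} (hA : Conn A 1 ∨ Conn A (flip 0))
    (hB : Conn B 1 ∨ Conn B (flip 0)) : Conn (A * B) 1 ∨ Conn (A * B) (flip 0) := by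
  rcases hA with hA | hA <;> rcases hB with hB | hB <;> have := hA.mul hB
  · left; simpa using this
  · right; simpa using this
  · right; simpa using this
  · left; rwa [flip_mul_flip] at this

/-- An invertible matrix is joined either to the identity or to a reflection. -/
lemma conn_one_or_flip {M : Mat} (hM : M.det ≠ 0) : Conn M 1 ∨ Conn M (flip 0) := by
  refine Matrix.diagonal_transvection_induction_of_det_ne_zero
    (fun M => Conn M 1 ∨ Conn M (flip 0)) M hM (fun D hD => ?_) (fun t => ?_)
    (fun A B _ _ hA hB => Conn.mul_or hA hB)
  · have e : Matrix.diagonal D = Matrix.diagonal (Function.update 1 0 (D 0)) *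
        Matrix.diagonal (Function.update 1 1 (D 1)) * Matrix.diagonal (Function.update 1 2 (D 2)) *
        Matrix.diagonal (Function.update 1 3 (D 3)) := by
      simp only [Matrix.diagonal_mul_diagonal]
      congr 1
      ext i
      fin_cases i <;> simp
    rw [Matrix.det_diagonal, Finset.prod_ne_zero_iff] at hD
    have := fun i => conn_diagonal_update i (hD i (Finset.mem_univ _))
    rw [e]
    exact Conn.mul_or (Conn.mul_or (Conn.mul_or (this 0) (this 1)) (this 2)) (this 3)
  · left
    refine Conn.of_path (fun u => Matrix.transvection t.i t.j ((1 - u) * t.c)) ?_ ?_ ?_ ?_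
    · have : (fun u : ℝ => Matrix.transvection t.i t.j ((1 - u) * t.c)) =
          fun u => (1 : Mat) + ((1 - u) * t.c) • Matrix.single t.i t.j (1 : ℝ) := by
        funext u
        rw [Matrix.transvection, Matrix.smul_single, smul_eq_mul, mul_one]
      rw [this]
      fun_prop
    · intro u _ _
      rw [Matrix.det_transvection_of_ne _ _ t.hij]
      exact one_ne_zero
    · simp [Matrix.TransvectionStruct.toMatrix]
    · simp

/-! ### Maps of the cube without zeros on the boundary -/

/-- The collapse of each factor. -/
noncomputable def EE (T : ℂ × ℂ) : X := (E T.1, E T.2)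

@[fun_prop] lemma continuous_EE : Continuous EE := by
  unfold EE
  exact (continuous_E.comp continuous_fst).prodMk (continuous_E.comp continuous_snd)

lemma inA_EE_iff (T : ℂ × ℂ) : InA (EE T) ↔ 1 ≤ ‖T‖ := by
  simp [InA, EE, E_eq_b0_iff, Prod.norm_def]

/-- The boundary of the unit cube. -/
def Bd : Set V := {y | (∀ i, 0 ≤ y i ∧ y i ≤ 1) ∧ ∃ i, y i = 0 ∨ y i = 1}

lemma isCompact_bd : IsCompact Bd := by
  refine (isCompact_Icc (a := (0 : V)) (b := 1)).of_isClosed_subset ?_ ?_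
  · have : Bd = (⋂ i, {y : V | 0 ≤ y i ∧ y i ≤ 1}) ∩ ⋃ i, {y : V | y i = 0 ∨ y i = 1} := by
      ext y; simp [Bd]
    rw [this]
    refine (isClosed_iInter fun i => ?_).inter (isClosed_iUnion_of_finite fun i => ?_)
    · exact (isClosed_le continuous_const (continuous_apply i)).inter
        (isClosed_le (continuous_apply i) continuous_const)
    · exact (isClosed_eq (continuous_apply i) continuous_const).union
        (isClosed_eq (continuous_apply i) continuous_const)
  · exact fun y hy => ⟨fun i => (hy.1 i).1, fun i => (hy.1 i).2⟩

/-- The centred coordinates of the cube. -/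
def ctr (y : V) : V := fun i => 2 * y i - 1

@[fun_prop] lemma continuous_ctr : Continuous ctr := by unfold ctr; fun_prop

lemma norm_ctr {y : V} (hy : y ∈ Bd) : ‖ctr y‖ = 1 := by
  refine le_antisymm ((pi_norm_le_iff_of_nonneg zero_le_one).2 fun i => ?_) ?_
  · rw [Real.norm_eq_abs, abs_le]
    have := hy.1 i
    constructor <;> simp only [ctr] <;> linarith
  · obtain ⟨i, hi⟩ := hy.2
    refine le_trans (le_of_eq ?_) (norm_le_pi_norm (ctr y) i)
    rcases hi with hi | hi <;> simp [ctr, hi] <;> norm_num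

/-- Maps of the cube without zeros on the boundary. -/
def NS : Set (V → ℂ × ℂ) := {T | Continuous T ∧ ∀ y ∈ Bd, T y ≠ 0}

lemma htpy_line {T T' : V → ℂ × ℂ} (hT : Continuous T) (hT' : Continuous T')
    (h : ∀ y ∈ Bd, ∀ u : ℝ, 0 ≤ u → u ≤ 1 → (1 - u) • T y + u • T' y ≠ 0) : Htpy NS T T' :=
  Htpy.of_Icc' (fun u y => (1 - u) • T y + u • T' y) (by fun_prop)
    (fun u hu hu' => ⟨by fun_prop, fun y hy => h y hy u hu hu'⟩) (by simp) (by simp)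

lemma htpy_free_scale {T : V → ℂ × ℂ} (hT : Continuous T) (h : ∀ y ∈ Bd, 1 ≤ ‖T y‖) {D : V → V}
    (hD : Continuous D) (hDB : ∀ y, InB y → D y ∈ Bd) {K : ℝ} (hK : 1 ≤ K) :
    Htpy FreeS (fun y => EE (T (D y))) (fun y => EE (K • T (D y))) := by
  refine Htpy.of_Icc' (fun u y => EE ((1 + u * (K - 1)) • T (D y))) (by fun_prop)
    (fun u hu hu' => ⟨by fun_prop, fun y hy => ?_⟩) (by simp) (by simp)
  rw [inA_EE_iff, norm_smul, Real.norm_eq_abs]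
  have h1 := h _ (hDB y hy)
  have h2 : 1 ≤ |1 + u * (K - 1)| := by
    rw [le_abs]; left; nlinarith
  nlinarith

/-- A homotopy without zeros on the boundary gives a free homotopy of the collapses. -/
lemma htpy_free_of_htpy {T T' : V → ℂ × ℂ} (h : Htpy NS T T') (h0 : ∀ y ∈ Bd, 1 ≤ ‖T y‖)
    (h1 : ∀ y ∈ Bd, 1 ≤ ‖T' y‖) {D : V → V} (hD : Continuous D) (hDB : ∀ y, InB y → D y ∈ Bd) :
    Htpy FreeS (fun y => EE (T (D y))) (fun y => EE (T' (D y))) := by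
  obtain ⟨H, hc, hS, rfl, rfl⟩ := h
  obtain ⟨m, hm, hmin⟩ : ∃ m : ℝ, 0 < m ∧ ∀ u ∈ Icc (0 : ℝ) 1, ∀ y ∈ Bd, m ≤ ‖H u y‖ := by
    have hcomp : IsCompact (Icc (0 : ℝ) 1 ×ˢ Bd) := isCompact_Icc.prod isCompact_bd
    have hne : (Icc (0 : ℝ) 1 ×ˢ Bd).Nonempty :=
      ⟨(0, 0), by simp, ⟨fun i => by simp, 0, by simp⟩⟩
    obtain ⟨p, hp, hpm⟩ := hcomp.exists_isMinOn hne hc.norm.continuousOn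
    exact ⟨‖H p.1 p.2‖, norm_pos_iff.2 ((hS _).2 _ hp.2), fun u hu y hy =>
      hpm (show (u, y) ∈ Icc (0 : ℝ) 1 ×ˢ Bd from ⟨hu, hy⟩)⟩
  set K : ℝ := max 1 m⁻¹
  have hK : 1 ≤ K := le_max_left _ _
  have hKm : 1 ≤ K * m := by
    rw [← inv_mul_cancel₀ hm.ne']
    exact mul_le_mul_of_nonneg_right (le_max_right _ _) hm.le
  refine ((htpy_free_scale (hS 0).1 h0 hD hDB hK).trans ?_).trans
    (htpy_free_scale (hS 1).1 h1 hD hDB hK).symm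
  refine Htpy.of_Icc' (fun u y => EE (K • H u (D y))) ?_
    (fun u hu hu' => ⟨?_, fun y hy => ?_⟩) rfl rfl
  · have : Continuous fun p : ℝ × V => H p.1 (D p.2) :=
      hc.comp (by fun_prop : Continuous fun p : ℝ × V => (p.1, D p.2))
    fun_prop
  · have := (hS u).1
    fun_prop
  · rw [inA_EE_iff, norm_smul, Real.norm_eq_abs, abs_of_pos (by linarith)]
    exact hKm.trans (mul_le_mul_of_nonneg_left (hmin u ⟨hu, hu'⟩ _ (hDB y hy)) (by linarith))

/-- The retraction to the cube, stretched in the first coordinate. -/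
def chi (y : V) : V := ![cl (3 * y 0 - 1), cl (y 1), cl (y 2), cl (y 3)]

@[fun_prop] lemma continuous_chi : Continuous chi := by
  apply continuous_vec4 <;> fun_prop

lemma line_mem_bd {y : V} (hy : InB y) {u : ℝ} (hu : 0 ≤ u) (hu' : u ≤ 1) :
    (1 - u) • chi y + u • clV y ∈ Bd := by
  have key : ∀ i, ((1 - u) • chi y + u • clV y) i = (1 - u) * chi y i + u * clV y i := fun i => rfl
  have hc : ∀ i, 0 ≤ chi y i ∧ chi y i ≤ 1 := by
    intro i
    fin_cases i <;> exact cl_mem _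
  have hc' : ∀ i, 0 ≤ clV y i ∧ clV y i ≤ 1 := fun i => cl_mem _
  refine ⟨fun i => ?_, ?_⟩
  · rw [key]
    have h1 := hc i
    have h2 := hc' i
    constructor
    · have := mul_nonneg hu h2.1
      have := mul_nonneg (sub_nonneg.2 hu') h1.1
      linarith
    · have := mul_nonneg hu (sub_nonneg.2 h2.2)
      have := mul_nonneg (sub_nonneg.2 hu') (sub_nonneg.2 h1.2)
      linarith
  · have z : ∀ i, chi y i = 0 → clV y i = 0 → ∃ i, ((1 - u) • chi y + u • clV y) i = 0 ∨
        ((1 - u) • chi y + u • clV y) i = 1 := fun i e1 e2 =>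
      ⟨i, Or.inl (by rw [key, e1, e2]; ring)⟩
    have o : ∀ i, chi y i = 1 → clV y i = 1 → ∃ i, ((1 - u) • chi y + u • clV y) i = 0 ∨
        ((1 - u) • chi y + u • clV y) i = 1 := fun i e1 e2 =>
      ⟨i, Or.inr (by rw [key, e1, e2]; ring)⟩
    rcases hy with hy | h
    · rw [inJ_iff] at hy
      rcases hy with h | h | h | h | h | h | h
      · exact z 0 (cl_of_le_zero (by linarith)) (cl_of_le_zero h)
      · exact o 0 (cl_of_one_le (by linarith)) (cl_of_one_le h)
      · exact z 1 (cl_of_le_zero h) (cl_of_le_zero h)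
      · exact o 1 (cl_of_one_le h) (cl_of_one_le h)
      · exact z 2 (cl_of_le_zero h) (cl_of_le_zero h)
      · exact o 2 (cl_of_one_le h) (cl_of_one_le h)
      · exact o 3 (cl_of_one_le h) (cl_of_one_le h)
    · exact z 3 (cl_of_le_zero h) (cl_of_le_zero h)

lemma chi_mem_bd {y : V} (hy : InB y) : chi y ∈ Bd := by
  simpa using line_mem_bd hy le_rfl zero_le_one

lemma htpy_chi_clV {T : V → ℂ × ℂ} (hT : Continuous T) (h : ∀ y ∈ Bd, 1 ≤ ‖T y‖) :
    Htpy FreeS (fun y => EE (T (chi y))) (fun y => EE (T (clV y))) := by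
  have := continuous_clV
  refine Htpy.of_Icc' (fun u y => EE (T ((1 - u) • chi y + u • clV y))) (by fun_prop)
    (fun u hu hu' => ⟨by fun_prop, fun y hy => ?_⟩) (by simp) (by simp)
  rw [inA_EE_iff]
  exact h _ (line_mem_bd hy hu hu')

/-! ### The generator -/

/-- The linear part of the generator. -/
noncomputable def Lw : V ≃ₗ[ℝ] ℂ × ℂ where
  toFun v := (⟨v 3 + v 0, v 1⟩, ⟨v 3 - v 0, v 2⟩)
  invFun z := ![(z.1.re - z.2.re) / 2, z.1.im, z.2.im, (z.1.re + z.2.re) / 2]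
  map_add' v w := by
    refine Prod.ext (Complex.ext ?_ ?_) (Complex.ext ?_ ?_) <;> simp <;> ring
  map_smul' c v := by
    refine Prod.ext (Complex.ext ?_ ?_) (Complex.ext ?_ ?_) <;> simp <;> ring
  left_inv v := by
    ext i; fin_cases i <;> simp
  right_inv z := by
    refine Prod.ext (Complex.ext ?_ ?_) (Complex.ext ?_ ?_) <;> simp <;> ring

/-- The quadratic coordinate of the generator. -/
def hw (y : V) : ℝ :=
  (6 * y 0 - 3) ^ 2 + (6 * y 1 - 3) ^ 2 + (6 * y 2 - 3) ^ 2 - 3 + 5 * y 3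

/-- The generator, before collapsing. -/
noncomputable def Tw (y : V) : ℂ × ℂ :=
  Lw ![6 * y 0 - 3, 6 * y 1 - 3, 6 * y 2 - 3, hw y]

@[fun_prop] lemma continuous_Lw : Continuous Lw :=
  LinearMap.continuous_of_finiteDimensional (Lw : V →ₗ[ℝ] ℂ × ℂ)

@[fun_prop] lemma continuous_Tw : Continuous Tw := by
  have h : Continuous fun y : V => (![6 * y 0 - 3, 6 * y 1 - 3, 6 * y 2 - 3, hw y] : V) := by
    unfold hw
    apply continuous_vec4 <;> fun_prop
  unfold Tw
  fun_prop

lemma Tw_fst (y : V) : (Tw y).1 = ⟨hw y + (6 * y 0 - 3), 6 * y 1 - 3⟩ := rfl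

lemma Tw_snd (y : V) : (Tw y).2 = ⟨hw y - (6 * y 0 - 3), 6 * y 2 - 3⟩ := rfl

lemma le_norm_complex {r : ℝ} {z : ℂ} (h : r ≤ z.re) : r ≤ ‖z‖ :=
  h.trans ((le_abs_self _).trans (Complex.abs_re_le_norm z))

lemma norm_Tw_of_inJ {y : V} (hy : ∀ i, 0 ≤ y i ∧ y i ≤ 1) (h : InJ y) :
    1 ≤ ‖(Tw y).1‖ ∧ 1 ≤ ‖(Tw y).2‖ := by
  have key : 1 ≤ hw y + (6 * y 0 - 3) ∧ 1 ≤ hw y - (6 * y 0 - 3) := by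
    have h0 := hy 0
    have h1 := hy 1
    have h2 := hy 2
    have h3 := hy 3
    have q0 := sq_nonneg (6 * y 0 - 3)
    have q1 := sq_nonneg (6 * y 1 - 3)
    have q2 := sq_nonneg (6 * y 2 - 3)
    unfold hw
    have big : ∀ i, (y i ≤ 0 ∨ 1 ≤ y i) → (6 * y i - 3) ^ 2 = 9 := by
      rintro i (g | g)
      · rw [le_antisymm g (hy i).1]; norm_num
      · rw [le_antisymm (hy i).2 g]; norm_num
    rw [inJ_iff] at h
    rcases h with h | h | h | h | h | h | h
    · have := big 0 (Or.inl h); constructor <;> linarith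
    · have := big 0 (Or.inr h); constructor <;> linarith
    · have := big 1 (Or.inl h); constructor <;> linarith
    · have := big 1 (Or.inr h); constructor <;> linarith
    · have := big 2 (Or.inl h); constructor <;> linarith
    · have := big 2 (Or.inr h); constructor <;> linarith
    · constructor <;> nlinarith [sq_nonneg (6 * y 0 - 3 + 1 / 2), sq_nonneg (6 * y 0 - 3 - 1 / 2)]
  exact ⟨le_norm_complex key.1, le_norm_complex key.2⟩

lemma norm_Tw_of_bottom {y : V} (h : y 3 = 0) : 1 ≤ ‖Tw y‖ := by
  by_contra hc
  rw [not_le, Prod.norm_def, max_lt_iff] at hc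
  have h1 : ‖(Tw y).1‖ ^ 2 < 1 := by
    rw [sq_lt_one_iff₀ (norm_nonneg _)]; exact hc.1
  have h2 : ‖(Tw y).2‖ ^ 2 < 1 := by
    rw [sq_lt_one_iff₀ (norm_nonneg _)]; exact hc.2
  rw [Complex.sq_norm, Complex.normSq_apply] at h1 h2
  simp only [Tw_fst, Tw_snd] at h1 h2
  have h3 : hw y = (6 * y 0 - 3) ^ 2 + (6 * y 1 - 3) ^ 2 + (6 * y 2 - 3) ^ 2 - 3 := by
    unfold hw; rw [h]; ring
  nlinarith [sq_nonneg (6 * y 0 - 3), sq_nonneg (6 * y 1 - 3), sq_nonneg (6 * y 2 - 3),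
    sq_nonneg (hw y + 1)]

lemma inJ_of_bd {y : V} (hy : y ∈ Bd) : InJ y ∨ y 3 = 0 := by
  obtain ⟨i, hi⟩ := hy.2
  rw [inJ_iff]
  fin_cases i <;> simp at hi <;> rcases hi with hi | hi <;> simp [hi]

lemma norm_Tw_of_bd {y : V} (hy : y ∈ Bd) : 1 ≤ ‖Tw y‖ := by
  rcases inJ_of_bd hy with h | h
  · exact (norm_Tw_of_inJ hy.1 h).1.trans (norm_fst_le _)
  · exact norm_Tw_of_bottom h

/-- The generator. -/
noncomputable def wmap (y : V) : X := EE (Tw (clV y))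

lemma inJ_clV {y : V} (hy : InJ y) : InJ (clV y) := by
  rw [inJ_iff] at hy ⊢
  rcases hy with h | h | h | h | h | h | h
  · left; exact (cl_of_le_zero h).le
  · right; left; exact (cl_of_one_le h).ge
  · right; right; left; exact (cl_of_le_zero h).le
  · right; right; right; left; exact (cl_of_one_le h).ge
  · right; right; right; right; left; exact (cl_of_le_zero h).le
  · right; right; right; right; right; left; exact (cl_of_one_le h).ge
  · right; right; right; right; right; right; exact (cl_of_one_le h).ge

lemma wmap_mem : wmap ∈ BasedS := by
  have hcl := continuous_clV
  refine ⟨by unfold wmap; fun_prop, fun y hy => ?_, fun y hy => ?_⟩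
  · have := norm_Tw_of_inJ (y := clV y) (fun i => cl_mem _) (inJ_clV hy)
    exact Prod.ext ((E_eq_b0_iff _).2 this.1) ((E_eq_b0_iff _).2 this.2)
  · rw [wmap, inA_EE_iff]
    exact norm_Tw_of_bottom (cl_of_le_zero hy)

lemma Lw_eq_zero_iff (v : V) : Lw v = 0 ↔ v = 0 := by simp

lemma htpy_Tw : Htpy NS Tw (fun y => Lw (ctr y)) := by
  refine htpy_line (by fun_prop) (by fun_prop) fun y hy u hu hu' h => ?_
  rw [Tw, ← map_smul, ← map_smul, ← map_add, Lw_eq_zero_iff] at h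
  have e : ∀ i, ((1 - u) • ![6 * y 0 - 3, 6 * y 1 - 3, 6 * y 2 - 3, hw y] + u • ctr y) i = 0 :=
    fun i => congrFun h i
  have e0 := e 0
  have e1 := e 1
  have e2 := e 2
  have e3 := e 3
  simp [ctr] at e0 e1 e2 e3
  have c : ∀ x : ℝ, (1 - u) * (6 * x - 3) + u * (2 * x - 1) = 0 → 2 * x - 1 = 0 := by
    intro x hx
    have : (3 - 2 * u) * (2 * x - 1) = 0 := by linarith
    rcases mul_eq_zero.1 this with h | h
    · linarith
    · exact h
  have c0 := c _ e0
  have c1 := c _ e1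
  have c2 := c _ e2
  have y0 : y 0 = 1 / 2 := by linarith
  have y1 : y 1 = 1 / 2 := by linarith
  have y2 : y 2 = 1 / 2 := by linarith
  simp only [hw, y0, y1, y2] at e3
  obtain ⟨i, hi⟩ := hy.2
  fin_cases i
  · change y 0 = 0 ∨ y 0 = 1 at hi
    rcases hi with hi | hi <;> linarith
  · change y 1 = 0 ∨ y 1 = 1 at hi
    rcases hi with hi | hi <;> linarith
  · change y 2 = 0 ∨ y 2 = 1 at hi
    rcases hi with hi | hi <;> linarith
  · change y 3 = 0 ∨ y 3 = 1 at hi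
    rcases hi with hi | hi <;> rw [hi] at e3 <;> nlinarith

lemma rfl0_mem_bd {y : V} (hy : y ∈ Bd) : rfl0 y ∈ Bd := by
  refine ⟨fun i => ?_, ?_⟩
  · have h0 := hy.1 0
    fin_cases i
    · simp only [rfl0]; constructor <;> simp <;> linarith
    · exact hy.1 1
    · exact hy.1 2
    · exact hy.1 3
  · obtain ⟨i, hi⟩ := hy.2
    refine ⟨i, ?_⟩
    fin_cases i
    · simp only [rfl0]
      rcases hi with hi | hi
      · right; simpa using hi
      · left; simp at hi; simp [hi]
    · exact hi
    · exact hi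
    · exact hi

lemma htpy_linear {L : V →ₗ[ℝ] ℂ × ℂ} (hL : Function.Injective L) :
    Htpy NS (fun y => L (ctr y)) Tw ∨ Htpy NS (fun y => L (ctr y)) (fun y => Tw (rfl0 y)) := by
  set L' : V →ₗ[ℝ] V := Lw.symm.toLinearMap ∘ₗ L with hL'
  have hinj : Function.Injective L' := Lw.symm.injective.comp hL
  have hdet : (LinearMap.toMatrix' L').det ≠ 0 := by
    rw [LinearMap.det_toMatrix']
    exact (LinearMap.isUnit_det L' ((LinearMap.isUnit_iff_ker_eq_bot L').2
      (LinearMap.ker_eq_bot.2 hinj))).ne_zero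
  have e : ∀ v, L v = Lw ((LinearMap.toMatrix' L').mulVec v) := fun v => by
    rw [LinearMap.toMatrix'_mulVec, hL']
    simp
  have key : ∀ N : Mat, Conn (LinearMap.toMatrix' L') N →
      Htpy NS (fun y => L (ctr y)) (fun y => Lw (N.mulVec (ctr y))) := by
    intro N hN
    obtain ⟨γ, hc, hS, h0, h1⟩ := hN.exists_path
    refine Htpy.of_Icc' (fun u y => Lw ((γ u).mulVec (ctr y))) ?_
      (fun u hu hu' => ⟨?_, fun y hy hz => ?_⟩) ?_ (by rw [h1])
    · exact continuous_Lw.comp ((hc.comp continuous_fst).matrix_mulVec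
        (continuous_ctr.comp continuous_snd))
    · exact continuous_Lw.comp (continuous_const.matrix_mulVec continuous_ctr)
    · rw [Lw_eq_zero_iff] at hz
      have := Matrix.eq_zero_of_mulVec_eq_zero (hS u) hz
      have h2 := norm_ctr hy
      rw [this] at h2
      simp at h2
    · funext y
      rw [h0, e]
  rcases conn_one_or_flip hdet with h | h
  · left
    have := (key _ h).trans (by simpa using htpy_Tw.symm)
    exact this
  · right
    refine (key _ h).trans ?_
    obtain ⟨H, hc, hS, h0, h1⟩ := htpy_Tw.symm
    have hcr := continuous_rfl0
    refine ⟨fun u y => H u (rfl0 y), hc.comp (by fun_prop : Continuous fun p : ℝ × V =>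
      (p.1, rfl0 p.2)), fun u => ⟨(hS u).1.comp hcr, fun y hy => (hS u).2 _ (rfl0_mem_bd hy)⟩,
      ?_, by simp only [h1]⟩
    funext y
    simp only [h0]
    congr 1
    ext i
    rw [flip, Matrix.mulVec_diagonal]
    fin_cases i <;> simp [ctr, rfl0]
    ring

lemma htpy_free_wmap {T : V → ℂ × ℂ} {L : V →ₗ[ℝ] ℂ × ℂ} (hL : Function.Injective L)
    (hT : Htpy NS T (fun y => L (ctr y))) (h : ∀ y ∈ Bd, 1 ≤ ‖T y‖) :
    Htpy FreeS (fun y => EE (T (chi y))) wmap ∨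
      Htpy FreeS (fun y => EE (T (chi y))) (fun y => wmap (rfl0 y)) := by
  rcases htpy_linear hL with h' | h'
  · left
    exact (htpy_free_of_htpy (hT.trans h') h (fun y hy => norm_Tw_of_bd hy) continuous_chi
      fun y hy => chi_mem_bd hy).trans
      (htpy_chi_clV continuous_Tw fun y hy => norm_Tw_of_bd hy)
  · right
    have hb : ∀ y ∈ Bd, 1 ≤ ‖Tw (rfl0 y)‖ := fun y hy => norm_Tw_of_bd (rfl0_mem_bd hy)
    refine ((htpy_free_of_htpy (hT.trans h') h hb continuous_chi
      fun y hy => chi_mem_bd hy).trans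
      (htpy_chi_clV (T := fun y => Tw (rfl0 y)) (continuous_Tw.comp continuous_rfl0) hb)).trans ?_
    refine Htpy.of_Icc' (fun _ y => wmap (rfl0 y)) ?_ (fun u _ _ => ?_) ?_ rfl
    · exact (wmap_mem.1.comp continuous_rfl0).comp continuous_snd
    · exact basedS_subset_freeS (comp_rfl0_mem wmap_mem)
    · funext y
      simp only [wmap]
      congr 2
      ext i
      have : cl (1 - y 0) = 1 - cl (y 0) := by
        rcases le_total (y 0) 0 with g | g
        · rw [cl_of_le_zero g, cl_of_one_le (by linarith)]; ring
        rcases le_total (y 0) 1 with g' | g'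
        · rw [cl_of_mem g g', cl_of_mem (by linarith) (by linarith)]
        · rw [cl_of_one_le g', cl_of_le_zero (by linarith)]; ring
      fin_cases i
      · simpa [clV, rfl0] using this
      all_goals rfl

open MeasureTheory

/-! ### Regular values of approximations -/

/-- The horizontal components. -/
noncomputable def UU : (ℂ × ℝ) × (ℂ × ℝ) →L[ℝ] ℂ × ℂ :=
  ((ContinuousLinearMap.fst ℝ ℂ ℝ).comp (ContinuousLinearMap.fst ℝ (ℂ × ℝ) (ℂ × ℝ))).prod
    ((ContinuousLinearMap.fst ℝ ℂ ℝ).comp (ContinuousLinearMap.snd ℝ (ℂ × ℝ) (ℂ × ℝ)))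

@[simp] lemma UU_apply (p : (ℂ × ℝ) × (ℂ × ℝ)) : UU p = (p.1.1, p.2.1) := rfl

/-- Both heights are nonpositive. -/
def Low (p : (ℂ × ℝ) × (ℂ × ℝ)) : Prop := p.1.2 ≤ 0 ∧ p.2.2 ≤ 0

/-- A twice differentiable approximation of a map to the product of two spheres. -/
structure IsApprox {Y : Type*} [NormedAddCommGroup Y] [NormedSpace ℝ Y] (f : Y → X)
    (P : Y → (ℂ × ℝ) × (ℂ × ℝ)) : Prop where
  contDiff : ContDiff ℝ 2 P
  near_fst : ∀ y, ‖(P y).1 - (f y).1.1‖ < 1 / 4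
  near_snd : ∀ y, ‖(P y).2 - (f y).2.1‖ < 1 / 4

lemma exists_isApprox {Y : Type*} [NormedAddCommGroup Y] [NormedSpace ℝ Y]
    [FiniteDimensional ℝ Y] {f : Y → X} (hf : Continuous f) : ∃ P, IsApprox f P := by
  obtain ⟨P1, h1, h1'⟩ := exists_contDiff_near (continuous_fst.comp hf)
  obtain ⟨P2, h2, h2'⟩ := exists_contDiff_near (continuous_snd.comp hf)
  exact ⟨fun y => (P1 y, P2 y), h1.prodMk h2, h1', h2'⟩

lemma height_near {p : ℂ × ℝ} {x : Sph} (h : ‖p - x.1‖ < 1 / 4) : |p.2 - x.1.2| < 1 / 4 :=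
  (norm_snd_le (p - x.1)).trans_lt h

lemma horiz_near {p : ℂ × ℝ} {x : Sph} (h : ‖p - x.1‖ < 1 / 4) : ‖p.1 - x.1.1‖ < 1 / 4 :=
  (norm_fst_le (p - x.1)).trans_lt h

lemma ne_b0_of_near {p : ℂ × ℝ} {x : Sph} (h : ‖p - x.1‖ < 1 / 4) (h0 : p.2 ≤ 0) : x ≠ b0 := by
  rw [Ne, eq_b0_iff]
  intro h1
  have := height_near h
  rw [abs_lt] at this
  linarith

/-- An approximation with small horizontal component has a definite height. -/
lemma height_of_near {p : ℂ × ℝ} {x : Sph} (h : ‖p - x.1‖ < 1 / 4) (h1 : ‖p.1‖ < 1 / 4) :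
    (p.2 ≤ 0 → p.2 < 0 ∧ x.1.2 < 0) ∧ (x.1.2 ≤ 0 → p.2 < 0) := by
  have h2 := height_near h
  have h3 := horiz_near h
  have h4 : ‖x.1.1‖ < 1 / 2 := by
    have := norm_sub_norm_le x.1.1 p.1
    rw [norm_sub_rev] at h3
    linarith
  have h5 : ‖x.1.1‖ ^ 2 + x.1.2 ^ 2 = 1 := x.2
  rw [abs_lt] at h2
  refine ⟨fun hp => ⟨?_, ?_⟩, fun hx => ?_⟩ <;> by_contra hc <;> nlinarith [norm_nonneg x.1.1]

/-- The preimage of `q` under the horizontal components, at nonpositive heights. -/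
def Bad (P : V → (ℂ × ℝ) × (ℂ × ℝ)) (q : ℂ × ℂ) : Set V := {y | UU (P y) = q ∧ Low (P y)}

lemma exists_regular {U : V → ℂ × ℂ} (hU : Differentiable ℝ U) :
    ∃ q : ℂ × ℂ, ‖q‖ < 1 / 4 ∧ ∀ y, U y = q → Function.Injective (fderiv ℝ U y) := by
  let e : (ℂ × ℂ) ≃L[ℝ] V := Lw.symm.toContinuousLinearEquiv
  let g : V → V := fun y => e (U y)
  have hg : ∀ y, HasFDerivAt g ((e : (ℂ × ℂ) →L[ℝ] V).comp (fderiv ℝ U y)) y := fun y =>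
    e.hasFDerivAt.comp y (hU y).hasFDerivAt
  set s : Set V := {y | ((e : (ℂ × ℂ) →L[ℝ] V).comp (fderiv ℝ U y)).det = 0}
  have h0 : volume (g '' s) = 0 :=
    addHaar_image_eq_zero_of_det_fderivWithin_eq_zero volume
      (fun y _ => (hg y).hasFDerivWithinAt) (fun y hy => hy)
  have ho : IsOpen {v : V | ‖e.symm v‖ < 1 / 4} :=
    isOpen_lt (by fun_prop) continuous_const
  have hpos := ho.measure_pos volume ⟨0, by simp⟩
  obtain ⟨v, hv, hv'⟩ : ∃ v, ‖e.symm v‖ < 1 / 4 ∧ v ∉ g '' s := by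
    by_contra! hc
    exact hpos.ne' (measure_mono_null (fun v hv => hc v hv) h0)
  refine ⟨e.symm v, hv, fun y hy => ?_⟩
  have h1 : y ∉ s := fun hs => hv' ⟨y, hs, by simp [g, hy]⟩
  have h2 : IsUnit (LinearMap.det
      (((e : (ℂ × ℂ) →L[ℝ] V).comp (fderiv ℝ U y) : V →L[ℝ] V) : V →ₗ[ℝ] V)) :=
    isUnit_iff_ne_zero.2 h1
  have h3 := LinearMap.ker_eq_bot.1 ((LinearMap.isUnit_iff_ker_eq_bot _).1
    ((LinearMap.isUnit_iff_isUnit_det _).2 h2))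
  exact Function.Injective.of_comp (f := e) h3

section

variable {f : V → X} {P : V → (ℂ × ℝ) × (ℂ × ℝ)} {q : ℂ × ℂ}

lemma not_inA_of_low (hP : IsApprox f P) {y : V} (h : Low (P y)) : ¬ InA (f y) := by
  rintro (h' | h')
  · exact ne_b0_of_near (hP.near_fst y) h.1 h'
  · exact ne_b0_of_near (hP.near_snd y) h.2 h'

lemma not_inB_of_low (hf : f ∈ BasedS) (hP : IsApprox f P) {y : V} (h : Low (P y)) : ¬ InB y :=
  fun hy => not_inA_of_low hP h ((basedS_subset_freeS hf).2 y hy)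

lemma mem_cube_of_not_inB {y : V} (h : ¬ InB y) (i : Fin 4) : 0 < y i ∧ y i < 1 := by
  have h' : ¬ InJ y ∧ ¬ y 3 ≤ 0 := not_or.1 h
  rw [inJ_iff] at h'
  push Not at h'
  obtain ⟨⟨a0, a1, a2, a3, a4, a5, a6⟩, a7⟩ := h'
  fin_cases i
  · exact ⟨a0, a1⟩
  · exact ⟨a2, a3⟩
  · exact ⟨a4, a5⟩
  · exact ⟨a7, a6⟩

lemma isClosed_low : IsClosed {p : (ℂ × ℝ) × (ℂ × ℝ) | Low p} :=
  (isClosed_le continuous_fst.snd continuous_const).inter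
    (isClosed_le continuous_snd.snd continuous_const)

lemma finite_bad (hf : f ∈ BasedS) (hP : IsApprox f P)
    (hq : ∀ y, UU (P y) = q → Function.Injective (fderiv ℝ (fun y => UU (P y)) y)) :
    (Bad P q).Finite := by
  have hPc := hP.contDiff.continuous
  have hU : Differentiable ℝ fun y => UU (P y) :=
    UU.differentiable.comp (hP.contDiff.differentiable two_ne_zero)
  refine IsCompact.finite ?_ ?_
  · refine (isCompact_Icc (a := (0 : V)) (b := 1)).of_isClosed_subset ?_ fun y hy => ?_
    · exact (isClosed_eq (by fun_prop) continuous_const).inter (isClosed_low.preimage hPc)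
    · have := mem_cube_of_not_inB (not_inB_of_low hf hP hy.2)
      exact ⟨fun i => (this i).1.le, fun i => (this i).2.le⟩
  · rw [isDiscrete_iff_nhdsNE]
    intro x hx
    obtain ⟨K, -, hK⟩ := LinearMap.exists_antilipschitzWith
      (fderiv ℝ (fun y => UU (P y)) x : V →ₗ[ℝ] ℂ × ℂ) (LinearMap.ker_eq_bot.2 (hq x hx.1))
    have := (hU x).hasFDerivAt.eventually_ne (c := q) ⟨K, hK⟩
    rw [← disjoint_iff, Filter.disjoint_principal_right]
    filter_upwards [this] with z hz hz'
    exact hz hz'.1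


/-- Near a regular bad point the horizontal components are close to their linear part. -/
lemma eventually_box (hf : f ∈ BasedS) (hP : IsApprox f P) (hq4 : ‖q‖ < 1 / 4)
    (hq : ∀ y, UU (P y) = q → Function.Injective (fderiv ℝ (fun y => UU (P y)) y)) {x : V}
    (hx : x ∈ Bad P q) : ∃ c > 0, (∀ v, c * ‖v‖ ≤ ‖fderiv ℝ (fun y => UU (P y)) x v‖) ∧
      ∀ᶠ ρ in 𝓝[>] (0 : ℝ), ∀ z, ‖z - x‖ ≤ ρ → Low (P z) ∧ (∀ i, 0 ≤ z i ∧ z i ≤ 1) ∧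
        ‖UU (P z) - q - fderiv ℝ (fun y => UU (P y)) x (z - x)‖ ≤ c / 2 * ‖z - x‖ := by
  have hPc := hP.contDiff.continuous
  have hU : Differentiable ℝ fun y => UU (P y) :=
    UU.differentiable.comp (hP.contDiff.differentiable two_ne_zero)
  obtain ⟨K, hK0, hK⟩ := LinearMap.exists_antilipschitzWith
    (fderiv ℝ (fun y => UU (P y)) x : V →ₗ[ℝ] ℂ × ℂ) (LinearMap.ker_eq_bot.2 (hq x hx.1))
  have hK0' : (0 : ℝ) < K := hK0
  refine ⟨(K : ℝ)⁻¹, by positivity, fun v => ?_, ?_⟩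
  · have := hK.le_mul_dist v 0
    rw [dist_zero_right, map_zero, dist_zero_right] at this
    rw [inv_mul_le_iff₀ hK0']
    exact this
  · have e1 := (hU x).hasFDerivAt.isLittleO.bound (show (0 : ℝ) < (K : ℝ)⁻¹ / 2 by positivity)
    have hn : ‖UU (P x)‖ < 1 / 4 := by rw [hx.1]; exact hq4
    have hn1 : (P x).1.2 < 0 := ((height_of_near (hP.near_fst x)
      ((norm_fst_le (UU (P x))).trans_lt hn)).1 hx.2.1).1
    have hn2 : (P x).2.2 < 0 := ((height_of_near (hP.near_snd x)
      ((norm_snd_le (UU (P x))).trans_lt hn)).1 hx.2.2).1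
    have e2 : ∀ᶠ z in 𝓝 x, (P z).1.2 < 0 :=
      (isOpen_lt hPc.fst.snd continuous_const).mem_nhds hn1
    have e3 : ∀ᶠ z in 𝓝 x, (P z).2.2 < 0 :=
      (isOpen_lt hPc.snd.snd continuous_const).mem_nhds hn2
    have e := (e1.and e2).and e3
    obtain ⟨ε, hε, h⟩ := Metric.eventually_nhds_iff.1 e
    filter_upwards [Ioo_mem_nhdsGT hε] with ρ hρ z hz
    obtain ⟨⟨a1, a2⟩, a3⟩ := h (show dist z x < ε by rw [dist_eq_norm]; exact hz.trans_lt hρ.2)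
    have hlow : Low (P z) := ⟨a2.le, a3.le⟩
    refine ⟨hlow, fun i => ?_, ?_⟩
    · have := mem_cube_of_not_inB (not_inB_of_low hf hP hlow) i
      exact ⟨this.1.le, this.2.le⟩
    · rw [← hx.1]
      exact a1

/-- The collapse of an approximation. -/
noncomputable def colP (q : ℂ × ℂ) (r : ℝ) (p : (ℂ × ℝ) × (ℂ × ℝ)) : X :=
  (col q.1 r p.1, col q.2 r p.2)

lemma htpy_colP (hf : f ∈ BasedS) (hP : IsApprox f P) (hq : ‖q‖ < 1 / 4) {r : ℝ} (hr0 : 0 < r)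
    (hr : r ≤ 1 / 4) : Htpy BasedS f (fun y => colP q r (P y)) := by
  have hPc := hP.contDiff.continuous
  obtain ⟨H1, c1, S1, a1, b1⟩ := htpy_col (continuous_fst.comp hf.1) hPc.fst hP.near_fst
    ((norm_fst_le q).trans hq.le) hr0 hr
  obtain ⟨H2, c2, S2, a2, b2⟩ := htpy_col (continuous_snd.comp hf.1) hPc.snd hP.near_snd
    ((norm_snd_le q).trans hq.le) hr0 hr
  refine ⟨fun u y => (H1 u y, H2 u y), c1.prodMk c2, fun u => ⟨(S1 u).1.prodMk (S2 u).1,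
    fun y hy => ?_, fun y hy => ?_⟩, ?_, ?_⟩
  · have := hf.2.1 y hy
    exact Prod.ext ((S1 u).2 y (by simp [this])) ((S2 u).2 y (by simp [this]))
  · exact (hf.2.2 y hy).imp (fun h => (S1 u).2 y h) (fun h => (S2 u).2 y h)
  · funext y
    simp only [a1, a2]
    rfl
  · funext y
    simp only [b1, b2]
    rfl

lemma of_not_inA_colP {r : ℝ} (hr : 0 < r) {p : (ℂ × ℝ) × (ℂ × ℝ)} (h : ¬ InA (colP q r p)) :
    Low p ∧ ‖UU p - q‖ < r := by
  obtain ⟨h1, h2⟩ := not_or.1 h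
  have h1 := col_ne_b0 hr h1
  have h2 := col_ne_b0 hr h2
  exact ⟨⟨h1.1, h2.1⟩, max_lt h1.2 h2.2⟩

lemma colP_of_low {r : ℝ} {p : (ℂ × ℝ) × (ℂ × ℝ)} (h : Low p) :
    colP q r p = EE (r⁻¹ • (UU p - q)) := by
  simp [colP, col, EE, h.1, h.2]

end

/-! ### All classes are powers of the generator -/

lemma htpy_slab_center {g : V → X} (hg : g ∈ BasedS) {x : V} {ρ : ℝ} (hρ : 0 < ρ)
    (hx : ∀ i, ρ ≤ x i ∧ x i + ρ ≤ 1)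
    (hbox : ∀ z : V, |z 0 - x 0| ≤ ρ → ∀ i, ρ ≤ |z i - x i| → InA (g z)) :
    Htpy FreeS (slab g (x 0 - ρ) (x 0 + ρ)) (fun y => g (x + ρ • ctr (chi y))) := by
  have hgc := hg.1
  have hα : ∀ s, |sα (x 0 - ρ) (x 0 + ρ) s - x 0| ≤ ρ := fun s => by
    have h1 := cl_nonneg (3 * s - 1)
    have h2 := cl_le_one (3 * s - 1)
    rw [abs_le, sα]
    constructor <;> nlinarith
  have hα0 : ∀ s, s ≤ 1 / 3 → ρ ≤ |sα (x 0 - ρ) (x 0 + ρ) s - x 0| := fun s hs => by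
    rw [sα_left hs, le_abs]; right; linarith
  have hα1 : ∀ s, 2 / 3 ≤ s → ρ ≤ |sα (x 0 - ρ) (x 0 + ρ) s - x 0| := fun s hs => by
    rw [sα_right hs, le_abs]; left; linarith
  let D : ℝ → V → V := fun u y => ![sα (x 0 - ρ) (x 0 + ρ) (y 0),
    (1 - u) * y 1 + u * (x 1 + ρ * (2 * cl (y 1) - 1)),
    (1 - u) * y 2 + u * (x 2 + ρ * (2 * cl (y 2) - 1)),
    (1 - u) * (y 3 + sβ (y 0) * (1 - y 3)) + u * (x 3 + ρ * (2 * cl (y 3) - 1))]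
  have hD : Continuous fun p : ℝ × V => D p.1 p.2 := by
    apply continuous_vec4 <;> fun_prop
  have hDu : ∀ u, Continuous (D u) := fun u => by
    apply continuous_vec4 <;> fun_prop
  refine Htpy.of_Icc' (fun u y => g (D u y)) (hgc.comp hD)
    (fun u hu hu' => ⟨hgc.comp (hDu u), fun y hy => ?_⟩) ?_ ?_
  · have lo : ∀ i : Fin 4, ∀ t b : ℝ, t ≤ 0 → b ≤ 0 →
        ρ ≤ |(1 - u) * b + u * (x i + ρ * (2 * cl t - 1)) - x i| := fun i t b ht hb => by
      rw [cl_of_le_zero ht, le_abs]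
      right
      have := mul_nonneg (sub_nonneg.2 hu') (sub_nonneg.2 hb)
      have := mul_nonneg (sub_nonneg.2 hu') (sub_nonneg.2 (hx i).1)
      linarith
    have hi : ∀ i : Fin 4, ∀ t b : ℝ, 1 ≤ t → 1 ≤ b →
        ρ ≤ |(1 - u) * b + u * (x i + ρ * (2 * cl t - 1)) - x i| := fun i t b ht hb => by
      rw [cl_of_one_le ht, le_abs]
      left
      have := mul_nonneg (sub_nonneg.2 hu') (sub_nonneg.2 hb)
      have := mul_nonneg (sub_nonneg.2 hu') (sub_nonneg.2 (hx i).2)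
      linarith
    have h0 : |D u y 0 - x 0| ≤ ρ := hα _
    rcases hy with h | h
    · rw [inJ_iff] at h
      rcases h with h | h | h | h | h | h | h
      · exact hbox _ h0 0 (hα0 _ (by linarith))
      · exact hbox _ h0 0 (hα1 _ (by linarith))
      · exact hbox _ h0 1 (lo 1 _ _ h h)
      · exact hbox _ h0 1 (hi 1 _ _ h h)
      · exact hbox _ h0 2 (lo 2 _ _ h h)
      · exact hbox _ h0 2 (hi 2 _ _ h h)
      · refine hbox _ h0 3 (hi 3 _ _ h ?_)
        have : sβ (y 0) ≤ 1 := cl_le_one _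
        nlinarith
    · by_cases g1 : y 0 ≤ 1 / 3
      · exact hbox _ h0 0 (hα0 _ g1)
      by_cases g2 : 2 / 3 ≤ y 0
      · exact hbox _ h0 0 (hα1 _ g2)
      refine hbox _ h0 3 (lo 3 _ _ h ?_)
      rw [sβ_mid (by linarith) (by linarith)]
      linarith
  · funext y
    simp [D, slab, rep]
  · funext y
    congr 1
    ext i
    fin_cases i <;> simp [D, ctr, chi, sα]
    ring

section

variable {f : V → X} {P : V → (ℂ × ℝ) × (ℂ × ℝ)} {q : ℂ × ℂ}

lemma add_smul_ctr_sub (x y : V) (ρ : ℝ) : (x + ρ • ctr y) - x = ρ • ctr y := by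
  simp

/-- The slab around a bad point is the generator up to sign. -/
lemma slab_htpy_wmap (hP : IsApprox f P) {r ρ c : ℝ} (hr : 0 < r) (hρ : 0 < ρ) (hc : 0 < c)
    (hg : (fun y => colP q r (P y)) ∈ BasedS) {x : V}
    {L : V →L[ℝ] ℂ × ℂ} (hL : ∀ v, c * ‖v‖ ≤ ‖L v‖)
    (hx : ∀ z, ‖z - x‖ ≤ ρ → Low (P z) ∧ (∀ i, 0 ≤ z i ∧ z i ≤ 1) ∧
        ‖UU (P z) - q - L (z - x)‖ ≤ c / 2 * ‖z - x‖)
    (hbox : ∀ z : V, |z 0 - x 0| ≤ ρ → ∀ i, ρ ≤ |z i - x i| → InA (colP q r (P z)))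
    (hs : slab (fun y => colP q r (P y)) (x 0 - ρ) (x 0 + ρ) ∈ BasedS) :
    Htpy BasedS (slab (fun y => colP q r (P y)) (x 0 - ρ) (x 0 + ρ)) wmap ∨
      Htpy BasedS (slab (fun y => colP q r (P y)) (x 0 - ρ) (x 0 + ρ))
        (fun y => wmap (rfl0 y)) := by
  have hPc := hP.contDiff.continuous
  have hx1 : ∀ i, ρ ≤ x i ∧ x i + ρ ≤ 1 := by
    intro i
    have h1 := (hx (x - fun _ => ρ) (by
      rw [sub_sub_cancel_left, norm_neg, pi_norm_le_iff_of_nonneg hρ.le]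
      exact fun _ => (abs_of_pos hρ).le)).2.1 i
    have h2 := (hx (x + fun _ => ρ) (by
      rw [add_sub_cancel_left, pi_norm_le_iff_of_nonneg hρ.le]
      exact fun _ => (abs_of_pos hρ).le)).2.1 i
    simp only [Pi.sub_apply, Pi.add_apply] at h1 h2
    constructor <;> linarith
  have hnear : ∀ y, ‖ctr y‖ ≤ 1 → ‖(x + ρ • ctr y) - x‖ ≤ ρ := fun y hy => by
    rw [add_smul_ctr_sub, norm_smul, Real.norm_eq_abs, abs_of_pos hρ]
    nlinarith
  let T : V → ℂ × ℂ := fun y => r⁻¹ • (UU (P (x + ρ • ctr y)) - q)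
  have hT : Continuous T := by
    have := continuous_ctr
    fun_prop
  have h1 : (fun y => colP q r (P (x + ρ • ctr (chi y)))) = fun y => EE (T (chi y)) := by
    funext y
    refine colP_of_low (hx _ (hnear _ ?_)).1
    rw [pi_norm_le_iff_of_nonneg zero_le_one]
    intro i
    have : 0 ≤ chi y i ∧ chi y i ≤ 1 := by fin_cases i <;> exact cl_mem _
    rw [Real.norm_eq_abs, abs_le]
    simp only [ctr]
    constructor <;> linarith
  have hTb : ∀ y ∈ Bd, 1 ≤ ‖T y‖ := by
    intro y hy
    have hn := norm_ctr hy
    have hlow := (hx _ (hnear y hn.le)).1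
    rw [← inA_EE_iff, ← colP_of_low hlow]
    have hi : ∀ i, (x + ρ • ctr y) i - x i = ρ * ctr y i := fun i => by simp
    obtain ⟨i, hi'⟩ := hy.2
    refine hbox _ ?_ i ?_
    · rw [hi, abs_mul, abs_of_pos hρ]
      have := (norm_le_pi_norm (ctr y) 0).trans hn.le
      rw [Real.norm_eq_abs] at this
      nlinarith
    · rw [hi, abs_mul, abs_of_pos hρ]
      have : |ctr y i| = 1 := by
        rcases hi' with h | h <;> simp only [ctr, h] <;> norm_num
      rw [this, mul_one]
  have hLT : Htpy NS T (fun y => (L : V →ₗ[ℝ] ℂ × ℂ) (ctr y)) := by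
    refine htpy_line hT (L.continuous.comp continuous_ctr) fun y hy u hu hu' h0 => ?_
    have hn := norm_ctr hy
    have h2 := (hx _ (hnear y hn.le)).2.2
    rw [add_smul_ctr_sub, map_smul, norm_smul, hn, Real.norm_eq_abs, abs_of_pos hρ] at h2
    set e := UU (P (x + ρ • ctr y)) - q - ρ • L (ctr y) with he
    have h3 : (1 - u) • T y + u • L (ctr y) =
        ((1 - u) * r⁻¹ * ρ + u) • L (ctr y) + ((1 - u) * r⁻¹) • e := by
      simp only [T, he]
      module
    have h0' : (1 - u) • T y + u • L (ctr y) = 0 := h0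
    rw [h3, add_eq_zero_iff_eq_neg] at h0'
    have h4 := congrArg norm h0'
    have hu1 : 0 ≤ (1 - u) * r⁻¹ := mul_nonneg (sub_nonneg.2 hu') (inv_nonneg.2 hr.le)
    rw [norm_neg, norm_smul, norm_smul, Real.norm_eq_abs, Real.norm_eq_abs,
      abs_of_nonneg hu1, abs_of_nonneg (add_nonneg (mul_nonneg hu1 hρ.le) hu)] at h4
    have h5 := hL (ctr y)
    rw [hn, mul_one] at h5
    have h6 : ((1 - u) * r⁻¹ * ρ + u) * c ≤ (1 - u) * r⁻¹ * (c / 2 * (ρ * 1)) := by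
      refine (mul_le_mul_of_nonneg_left h5 (add_nonneg (mul_nonneg hu1 hρ.le) hu)).trans ?_
      rw [h4]
      exact mul_le_mul_of_nonneg_left h2 hu1
    have h7 : (1 - u) * r⁻¹ * ρ * c / 2 + u * c ≤ 0 := by linarith
    have h8 : 0 ≤ (1 - u) * r⁻¹ * ρ * c / 2 := by positivity
    have h9 : 0 ≤ u * c := by positivity
    have hu0 : u = 0 := by
      have : u * c = 0 := by linarith
      exact (mul_eq_zero.1 this).resolve_right hc.ne'
    subst hu0
    have : 0 < (1 - 0) * r⁻¹ * ρ * c / 2 := by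
      have := inv_pos.2 hr
      simp only [sub_zero, one_mul]
      positivity
    linarith
  have hLi : Function.Injective (L : V →ₗ[ℝ] ℂ × ℂ) := by
    rw [← LinearMap.ker_eq_bot, LinearMap.ker_eq_bot']
    intro v hv
    have h2 := hL v
    rw [show L v = 0 from hv, norm_zero] at h2
    have : ‖v‖ ≤ 0 := by
      by_contra hlt
      nlinarith [mul_pos hc (not_le.1 hlt)]
    exact norm_le_zero_iff.1 this
  have hslab := htpy_slab_center hg hρ hx1 hbox
  simp only [h1] at hslab
  rcases htpy_free_wmap hLi hLT hTb with h | h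
  · left; exact htpy_of_free hs wmap_mem (hslab.trans h)
  · right; exact htpy_of_free hs (comp_rfl0_mem wmap_mem) (hslab.trans h)

end

section

variable {f : V → X} {P : V → (ℂ × ℝ) × (ℂ × ℝ)} {q : ℂ × ℂ}

/-- The horizontal components stay away from `q` off the bad points. -/
lemma exists_radius (hP : IsApprox f P) (B : Set V) (hB : ∀ z, z ∈ Bad P q → z ∈ B) {ρ : ℝ}
    (hρ : 0 < ρ) : ∃ r > 0, r ≤ 1 / 4 ∧ ∀ z ∈ Icc (0 : V) 1, Low (P z) → ‖UU (P z) - q‖ < r →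
      ∃ x ∈ B, ‖z - x‖ < ρ := by
  have hPc := hP.contDiff.continuous
  have hK : IsCompact (Icc (0 : V) 1 ∩ ({z | Low (P z)} ∩ ⋂ x ∈ B, {z | ρ ≤ ‖z - x‖})) :=
    isCompact_Icc.inter_right ((isClosed_low.preimage hPc).inter
      (isClosed_biInter fun x _ => isClosed_le continuous_const (by fun_prop)))
  obtain ⟨m, hm, h⟩ := hK.exists_forall_le' (f := fun z => ‖UU (P z) - q‖) (a := 0)
    (Continuous.continuousOn (by fun_prop)) (by
      rintro z ⟨-, hz, hz'⟩
      rw [norm_pos_iff, sub_ne_zero]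
      intro h
      have := mem_iInter₂.1 hz' z (hB z ⟨h, hz⟩)
      simp only [mem_ofPred_eq, sub_self, norm_zero] at this
      linarith)
  refine ⟨min m (1 / 4), lt_min hm (by norm_num), min_le_right _ _, fun z hz hl hlt => ?_⟩
  by_contra! hc
  have := h z ⟨hz, hl, mem_iInter₂.2 hc⟩
  exact absurd (hlt.trans_le (min_le_left _ _)) (not_lt.2 this)

/-- A map whose bad points have distinct first coordinates is a power of the generator. -/
lemma mem_of_injOn {G : Type*} [Group G] {mk : BasedS → G}
    (hm : ∀ f g : BasedS, Htpy BasedS f.1 g.1 → mk f = mk g)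
    (hconcat : ∀ f g : BasedS, mk ⟨_, concat_mem f.2 g.2⟩ = mk g * mk f)
    (hconst : mk ⟨_, const_mem⟩ = 1)
    (hinv : ∀ f : BasedS, mk ⟨_, comp_rfl0_mem f.2⟩ = (mk f)⁻¹) (hf : f ∈ BasedS)
    (hP : IsApprox f P) (hq4 : ‖q‖ < 1 / 4)
    (hq : ∀ y, UU (P y) = q → Function.Injective (fderiv ℝ (fun y => UU (P y)) y))
    (hinj : InjOn (fun y : V => y 0) (Bad P q)) :
    mk ⟨f, hf⟩ ∈ Subgroup.zpowers (mk ⟨wmap, wmap_mem⟩) := by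
  have hfin := finite_bad hf hP hq
  choose! c hc hL hbx using fun x (hx : x ∈ Bad P q) => eventually_box hf hP hq4 hq hx
  have hsep : ∀ x ∈ Bad P q, ∀ x' ∈ Bad P q, x ≠ x' →
      ∀ᶠ ρ in 𝓝[>] (0 : ℝ), 2 * ρ ≤ |x 0 - x' 0| := by
    intro x hx x' hx' hne
    have h0 : 0 < |x 0 - x' 0| := abs_pos.2 (sub_ne_zero.2 fun h => hne (hinj hx hx' h))
    filter_upwards [Ioo_mem_nhdsGT (half_pos h0)] with ρ hρ
    linarith [hρ.2]
  have hsep' : ∀ᶠ ρ in 𝓝[>] (0 : ℝ), ∀ x ∈ Bad P q, ∀ x' ∈ Bad P q, x ≠ x' →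
      2 * ρ ≤ |x 0 - x' 0| := by
    rw [Filter.eventually_all_finite hfin]
    intro x hx
    rw [Filter.eventually_all_finite hfin]
    intro x' hx'
    by_cases h : x = x'
    · simp [h]
    · filter_upwards [hsep x hx x' hx' h] with ρ hρ _ using hρ
  obtain ⟨ρ, ⟨hbox, hs⟩, hρ⟩ := ((((Filter.eventually_all_finite hfin).2 hbx).and hsep').and
    self_mem_nhdsWithin).exists
  have hρ : 0 < ρ := hρ
  obtain ⟨r, hr, hr4, hrad⟩ := exists_radius (q := q) hP (Bad P q) (fun _ h => h) hρ
  have hh := htpy_colP hf hP hq4 hr hr4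
  have hg : (fun y => colP q r (P y)) ∈ BasedS := by
    obtain ⟨H, -, hS, -, h1⟩ := hh
    exact h1 ▸ hS 1
  have hnear : ∀ z, ¬ InA (colP q r (P z)) → ∃ x ∈ Bad P q, ‖z - x‖ < ρ := by
    intro z hz
    have hz' := mem_cube_of_not_inB fun h => hz ((basedS_subset_freeS hg).2 z h)
    obtain ⟨h1, h2⟩ := of_not_inA_colP hr hz
    exact hrad z ⟨fun i => (hz' i).1.le, fun i => (hz' i).2.le⟩ h1 h2
  have hcube : ∀ x ∈ Bad P q, ρ ≤ x 0 ∧ x 0 + ρ ≤ 1 := by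
    intro x hx
    have h1 := (hbox x hx (x - fun _ => ρ) (by
      rw [sub_sub_cancel_left, norm_neg, pi_norm_le_iff_of_nonneg hρ.le]
      exact fun _ => (abs_of_pos hρ).le)).2.1 0
    have h2 := (hbox x hx (x + fun _ => ρ) (by
      rw [add_sub_cancel_left, pi_norm_le_iff_of_nonneg hρ.le]
      exact fun _ => (abs_of_pos hρ).le)).2.1 0
    simp only [Pi.sub_apply, Pi.add_apply] at h1 h2
    constructor <;> linarith
  have hcoord : ∀ (z x : V) i, |z i - x i| ≤ ‖z - x‖ := fun z x i => norm_le_pi_norm (z - x) i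
  rw [hm ⟨f, hf⟩ ⟨_, hg⟩ hh]
  refine mem_of_slabs hm hconcat hconst _ ⟨_, hg⟩ (hfin.toFinset.image fun y => y 0) hρ ?_ ?_ ?_
    ?_ ?_
  · simp only [Finset.mem_image, Finite.mem_toFinset]
    rintro _ ⟨x, hx, rfl⟩
    exact (hcube x hx).1
  · simp only [Finset.mem_image, Finite.mem_toFinset]
    rintro _ ⟨x, hx, rfl⟩
    exact (hcube x hx).2
  · simp only [Finset.mem_image, Finite.mem_toFinset]
    rintro _ ⟨x, hx, rfl⟩ _ ⟨x', hx', rfl⟩ hlt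
    have := hs x hx x' hx' (fun h => hlt.ne (h ▸ rfl))
    rw [abs_of_neg (sub_neg.2 hlt)] at this
    linarith
  · intro t ht z hz
    by_contra hA
    obtain ⟨x, hx, hlt⟩ := hnear z hA
    have h1 := ht (x 0) (Finset.mem_image.2 ⟨x, hfin.mem_toFinset.2 hx, rfl⟩)
    have h2 := hcoord z x 0
    rw [hz] at h2
    linarith
  · simp only [Finset.mem_image, Finite.mem_toFinset]
    rintro _ ⟨x, hx, rfl⟩ h
    have hb : ∀ z : V, |z 0 - x 0| ≤ ρ → ∀ i, ρ ≤ |z i - x i| → InA (colP q r (P z)) := by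
      intro z hz i hi
      by_contra hA
      obtain ⟨x', hx', hlt⟩ := hnear z hA
      by_cases hxx : x = x'
      · subst hxx
        linarith [hcoord z x i]
      · have h1 := hs x hx x' hx' hxx
        have h2 := hcoord z x' 0
        have h3 := abs_sub_le (x 0) (z 0) (x' 0)
        rw [abs_sub_comm (x 0) (z 0)] at h3
        linarith
    rcases slab_htpy_wmap hP hr hρ (hc x hx) hg (hL x hx) (hbox x hx) hb h with h' | h'
    · rw [hm ⟨_, h⟩ ⟨_, wmap_mem⟩ h']
      exact Subgroup.mem_zpowers _
    · rw [hm ⟨_, h⟩ ⟨_, comp_rfl0_mem wmap_mem⟩ h', hinv ⟨_, wmap_mem⟩]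
      exact inv_mem (Subgroup.mem_zpowers _)

end

/-! ### Making first coordinates distinct by a shear -/

/-- The amount of shear. -/
noncomputable def shift (ε : ℝ) (y : V) : ℝ :=
  ε * Real.arctan (y 1) + ε ^ 2 * Real.arctan (y 2) + ε ^ 3 * Real.arctan (y 3)

/-- A shear in the first coordinate. -/
noncomputable def shear (ε : ℝ) (y : V) : V := ![3 * y 0 - 1 + shift ε y, y 1, y 2, y 3]

/-- The inverse of the shear. -/
noncomputable def shearInv (ε : ℝ) (y : V) : V := ![(y 0 + 1 - shift ε y) / 3, y 1, y 2, y 3]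

lemma contDiff_shift (ε : ℝ) : ContDiff ℝ 2 (shift ε) := by
  have h : ∀ i : Fin 4, ContDiff ℝ 2 fun y : V => Real.arctan (y i) := fun i =>
    (contDiff_apply ℝ ℝ i).arctan
  exact ((contDiff_const.mul (h 1)).add (contDiff_const.mul (h 2))).add (contDiff_const.mul (h 3))

lemma contDiff_vec4 {a b c d : V → ℝ} (ha : ContDiff ℝ 2 a)
    (hb : ContDiff ℝ 2 b) (hc : ContDiff ℝ 2 c) (hd : ContDiff ℝ 2 d) :
    ContDiff ℝ 2 fun y => (![a y, b y, c y, d y] : V) := by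
  refine contDiff_pi.2 fun i => ?_
  fin_cases i <;> assumption

lemma contDiff_shear (ε : ℝ) : ContDiff ℝ 2 (shear ε) :=
  contDiff_vec4 (((contDiff_const.mul (contDiff_apply ℝ ℝ 0)).sub contDiff_const).add
    (contDiff_shift ε)) (contDiff_apply ℝ ℝ 1) (contDiff_apply ℝ ℝ 2) (contDiff_apply ℝ ℝ 3)

lemma contDiff_shearInv (ε : ℝ) : ContDiff ℝ 2 (shearInv ε) :=
  contDiff_vec4 ((((contDiff_apply ℝ ℝ 0).add contDiff_const).sub (contDiff_shift ε)).div_const 3)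
    (contDiff_apply ℝ ℝ 1) (contDiff_apply ℝ ℝ 2) (contDiff_apply ℝ ℝ 3)

lemma shift_shear (ε : ℝ) (y : V) : shift ε (shear ε y) = shift ε y := rfl

lemma shearInv_shear (ε : ℝ) (y : V) : shearInv ε (shear ε y) = y := by
  ext i
  fin_cases i
  · simp only [shearInv, shift_shear]
    simp [shear]
    ring
  all_goals rfl

lemma abs_shift_le {ε : ℝ} (h0 : 0 < ε) (h1 : ε < 1 / 6) (y : V) : |shift ε y| ≤ 1 := by
  have h : ∀ t, -2 < Real.arctan t ∧ Real.arctan t < 2 := fun t => by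
    have := Real.neg_pi_div_two_lt_arctan t
    have := Real.arctan_lt_pi_div_two t
    have := Real.pi_lt_four
    constructor <;> linarith
  have e2 : ε ^ 2 ≤ 1 / 6 * ε := by nlinarith
  have e3 : ε ^ 3 ≤ 1 / 36 * ε := by nlinarith
  have p2 : 0 < ε ^ 2 := by positivity
  have p3 : 0 < ε ^ 3 := by positivity
  have a1 := h (y 1)
  have a2 := h (y 2)
  have a3 := h (y 3)
  rw [abs_le, shift]
  constructor <;> nlinarith

lemma htpy_shear {f : V → X} (hf : f ∈ BasedS) {ε : ℝ} (h0 : 0 < ε) (h1 : ε < 1 / 6) :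
    Htpy BasedS (fun y => f (shear ε y)) f := by
  refine htpy_comp_of_faces hf (contDiff_shear ε).continuous ?_ ?_
  · intro y i hi
    have := abs_le.1 (abs_shift_le h0 h1 y)
    fin_cases i <;> simp [shear] at hi ⊢ <;> linarith
  · intro y i hi
    have := abs_le.1 (abs_shift_le h0 h1 y)
    fin_cases i <;> simp [shear] at hi ⊢ <;> linarith

open Polynomial in
/-- Two distinct points have distinct first coordinates after a generic shear. -/
lemma finite_shear_eq {x x' : V} (h : x ≠ x') :
    {ε : ℝ | shearInv ε x 0 = shearInv ε x' 0}.Finite := by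
  let d : Fin 4 → ℝ := fun i => Real.arctan (x i) - Real.arctan (x' i)
  let p : ℝ[X] := C (x 0 - x' 0) - (Polynomial.X * C (d 1) + Polynomial.X ^ 2 * C (d 2) +
    Polynomial.X ^ 3 * C (d 3))
  have hp : p ≠ 0 := by
    intro hp
    have hd : ∀ i, d i = 0 → x i = x' i := fun i hi =>
      Real.arctan_injective (sub_eq_zero.1 hi)
    apply h
    have c0 := congrArg (fun r => coeff r 0) hp
    have c1 := congrArg (fun r => coeff r 1) hp
    have c2 := congrArg (fun r => coeff r 2) hp
    have c3 := congrArg (fun r => coeff r 3) hp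
    simp [p, coeff_X, coeff_C, coeff_X_pow] at c0 c1 c2 c3
    ext i
    fin_cases i
    · exact sub_eq_zero.1 c0
    · exact hd 1 c1
    · exact hd 2 c2
    · exact hd 3 c3
  refine (Polynomial.finite_setOfPred_isRoot hp).subset fun ε hε => ?_
  have hε : (x 0 + 1 - shift ε x) / 3 = (x' 0 + 1 - shift ε x') / 3 := hε
  simp only [shift] at hε
  simp [p, d, IsRoot]
  linarith

lemma exists_shear {B : Set V} (hB : B.Finite) :
    ∃ ε : ℝ, 0 < ε ∧ ε < 1 / 6 ∧ InjOn (fun x => shearInv ε x 0) B := by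
  have hfin : (⋃ p ∈ B.offDiag, {ε : ℝ | shearInv ε p.1 0 = shearInv ε p.2 0}).Finite :=
    (hB.offDiag).biUnion fun p hp => finite_shear_eq hp.2.2
  obtain ⟨ε, hε, hn⟩ := ((Ioo_infinite (show (0 : ℝ) < 1 / 6 by norm_num)).sdiff hfin).nonempty
  refine ⟨ε, hε.1, hε.2, fun x hx x' hx' h => ?_⟩
  by_contra hne
  exact hn (mem_iUnion₂.2 ⟨(x, x'), ⟨hx, hx', hne⟩, h⟩)

/-- Every class is a power of the generator. -/
lemma mem_zpowers_wmap {G : Type*} [Group G] {mk : BasedS → G}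
    (hm : ∀ f g : BasedS, Htpy BasedS f.1 g.1 → mk f = mk g)
    (hconcat : ∀ f g : BasedS, mk ⟨_, concat_mem f.2 g.2⟩ = mk g * mk f)
    (hconst : mk ⟨_, const_mem⟩ = 1)
    (hinv : ∀ f : BasedS, mk ⟨_, comp_rfl0_mem f.2⟩ = (mk f)⁻¹) (f : BasedS) :
    mk f ∈ Subgroup.zpowers (mk ⟨wmap, wmap_mem⟩) := by
  obtain ⟨f, hf⟩ := f
  obtain ⟨P, hP⟩ := exists_isApprox hf.1
  have hU : Differentiable ℝ fun y => UU (P y) :=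
    UU.differentiable.comp (hP.contDiff.differentiable two_ne_zero)
  obtain ⟨q, hq4, hq⟩ := exists_regular hU
  obtain ⟨ε, h0, h1, hinj⟩ := exists_shear (finite_bad hf hP hq)
  have hsh := htpy_shear hf h0 h1
  have hg : (fun y => f (shear ε y)) ∈ BasedS := by
    obtain ⟨H, -, hS, h0, -⟩ := hsh
    exact h0 ▸ hS 0
  rw [← hm ⟨_, hg⟩ ⟨f, hf⟩ hsh]
  have hP' : IsApprox (fun y => f (shear ε y)) fun y => P (shear ε y) :=
    ⟨hP.contDiff.comp (contDiff_shear ε), fun y => hP.near_fst _, fun y => hP.near_snd _⟩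
  have hd : Differentiable ℝ (shear ε) := (contDiff_shear ε).differentiable two_ne_zero
  have hd' : Differentiable ℝ (shearInv ε) := (contDiff_shearInv ε).differentiable two_ne_zero
  refine mem_of_injOn hm hconcat hconst hinv hg hP' hq4 (fun y hy => ?_) ?_
  · have e1 : fderiv ℝ (fun y => UU (P (shear ε y))) y =
        (fderiv ℝ (fun y => UU (P y)) (shear ε y)).comp (fderiv ℝ (shear ε) y) :=
      fderiv_comp (g := fun y => UU (P y)) y (hU _) (hd y)
    rw [e1]
    refine (hq _ hy).comp (Function.LeftInverse.injective (g := fderiv ℝ (shearInv ε) (shear ε y))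
      fun v => ?_)
    have e2 : fderiv ℝ (fun y => shearInv ε (shear ε y)) y =
        (fderiv ℝ (shearInv ε) (shear ε y)).comp (fderiv ℝ (shear ε) y) :=
      fderiv_comp y (hd' _) (hd y)
    simp only [shearInv_shear, fderiv_fun_id] at e2
    exact (DFunLike.congr_fun e2 v).symm
  · intro y hy y' hy' h
    have h2 : shear ε y = shear ε y' := hinj (by exact hy) (by exact hy') (by
      simpa only [shearInv_shear] using h)
    rw [← shearInv_shear ε y, h2, shearInv_shear]

/-! ### Homotopy invariance of the integral of a pulled back form -/

lemma sum_sign_symm {n : ℕ} (D : Fin n → Fin (n + 1) → ℝ) (i : Fin n)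
    (B : Fin (n + 1) → Fin (n + 1) → ℝ) (hB : ∀ a b, B a b = B b a) :
    ∑ τ : Equiv.Perm (Fin (n + 1)), ((Equiv.Perm.sign τ : ℤ) : ℝ) *
      (B (τ 0) (τ i.succ) * ∏ k ∈ Finset.univ.erase i, D k (τ k.succ)) = 0 := by
  have h := Equiv.sum_comp (Equiv.mulRight (Equiv.swap (0 : Fin (n + 1)) i.succ))
    fun τ : Equiv.Perm (Fin (n + 1)) => ((Equiv.Perm.sign τ : ℤ) : ℝ) *
      (B (τ 0) (τ i.succ) * ∏ k ∈ Finset.univ.erase i, D k (τ k.succ))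
  have h2 : ∀ τ : Equiv.Perm (Fin (n + 1)), ∏ k ∈ Finset.univ.erase i,
      D k (τ (Equiv.swap (0 : Fin (n + 1)) i.succ k.succ)) =
      ∏ k ∈ Finset.univ.erase i, D k (τ k.succ) := fun τ =>
    Finset.prod_congr rfl fun k hk => by
      rw [Equiv.swap_apply_of_ne_of_ne (Fin.succ_ne_zero k)
        (fun h => (Finset.mem_erase.1 hk).1 (Fin.succ_injective _ h))]
  simp only [Equiv.coe_mulRight, Equiv.Perm.sign_mul, Equiv.Perm.coe_mul, Function.comp_apply,
    Equiv.swap_apply_left, Equiv.swap_apply_right, h2, hB _ (_ : Fin (n + 1)),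
    Equiv.Perm.sign_swap (Fin.succ_ne_zero i).symm, mul_neg, mul_one, Units.val_neg, Int.cast_neg,
    neg_mul, Finset.sum_neg_distrib] at h
  have h3 : ∀ τ : Equiv.Perm (Fin (n + 1)), B (τ i.succ) (τ 0) = B (τ 0) (τ i.succ) :=
    fun τ => hB _ _
  simp only [h3] at h
  linarith

/-- The partial derivatives. -/
noncomputable def pd {n : ℕ} (U : (Fin (n + 1) → ℝ) → Fin n → ℝ) (i : Fin n) (k : Fin (n + 1))
    (z : Fin (n + 1) → ℝ) : ℝ := fderiv ℝ U z (Pi.single k 1) i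

/-- The vector field whose flux is the integral of the Jacobian. -/
noncomputable def jac {n : ℕ} (g : (Fin (n + 1) → ℝ) → ℝ) (U : (Fin (n + 1) → ℝ) → Fin n → ℝ)
    (j : Fin (n + 1)) (z : Fin (n + 1) → ℝ) : ℝ :=
  g z * ∑ τ : Equiv.Perm (Fin (n + 1)), (if τ 0 = j then ((Equiv.Perm.sign τ : ℤ) : ℝ) else 0) *
    ∏ i, pd U i (τ i.succ) z

lemma jac_zero {n : ℕ} (g : (Fin (n + 1) → ℝ) → ℝ) (U : (Fin (n + 1) → ℝ) → Fin n → ℝ)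
    (z : Fin (n + 1) → ℝ) :
    jac g U 0 z = g z * (Matrix.of fun k i : Fin n => pd U i k.succ z).det := by
  let M : Matrix (Fin (n + 1)) (Fin (n + 1)) ℝ :=
    Matrix.of fun k => Fin.cons (if k = 0 then 1 else 0) fun i => pd U i k z
  have h1 : M.det = (Matrix.of fun k i : Fin n => pd U i k.succ z).det := by
    rw [Matrix.det_succ_column_zero, Finset.sum_eq_single 0]
    · simp [M]
      congr 1
    · intro b _ hb
      simp [M, hb]
    · simp
  rw [jac, ← h1, Matrix.det_apply']
  congr 1
  refine Finset.sum_congr rfl fun τ _ => ?_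
  rw [Fin.prod_univ_succ]
  by_cases h : τ 0 = 0 <;> simp [M, h]

lemma hasFDerivAt_jac_of_zero {n : ℕ} {g : (Fin (n + 1) → ℝ) → ℝ}
    {U : (Fin (n + 1) → ℝ) → Fin n → ℝ} {p : Fin (n + 1) → ℝ} (h : ∀ᶠ z in 𝓝 p, g z = 0)
    (j : Fin (n + 1)) : HasFDerivAt (jac g U j) (0 : (Fin (n + 1) → ℝ) →L[ℝ] ℝ) p := by
  refine (hasFDerivAt_const (0 : ℝ) p).congr_of_eventuallyEq ?_
  filter_upwards [h] with z hz
  rw [jac, hz, zero_mul]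

section

variable {n : ℕ} {g : (Fin (n + 1) → ℝ) → ℝ} {ψ : (Fin n → ℝ) → ℝ}
    {U : (Fin (n + 1) → ℝ) → Fin n → ℝ} {p : Fin (n + 1) → ℝ}

lemma hasFDerivAt_pd (hU : ContDiffAt ℝ 2 U p) (i : Fin n) (k : Fin (n + 1)) :
    ∃ L : (Fin (n + 1) → ℝ) →L[ℝ] ℝ, HasFDerivAt (pd U i k) L p ∧
      ∀ v, L v = fderiv ℝ (fderiv ℝ U) p v (Pi.single k 1) i := by
  have h1 : DifferentiableAt ℝ (fderiv ℝ U) p :=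
    (hU.fderiv_right (m := 1) (by norm_num)).differentiableAt one_ne_zero
  let ev : ((Fin (n + 1) → ℝ) →L[ℝ] (Fin n → ℝ)) →L[ℝ] ℝ :=
    (ContinuousLinearMap.proj i).comp
      (ContinuousLinearMap.apply ℝ (Fin n → ℝ) (Pi.single k 1 : Fin (n + 1) → ℝ))
  exact ⟨ev.comp (fderiv ℝ (fderiv ℝ U) p), ev.hasFDerivAt.comp p h1.hasFDerivAt, fun v => rfl⟩

lemma hasFDerivAt_jac (hU : ContDiffAt ℝ 2 U p) (hψ : DifferentiableAt ℝ ψ (U p))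
    (hg : ∀ᶠ z in 𝓝 p, g z = ψ (U z)) :
    ∃ L : Fin (n + 1) → (Fin (n + 1) → ℝ) →L[ℝ] ℝ, (∀ j, HasFDerivAt (jac g U j) (L j) p) ∧
      ∑ j, L j (Pi.single j 1) = 0 := by
  have hU1 : HasFDerivAt U (fderiv ℝ U p) p := (hU.differentiableAt two_ne_zero).hasFDerivAt
  have hg' : HasFDerivAt g ((fderiv ℝ ψ (U p)).comp (fderiv ℝ U p)) p :=
    (hψ.hasFDerivAt.comp p hU1).congr_of_eventuallyEq hg
  choose D' hD' hDv using hasFDerivAt_pd hU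
  have hprod := fun τ : Equiv.Perm (Fin (n + 1)) =>
    HasFDerivAt.finsetProd (u := Finset.univ) (g := fun i => pd U i (τ (Fin.succ i)))
      (x := p) fun i _ => hD' i (τ (Fin.succ i))
  have hall := fun j : Fin (n + 1) => hg'.mul (HasFDerivAt.fun_sum (u := Finset.univ)
    fun τ _ => (hprod τ).const_mul (if τ 0 = j then ((Equiv.Perm.sign τ : ℤ) : ℝ) else 0))
  refine ⟨_, hall, ?_⟩
  let B : Fin n → Fin (n + 1) → Fin (n + 1) → ℝ := fun i a b =>
    g p * fderiv ℝ (fderiv ℝ U) p (Pi.single a 1) (Pi.single b 1) i +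
      fderiv ℝ ψ (U p) (Pi.single i 1) * (pd U i a p * pd U i b p)
  have hsymm : IsSymmSndFDerivAt ℝ U p := hU.isSymmSndFDerivAt (by simp)
  have hB : ∀ i a b, B i a b = B i b a := fun i a b => by
    simp only [B]
    rw [hsymm.eq, mul_comm (pd U i a p)]
  have hdg : ∀ k, fderiv ℝ ψ (U p) (fderiv ℝ U p (Pi.single k 1)) =
      ∑ l, fderiv ℝ ψ (U p) (Pi.single l 1) * pd U l k p := by
    intro k
    have : fderiv ℝ U p (Pi.single k 1) = ∑ l, pd U l k p • (Pi.single l 1 : Fin n → ℝ) := by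
      ext m
      simp [pd, Finset.sum_apply, Pi.single_apply]
    rw [this, map_sum]
    exact Finset.sum_congr rfl fun l _ => by rw [map_smul, smul_eq_mul, mul_comm]
  have hsum : ∀ τ : Equiv.Perm (Fin (n + 1)), g p * ∑ i,
      (∏ k ∈ Finset.univ.erase i, pd U k (τ k.succ) p) *
        fderiv ℝ (fderiv ℝ U) p (Pi.single (τ 0) 1) (Pi.single (τ i.succ) 1) i +
      (∏ i, pd U i (τ i.succ) p) * ∑ l, fderiv ℝ ψ (U p) (Pi.single l 1) * pd U l (τ 0) p =
      ∑ i, B i (τ 0) (τ i.succ) * ∏ k ∈ Finset.univ.erase i, pd U k (τ k.succ) p := by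
    intro τ
    rw [Finset.mul_sum, Finset.mul_sum, ← Finset.sum_add_distrib]
    refine Finset.sum_congr rfl fun i _ => ?_
    rw [← Finset.mul_prod_erase Finset.univ _ (Finset.mem_univ i)]
    simp only [B]
    ring
  have hfin : ∑ τ : Equiv.Perm (Fin (n + 1)), ((Equiv.Perm.sign τ : ℤ) : ℝ) *
      ∑ i, B i (τ 0) (τ i.succ) * ∏ k ∈ Finset.univ.erase i, pd U k (τ k.succ) p = 0 := by
    simp only [Finset.mul_sum]
    rw [Finset.sum_comm]
    exact Finset.sum_eq_zero fun i _ => sum_sign_symm (fun k a => pd U k a p) i (B i) (hB i)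
  refine Eq.trans ?_ hfin
  simp only [add_apply, smul_apply, sum_apply, ContinuousLinearMap.comp_apply, smul_eq_mul, hDv,
    hdg, ← hsum]
  have hj : ∀ (A : Equiv.Perm (Fin (n + 1)) → Fin (n + 1) → ℝ),
      ∑ τ : Equiv.Perm (Fin (n + 1)), ((Equiv.Perm.sign τ : ℤ) : ℝ) * A τ (τ 0) =
      ∑ j, ∑ τ : Equiv.Perm (Fin (n + 1)),
        (if τ 0 = j then ((Equiv.Perm.sign τ : ℤ) : ℝ) else 0) * A τ j := by
    intro A
    rw [Finset.sum_comm]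
    exact Finset.sum_congr rfl fun τ _ => by simp [ite_mul]
  rw [hj fun τ j => g p * ∑ i,
      (∏ k ∈ Finset.univ.erase i, pd U k (τ k.succ) p) *
        fderiv ℝ (fderiv ℝ U) p (Pi.single j 1) (Pi.single (τ i.succ) 1) i +
      (∏ i, pd U i (τ i.succ) p) * ∑ l, fderiv ℝ ψ (U p) (Pi.single l 1) * pd U l j p]
  refine Finset.sum_congr rfl fun j _ => ?_
  rw [Finset.mul_sum, Finset.sum_mul, ← Finset.sum_add_distrib]
  exact Finset.sum_congr rfl fun τ _ => by ring

/-- Where the coefficient is a function of `U`, or vanishes, near every point of the cube. -/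
def Good (g : (Fin (n + 1) → ℝ) → ℝ) (ψ : (Fin n → ℝ) → ℝ) (U : (Fin (n + 1) → ℝ) → Fin n → ℝ)
    (p : Fin (n + 1) → ℝ) : Prop :=
  (∀ᶠ z in 𝓝 p, g z = 0) ∨ (ContDiffAt ℝ 2 U p ∧ ∀ᶠ z in 𝓝 p, g z = ψ (U z))

lemma hasFDerivAt_jac_of_good (hψ : Differentiable ℝ ψ) (h : Good g ψ U p) :
    ∃ L : Fin (n + 1) → (Fin (n + 1) → ℝ) →L[ℝ] ℝ, (∀ j, HasFDerivAt (jac g U j) (L j) p) ∧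
      ∑ j, L j (Pi.single j 1) = 0 := by
  rcases h with h | ⟨h, hg⟩
  · exact ⟨fun _ => 0, hasFDerivAt_jac_of_zero h, by simp⟩
  · exact hasFDerivAt_jac h (hψ _) hg

/-- The flux through the bottom and the top of the cube agree. -/
lemma integral_jac_eq (hψ : Differentiable ℝ ψ)
    (h : ∀ p ∈ Icc (0 : Fin (n + 1) → ℝ) 1, Good g ψ U p)
    (hside : ∀ p ∈ Icc (0 : Fin (n + 1) → ℝ) 1,
      (∃ i : Fin n, p i.succ = 0 ∨ p i.succ = 1) → g p = 0) :
    ∫ x in Icc (0 : Fin n → ℝ) 1, jac g U 0 (Fin.cons 0 x) =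
      ∫ x in Icc (0 : Fin n → ℝ) 1, jac g U 0 (Fin.cons 1 x) := by
  have hle : (0 : Fin (n + 1) → ℝ) ≤ 1 := zero_le_one
  choose! L hL hL0 using fun p hp => hasFDerivAt_jac_of_good hψ (h p hp)
  have h1 := integral_divergence_of_hasFDerivAt_off_countable' (0 : Fin (n + 1) → ℝ) 1 hle
    (jac g U) (fun j p => L p j) ∅ countable_empty
    (fun j p hp => (hL p hp j).continuousAt.continuousWithinAt)
    (fun p hp j => hL p ⟨fun i => (hp.1 i trivial).1.le, fun i => (hp.1 i trivial).2.le⟩ j)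
    (integrableOn_zero.congr_fun (fun p hp => (hL0 p hp).symm) measurableSet_Icc)
  rw [setIntegral_congr_fun measurableSet_Icc fun p hp => hL0 p hp, integral_zero,
    Fin.sum_univ_succ, Finset.sum_eq_zero, add_zero, eq_comm, sub_eq_zero] at h1
  · simp only [Fin.insertNth_zero'] at h1
    exact h1.symm
  · intro i _
    have hz : ∀ c : ℝ, c = 0 ∨ c = 1 → ∫ x in Icc ((0 : Fin (n + 1) → ℝ) ∘ Fin.succAbove i.succ)
        ((1 : Fin (n + 1) → ℝ) ∘ Fin.succAbove i.succ),
          jac g U i.succ (Fin.insertNth i.succ c x) = 0 := by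
      intro c hc
      refine setIntegral_eq_zero_of_forall_eq_zero fun x hx => ?_
      rw [jac, hside, zero_mul]
      · refine Fin.insertNth_mem_Icc.2 ⟨?_, hx⟩
        rcases hc with rfl | rfl <;> simp
      · exact ⟨i, by simpa using hc⟩
    exact sub_eq_zero.2 ((hz _ (Or.inr rfl)).trans (hz _ (Or.inl rfl)).symm)

lemma continuousOn_jac (hψ : Differentiable ℝ ψ)
    (h : ∀ p ∈ Icc (0 : Fin (n + 1) → ℝ) 1, Good g ψ U p)
    (j : Fin (n + 1)) : ContinuousOn (jac g U j) (Icc 0 1) := fun p hp => by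
  obtain ⟨L, hL, -⟩ := hasFDerivAt_jac_of_good hψ (h p hp)
  exact (hL j).continuousAt.continuousWithinAt

lemma cons_mem_Icc {u : ℝ} (hu : 0 ≤ u) (hu' : u ≤ 1) {x : Fin n → ℝ} (hx : x ∈ Icc 0 1) :
    (Fin.cons u x : Fin (n + 1) → ℝ) ∈ Icc 0 1 :=
  ⟨fun i => Fin.cases hu (fun i => hx.1 i) i, fun i => Fin.cases hu' (fun i => hx.2 i) i⟩

lemma jac_cons (h : Good g ψ U p) {u : ℝ} {x : Fin n → ℝ} (hp : p = Fin.cons u x) :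
    jac g U 0 p = g p * (fderiv ℝ (fun y : Fin n → ℝ => U (Fin.cons u y)) x).det := by
  rcases h with h | ⟨h, -⟩
  · have := h.self_of_nhds
    simp [jac, this]
  · rw [jac_zero]
    subst hp
    congr 1
    let ι : (Fin n → ℝ) →L[ℝ] (Fin (n + 1) → ℝ) :=
      ContinuousLinearMap.pi fun i => Fin.cases 0 (fun i => ContinuousLinearMap.proj i) i
    have hι : HasFDerivAt (fun y : Fin n → ℝ => (Fin.cons u y : Fin (n + 1) → ℝ)) ι x := by
      refine hasFDerivAt_pi.2 fun i => ?_
      refine Fin.cases ?_ (fun i => ?_) i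
      · exact hasFDerivAt_const _ _
      · exact (ContinuousLinearMap.proj (R := ℝ) (φ := fun _ : Fin n => ℝ) i).hasFDerivAt
    have hc : HasFDerivAt (fun y : Fin n → ℝ => U (Fin.cons u y))
        ((fderiv ℝ U (Fin.cons u x)).comp ι) x :=
      HasFDerivAt.comp x (h.differentiableAt two_ne_zero).hasFDerivAt hι
    rw [hc.fderiv, ContinuousLinearMap.det, ← LinearMap.det_toMatrix', ← Matrix.det_transpose]
    congr 1
    ext i k
    simp only [Matrix.transpose_apply, Matrix.of_apply, LinearMap.toMatrix'_apply, pd]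
    have : ι (Pi.single k 1) = Pi.single k.succ 1 := by
      ext m
      refine Fin.cases ?_ (fun m => ?_) m
      · simp [ι]
      · simp [ι, Pi.single_apply]
    simp [this]

end

/-- Linear coordinates on the target. -/
noncomputable def eV : (ℂ × ℂ) ≃L[ℝ] V := Lw.symm.toContinuousLinearEquiv

/-- The Jacobian determinant. -/
noncomputable def dt (T : V → ℂ × ℂ) (x : V) : ℝ := (fderiv ℝ (fun y => eV (T y)) x).det

lemma dt_congr {T T' : V → ℂ × ℂ} {x : V} (h : T =ᶠ[𝓝 x] T') : dt T x = dt T' x := by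
  have h' : (fun y => eV (T y)) =ᶠ[𝓝 x] fun y => eV (T' y) := h.mono fun y hy => congrArg eV hy
  rw [dt, dt, h'.fderiv_eq]

lemma dt_comp {T : V → ℂ × ℂ} {θ : V → V} {θ' : V →L[ℝ] V} {x : V}
    (hT : DifferentiableAt ℝ T (θ x)) (hθ : HasFDerivAt θ θ' x) :
    dt (fun y => T (θ y)) x = dt T (θ x) * θ'.det := by
  have h : HasFDerivAt (fun y => eV (T (θ y)))
      ((fderiv ℝ (fun y => eV (T y)) (θ x)).comp θ') x :=
    HasFDerivAt.comp (g := fun y => eV (T y)) x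
      (eV.differentiableAt.comp (θ x) hT).hasFDerivAt hθ
  rw [dt, h.fderiv, dt]
  exact LinearMap.det_comp _ _

/-- Invariance of the degree integral along a family. -/
lemma integral_flow {g : ℝ × V → ℝ} {U : ℝ × V → ℂ × ℂ} {ψ : ℂ × ℂ → ℝ} (hψ : Differentiable ℝ ψ)
    (h : ∀ u : ℝ, 0 ≤ u → u ≤ 1 → ∀ x ∈ Icc (0 : V) 1, (∀ᶠ p in 𝓝 (u, x), g p = 0) ∨
      (ContDiffAt ℝ 2 U (u, x) ∧ ∀ᶠ p in 𝓝 (u, x), g p = ψ (U p)))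
    (hside : ∀ u : ℝ, ∀ x : V, (∃ i, x i = 0 ∨ x i = 1) → g (u, x) = 0) :
    (∫ x in Icc (0 : V) 1, g (0, x) * dt (fun y => U (0, y)) x =
      ∫ x in Icc (0 : V) 1, g (1, x) * dt (fun y => U (1, y)) x) ∧
    ContinuousOn (fun x => g (1, x) * dt (fun y => U (1, y)) x) (Icc 0 1) := by
  let s : (Fin 5 → ℝ) →L[ℝ] ℝ × V :=
    (ContinuousLinearMap.proj 0).prod
      (ContinuousLinearMap.pi fun i => ContinuousLinearMap.proj i.succ)
  have hs : ∀ (u : ℝ) (x : V), s (Fin.cons u x) = (u, x) := fun u x => rfl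
  let G : (Fin 5 → ℝ) → ℝ := fun z => g (s z)
  let W : (Fin 5 → ℝ) → V := fun z => eV (U (s z))
  let φ : V → ℝ := fun v => ψ (eV.symm v)
  have hφ : Differentiable ℝ φ := hψ.comp eV.symm.differentiable
  have hgood : ∀ p ∈ Icc (0 : Fin 5 → ℝ) 1, Good G φ W p := by
    intro p hp
    have hst : Filter.Tendsto s (𝓝 p) (𝓝 (s p)) := s.continuous.continuousAt
    rcases h (p 0) (hp.1 0) (hp.2 0) (fun i => p i.succ)
      ⟨fun i => hp.1 i.succ, fun i => hp.2 i.succ⟩ with h' | ⟨h1, h2⟩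
    · exact Or.inl (hst.eventually h')
    · refine Or.inr ⟨eV.contDiff.contDiffAt.comp p (ContDiffAt.comp p h1 s.contDiff.contDiffAt), ?_⟩
      filter_upwards [hst.eventually h2] with z hz
      simp only [G, φ, W, ContinuousLinearEquiv.symm_apply_apply]
      exact hz
  have hj : ∀ u : ℝ, 0 ≤ u → u ≤ 1 → ∀ x ∈ Icc (0 : V) 1, jac G W 0 (Fin.cons u x) =
      g (u, x) * dt (fun y => U (u, y)) x := fun u hu hu' x hx =>
    jac_cons (hgood _ (cons_mem_Icc hu hu' hx)) rfl
  have h1 := integral_jac_eq hφ hgood fun p _ hi => hside (p 0) (fun i => p i.succ) hi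
  rw [setIntegral_congr_fun measurableSet_Icc (hj 0 le_rfl zero_le_one),
    setIntegral_congr_fun measurableSet_Icc (hj 1 zero_le_one le_rfl)] at h1
  refine ⟨h1, ?_⟩
  have h2 : ContinuousOn (fun x : V => jac G W 0 (Fin.cons 1 x)) (Icc 0 1) := by
    refine (continuousOn_jac hφ hgood 0).comp (Continuous.continuousOn ?_)
      fun x hx => cons_mem_Icc zero_le_one le_rfl hx
    refine continuous_pi fun i => ?_
    refine Fin.cases ?_ (fun i => ?_) i
    · exact continuous_const
    · exact continuous_apply i
  exact h2.congr fun x hx => (hj 1 zero_le_one le_rfl x hx).symm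

/-- The projection of the sphere inverting the collapse on the lower half. -/
noncomputable def pr (x : Sph) : ℂ := (√(2 * (1 - x.1.2)))⁻¹ • x.1.1

lemma pr_E {v : ℂ} (hv : ‖v‖ < 1) : pr (E v) = v := by
  have h1 : ‖v‖ ^ 2 < 1 := by nlinarith [norm_nonneg v]
  have h2 : 0 < √(1 - ‖v‖ ^ 2) := Real.sqrt_pos.2 (by linarith)
  have h3 : (E v).1.2 = 2 * ‖v‖ ^ 2 - 1 := by
    show 2 * min 1 (‖v‖ ^ 2) - 1 = _
    rw [min_eq_right h1.le]
  have h4 : (E v).1.1 = (2 * √(1 - ‖v‖ ^ 2)) • v := by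
    show ((2 * √(max 0 (1 - ‖v‖ ^ 2)) : ℝ) : ℂ) * v = _
    rw [max_eq_right (by linarith), Complex.real_smul]
  have h5 : √(2 * (1 - (2 * ‖v‖ ^ 2 - 1))) = 2 * √(1 - ‖v‖ ^ 2) := by
    rw [show 2 * (1 - (2 * ‖v‖ ^ 2 - 1)) = 2 ^ 2 * (1 - ‖v‖ ^ 2) by ring,
      Real.sqrt_mul (by norm_num), Real.sqrt_sq (by norm_num)]
  rw [pr, h3, h4, h5, smul_smul, inv_mul_cancel₀ (by positivity), one_smul]

lemma continuousAt_pr {x : Sph} (hx : x ≠ b0) : ContinuousAt pr x := by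
  have h1 : x.1.2 ≠ 1 := fun h => hx ((eq_b0_iff x).2 h)
  have h2 : ‖x.1.1‖ ^ 2 + x.1.2 ^ 2 = 1 := x.2
  have h3 : x.1.2 < 1 := lt_of_le_of_ne (by nlinarith [sq_nonneg ‖x.1.1‖]) h1
  have hc : Continuous fun x : Sph => x.1.2 := by fun_prop
  have hc' : Continuous fun x : Sph => x.1.1 := by fun_prop
  have hs : ContinuousAt (fun x : Sph => √(2 * (1 - x.1.2))) x :=
    (Real.continuous_sqrt.comp (continuous_const.mul (continuous_const.sub hc))).continuousAt
  exact (hs.inv₀ (Real.sqrt_pos.2 (by linarith)).ne').smul hc'.continuousAt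

/-- On the equator, the interpolation stays away from zero. -/
lemma norm_interp {p : ℂ × ℝ} {x : Sph} (h : ‖p - x.1‖ < 1 / 4) (hx : x.1.2 = 0) {u : ℝ}
    (hu : 0 ≤ u) (hu' : u ≤ 1) : 1 / 8 < ‖(1 - u) • p.1 + u • pr x‖ := by
  have h1 : ‖x.1.1‖ = 1 := by
    have h2 : ‖x.1.1‖ ^ 2 + x.1.2 ^ 2 = 1 := x.2
    rw [hx] at h2
    nlinarith [norm_nonneg x.1.1]
  have hs : √(2 * (1 - (0 : ℝ))) = √2 := by norm_num
  have h2 : (√2)⁻¹ ≥ 1 / 2 := by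
    rw [ge_iff_le, one_div]
    refine inv_anti₀ (by positivity) ?_
    rw [Real.sqrt_le_left (by norm_num)]
    norm_num
  have h3 : (1 - u) • p.1 + u • pr x =
      ((1 - u) + u * (√2)⁻¹) • x.1.1 - (1 - u) • (x.1.1 - p.1) := by
    rw [pr, hx, hs]
    module
  have h4 := norm_sub_norm_le (((1 - u) + u * (√2)⁻¹) • x.1.1) ((1 - u) • (x.1.1 - p.1))
  have h5 : 0 ≤ (1 - u) + u * (√2)⁻¹ := by
    have : 0 ≤ u * (√2)⁻¹ := by positivity
    linarith
  rw [← h3, norm_smul, norm_smul, h1, Real.norm_eq_abs, Real.norm_eq_abs, abs_of_nonneg h5,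
    abs_of_nonneg (sub_nonneg.2 hu'), norm_sub_rev] at h4
  have h6 := horiz_near h
  have h7 : (1 - u) * ‖p.1 - x.1.1‖ ≤ 1 / 4 * (1 - u) := by nlinarith
  nlinarith

/-- The projection of the product of the spheres inverting `EE` on the open unit ball. -/
noncomputable def prr (q : X) : ℂ × ℂ := (pr q.1, pr q.2)

lemma prr_EE {T : ℂ × ℂ} (hT : ‖T‖ < 1) : prr (EE T) = T :=
  Prod.ext (pr_E ((norm_fst_le T).trans_lt hT)) (pr_E ((norm_snd_le T).trans_lt hT))

/-- Maps that are locally collapses of orientation preserving local diffeomorphisms. -/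
def PosS : Set (V → X) :=
  {f | ∀ x, ¬ InA (f x) → ∃ T : V → ℂ × ℂ, ContDiffAt ℝ 2 T x ∧ 0 < dt T x ∧
    ∀ᶠ y in 𝓝 x, f y = EE (T y)}

lemma prr_of_mem_posS {f : V → X} (hf : f ∈ PosS) {x : V} (hx : ¬ InA (f x)) :
    ContDiffAt ℝ 2 (fun y => prr (f y)) x ∧ 0 < dt (fun y => prr (f y)) x := by
  obtain ⟨T, hT, hd, he⟩ := hf x hx
  rw [he.self_of_nhds, inA_EE_iff, not_le] at hx
  have h : (fun y => prr (f y)) =ᶠ[𝓝 x] T := by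
    filter_upwards [he, hT.continuousAt.norm.eventually (gt_mem_nhds hx)] with y h1 h2
    rw [h1, prr_EE h2]
  exact ⟨hT.congr_of_eventuallyEq h, by rwa [dt_congr h]⟩

open Classical in
/-- The degree integrand of a family. -/
noncomputable def cut (L : Set (ℝ × V)) (ψ : ℂ × ℂ → ℝ) (U : ℝ × V → ℂ × ℂ) (p : ℝ × V) : ℝ :=
  if p ∈ L then ψ (U p) else 0

lemma cut_spec {L : Set (ℝ × V)} (hL : IsClosed L) {ψ : ℂ × ℂ → ℝ}
    (hψ : ∀ z, 1 / 8 ≤ ‖z‖ → ψ z = 0) {U : ℝ × V → ℂ × ℂ} {p : ℝ × V}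
    (h : p ∈ L → (ContinuousAt U p ∧ 1 / 8 < ‖U p‖) ∨ (ContDiffAt ℝ 2 U p ∧ L ∈ 𝓝 p)) :
    (∀ᶠ q in 𝓝 p, cut L ψ U q = 0) ∨
      (ContDiffAt ℝ 2 U p ∧ ∀ᶠ q in 𝓝 p, cut L ψ U q = ψ (U q)) := by
  by_cases hp : p ∈ L
  · rcases h hp with ⟨h1, h2⟩ | ⟨h1, h2⟩
    · left
      filter_upwards [h1.norm.eventually (lt_mem_nhds h2)] with q hq
      rw [cut, hψ _ hq.le, ite_self]
    · right
      refine ⟨h1, ?_⟩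
      filter_upwards [h2] with q hq
      rw [cut, if_pos hq]
  · left
    filter_upwards [hL.isOpen_compl.mem_nhds hp] with q hq
    rw [cut, if_neg hq]

lemma inB_of_side {x : V} (h : ∃ i, x i = 0 ∨ x i = 1) : InB x := by
  obtain ⟨i, hi⟩ := h
  by_contra hx
  have := mem_cube_of_not_inB hx i
  rcases hi with hi | hi <;> rw [hi] at this <;> linarith

/-- The points mapped to the lower halves of both spheres. -/
def LowX (q : X) : Prop := q.1.1.2 ≤ 0 ∧ q.2.1.2 ≤ 0

lemma not_inA_of_lowX {q : X} (h : LowX q) : ¬ InA q := by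
  rintro (h' | h')
  · rw [eq_b0_iff] at h'; have := h.1; linarith
  · rw [eq_b0_iff] at h'; have := h.2; linarith

lemma low_iff {f : V → X} {P : V → (ℂ × ℝ) × (ℂ × ℝ)} {x : V}
    (h1 : ‖(P x).1 - (f x).1.1‖ < 1 / 4) (h2 : ‖(P x).2 - (f x).2.1‖ < 1 / 4)
    (h : ‖UU (P x)‖ < 1 / 8) : Low (P x) ↔ LowX (f x) := by
  have k1 := height_of_near h1 (((norm_fst_le (UU (P x))).trans_lt h).trans (by norm_num))
  have k2 := height_of_near h2 (((norm_snd_le (UU (P x))).trans_lt h).trans (by norm_num))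
  exact ⟨fun hl => ⟨(k1.1 hl.1).2.le, (k2.1 hl.2).2.le⟩,
    fun hl => ⟨(k1.2 hl.1).le, (k2.2 hl.2).le⟩⟩

/-- A positive map is not null homotopic. -/
lemma not_htpy_const {f : V → X} (hf : f ∈ BasedS) (hpos : f ∈ PosS) {x₀ : V}
    (hx₀ : f x₀ = EE 0) : ¬ Htpy BasedS f (fun _ => base) := by
  rintro ⟨H, hc, hS, h0, h1⟩
  obtain ⟨P, hP⟩ := exists_isApprox hc
  let b : ContDiffBump (0 : ℂ × ℂ) := ⟨1 / 16, 1 / 8, by norm_num, by norm_num⟩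
  let ψ : ℂ × ℂ → ℝ := b
  have hψd : Differentiable ℝ ψ := (b.contDiff (n := 1)).differentiable one_ne_zero
  have hψ0 : ∀ z, 1 / 8 ≤ ‖z‖ → ψ z = 0 := fun z hz =>
    b.zero_of_le_dist (by rw [dist_zero_right]; exact hz)
  have hψn : ∀ z, 0 ≤ ψ z := fun z => b.nonneg
  have hψp : 0 < ψ 0 := b.pos_of_mem_ball (by simp [b])
  let L₁ : Set (ℝ × V) := {p | Low (P p)}
  let U₁ : ℝ × V → ℂ × ℂ := fun p => UU (P p)
  let L₂ : Set (ℝ × V) := {p | LowX (f p.2)}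
  let U₂ : ℝ × V → ℂ × ℂ := fun p => (1 - p.1) • UU (P (0, p.2)) + p.1 • prr (f p.2)
  have hU₁ : ContDiff ℝ 2 U₁ := UU.contDiff.comp hP.contDiff
  have hL₁ : IsClosed L₁ := isClosed_low.preimage hP.contDiff.continuous
  have hf1 : Continuous fun p : ℝ × V => (f p.2).1.1.2 :=
    (continuous_snd.comp continuous_subtype_val).comp
      (continuous_fst.comp (hf.1.comp continuous_snd))
  have hf2 : Continuous fun p : ℝ × V => (f p.2).2.1.2 :=
    (continuous_snd.comp continuous_subtype_val).comp
      (continuous_snd.comp (hf.1.comp continuous_snd))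
  have hL₂ : IsClosed L₂ :=
    (isClosed_le hf1 continuous_const).inter (isClosed_le hf2 continuous_const)
  have near1 : ∀ x, ‖(P (0, x)).1 - (f x).1.1‖ < 1 / 4 := fun x => by
    rw [← h0]; exact hP.near_fst (0, x)
  have near2 : ∀ x, ‖(P (0, x)).2 - (f x).2.1‖ < 1 / 4 := fun x => by
    rw [← h0]; exact hP.near_snd (0, x)
  have not_low : ∀ u x, InA (H u x) → (u, x) ∉ L₁ := by
    rintro u x (h | h) hl
    · exact ne_b0_of_near (hP.near_fst (u, x)) hl.1 h
    · exact ne_b0_of_near (hP.near_snd (u, x)) hl.2 h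
  have flow₁ := (integral_flow (g := cut L₁ ψ U₁) (U := U₁) hψd
    (fun u _ _ x _ => cut_spec hL₁ hψ0 fun hp => by
      by_cases hu : 1 / 8 < ‖U₁ (u, x)‖
      · exact Or.inl ⟨hU₁.continuous.continuousAt, hu⟩
      · refine Or.inr ⟨hU₁.contDiffAt, ?_⟩
        have hu' : ‖UU (P (u, x))‖ < 1 / 4 := (not_lt.1 hu).trans_lt (by norm_num)
        have k1 := (height_of_near (hP.near_fst (u, x))
          ((norm_fst_le (UU (P (u, x)))).trans_lt hu')).1 hp.1
        have k2 := (height_of_near (hP.near_snd (u, x))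
          ((norm_snd_le (UU (P (u, x)))).trans_lt hu')).1 hp.2
        have c := hP.contDiff.continuous
        filter_upwards [(c.fst.snd.continuousAt (x := (u, x))).eventually (gt_mem_nhds k1.1),
          (c.snd.snd.continuousAt (x := (u, x))).eventually (gt_mem_nhds k2.1)] with q q1 q2
        exact ⟨q1.le, q2.le⟩)
    (fun u x hx => if_neg (not_low u x ((basedS_subset_freeS (hS u)).2 x (inB_of_side hx))))).1
  have end₁ : ∫ x in Icc (0 : V) 1, cut L₁ ψ U₁ (1, x) * dt (fun y => U₁ (1, y)) x = 0 := by
    have : ∀ x, cut L₁ ψ U₁ (1, x) = 0 := fun x =>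
      if_neg (not_low 1 x (by rw [h1]; exact inA_base))
    simp [this]
  have hU₂c : ∀ u x, ¬ InA (f x) → ContinuousAt U₂ (u, x) := by
    intro u x hx
    have c1 : Continuous fun p : ℝ × V => (1 - p.1) • UU (P (0, p.2)) := by
      have := hP.contDiff.continuous
      fun_prop
    have c2 : ContinuousAt (fun p : ℝ × V => prr (f p.2)) (u, x) :=
      ContinuousAt.prodMk
        (ContinuousAt.comp (g := pr) (continuousAt_pr fun h => hx (Or.inl h))
          (continuous_fst.comp (hf.1.comp continuous_snd)).continuousAt)
        (ContinuousAt.comp (g := pr) (continuousAt_pr fun h => hx (Or.inr h))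
          (continuous_snd.comp (hf.1.comp continuous_snd)).continuousAt)
    exact c1.continuousAt.add (continuousAt_fst.smul c2)
  have hU₂d : ∀ u x, ¬ InA (f x) → ContDiffAt ℝ 2 U₂ (u, x) := by
    intro u x hx
    have d1 : ContDiff ℝ 2 fun p : ℝ × V => (1 - p.1) • UU (P (0, p.2)) := by
      have e : ContDiff ℝ 2 fun p : ℝ × V => U₁ (0, p.2) :=
        hU₁.comp (contDiff_const.prodMk contDiff_snd)
      exact (contDiff_const.sub contDiff_fst).smul e
    have d2 : ContDiffAt ℝ 2 (fun p : ℝ × V => prr (f p.2)) (u, x) :=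
      ContDiffAt.comp (g := fun y => prr (f y)) (u, x) (prr_of_mem_posS hpos hx).1
        contDiffAt_snd
    exact d1.contDiffAt.add (contDiffAt_fst.smul d2)
  have flow₂ := integral_flow (g := cut L₂ ψ U₂) (U := U₂) hψd
    (fun u hu hu' x _ => cut_spec hL₂ hψ0 fun hp => by
      have hA := not_inA_of_lowX hp
      rcases eq_or_lt_of_le hp.1 with e1 | e1
      · exact Or.inl ⟨hU₂c u x hA, (norm_interp (near1 x) e1 hu hu').trans_le
          (norm_fst_le (U₂ (u, x)))⟩
      rcases eq_or_lt_of_le hp.2 with e2 | e2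
      · exact Or.inl ⟨hU₂c u x hA, (norm_interp (near2 x) e2 hu hu').trans_le
          (norm_snd_le (U₂ (u, x)))⟩
      refine Or.inr ⟨hU₂d u x hA, ?_⟩
      filter_upwards [(hf1.continuousAt (x := (u, x))).eventually (gt_mem_nhds e1),
        (hf2.continuousAt (x := (u, x))).eventually (gt_mem_nhds e2)] with q q1 q2
      exact ⟨q1.le, q2.le⟩)
    (fun u x hx => if_neg fun hl =>
      not_inA_of_lowX hl ((basedS_subset_freeS hf).2 x (inB_of_side hx)))
  have hU0 : ∀ x, U₂ (0, x) = U₁ (0, x) := fun x => by simp [U₁, U₂]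
  have hU1 : ∀ x, U₂ (1, x) = prr (f x) := fun x => by simp [U₂]
  have start : ∀ x, cut L₂ ψ U₂ (0, x) = cut L₁ ψ U₁ (0, x) := by
    intro x
    unfold cut
    rw [hU0]
    by_cases hz : 1 / 8 ≤ ‖U₁ (0, x)‖
    · simp only [hψ0 _ hz, ite_self]
    · have h : (0, x) ∈ L₂ ↔ (0, x) ∈ L₁ :=
        (low_iff (P := fun x => P (0, x)) (near1 x) (near2 x) (not_le.1 hz)).symm
      by_cases hm : (0, x) ∈ L₁
      · rw [if_pos hm, if_pos (h.2 hm)]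
      · rw [if_neg hm, if_neg (h.not.2 hm)]
  have total : ∫ x in Icc (0 : V) 1, cut L₂ ψ U₂ (1, x) * dt (fun y => prr (f y)) x = 0 := by
    have e := flow₂.1
    simp only [hU0, hU1, start] at e
    rw [← e, flow₁, end₁]
  have cont := flow₂.2
  simp only [hU1] at cont
  have nonneg : ∀ x, 0 ≤ cut L₂ ψ U₂ (1, x) * dt (fun y => prr (f y)) x := by
    intro x
    unfold cut
    split_ifs with h
    · exact mul_nonneg (hψn _) (prr_of_mem_posS hpos (not_inA_of_lowX h)).2.le
    · simp
  have ae : (fun x => cut L₂ ψ U₂ (1, x) * dt (fun y => prr (f y)) x) =ᵐ[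
      volume.restrict (Icc (0 : V) 1)] 0 :=
    (integral_eq_zero_iff_of_nonneg nonneg
      (cont.integrableOn_compact isCompact_Icc)).1 total
  have hA0 : ¬ InA (f x₀) := by
    rw [hx₀, inA_EE_iff]
    simp
  have hcube : (univ.pi fun _ : Fin 4 => Ioo (0 : ℝ) 1) ⊆ Icc (0 : V) 1 := fun y hy =>
    ⟨fun i => (hy i (mem_univ i)).1.le, fun i => (hy i (mem_univ i)).2.le⟩
  have key := Measure.eqOn_open_of_ae_eq (ae_restrict_of_ae_restrict_of_subset hcube ae)
    (isOpen_set_pi finite_univ fun i _ => isOpen_Ioo) (cont.mono hcube) continuousOn_const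
    (fun i _ => mem_cube_of_not_inB (fun h => hA0 ((basedS_subset_freeS hf).2 x₀ h)) i)
  have hl : (1, x₀) ∈ L₂ := by
    show LowX (f x₀)
    rw [hx₀]
    constructor <;> show 2 * min 1 (‖(0 : ℂ)‖ ^ 2) - 1 ≤ 0 <;> simp
  have hval : cut L₂ ψ U₂ (1, x₀) = ψ 0 := by
    rw [cut, if_pos hl, hU1, hx₀, prr_EE (by simp)]
  simp only [hval, Pi.zero_apply] at key
  exact absurd key (ne_of_gt (mul_pos hψp (prr_of_mem_posS hpos hA0).2))

/-- The affine substitutions used in the concatenation. -/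
def dbl (c : ℝ) (y : V) : V := ![2 * y 0 - c, y 1, y 2, y 3]

lemma continuous_dbl (c : ℝ) : Continuous (dbl c) := by
  unfold dbl
  apply continuous_vec4 <;> fun_prop

/-- The linear map with the given rows. -/
noncomputable def rows (M : Matrix (Fin 4) (Fin 4) ℝ) : V →L[ℝ] V :=
  LinearMap.toContinuousLinearMap (Matrix.toLin' M)

lemma det_rows (M : Matrix (Fin 4) (Fin 4) ℝ) : (rows M).det = M.det :=
  LinearMap.det_toLin' M

lemma hasFDerivAt_dbl (c : ℝ) (x : V) :
    HasFDerivAt (dbl c) (rows (Matrix.diagonal ![2, 1, 1, 1])) x := by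
  have h : dbl c = fun y => rows (Matrix.diagonal ![2, 1, 1, 1]) y + ![-c, 0, 0, 0] := by
    funext y
    ext i
    fin_cases i <;> simp [dbl, rows, Matrix.mulVec_diagonal, sub_eq_add_neg]
  rw [h]
  exact (rows _).hasFDerivAt.add_const _

lemma posS_comp_dbl {f : V → X} (hf : f ∈ PosS) {k : V → X} {c : ℝ} {x : V}
    (hk : ∀ᶠ y in 𝓝 x, k y = f (dbl c y)) (hx : ¬ InA (k x)) :
    ∃ T : V → ℂ × ℂ, ContDiffAt ℝ 2 T x ∧ 0 < dt T x ∧ ∀ᶠ y in 𝓝 x, k y = EE (T y) := by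
  rw [hk.self_of_nhds] at hx
  obtain ⟨T, hT, hd, he⟩ := hf _ hx
  have hdbl : ContDiff ℝ 2 (dbl c) := by
    rw [contDiff_pi]
    intro i
    fin_cases i <;> simp [dbl] <;> fun_prop
  refine ⟨fun y => T (dbl c y), hT.comp x hdbl.contDiffAt, ?_, ?_⟩
  · rw [dt_comp (hT.differentiableAt two_ne_zero) (hasFDerivAt_dbl c x), det_rows,
      Matrix.det_diagonal]
    simpa [Fin.prod_univ_succ] using hd
  · filter_upwards [hk, (continuous_dbl c).continuousAt.eventually he] with y h1 h2
    rw [h1, h2]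

lemma concat_mem_posS {f g : V → X} (hf : f ∈ PosS) (hfb : f ∈ BasedS) (hg : g ∈ PosS) :
    concat f g ∈ PosS := by
  intro x hx
  rcases lt_trichotomy (x 0) (1 / 2) with h | h | h
  · refine posS_comp_dbl (c := 0) hf ?_ hx
    filter_upwards [((continuous_apply 0).continuousAt (x := x)).eventually (gt_mem_nhds h)]
      with y hy
    rw [concat, if_pos hy.le, dbl, sub_zero]
  · refine absurd ?_ hx
    rw [concat, if_pos h.le, hfb.2.1 _ ((inJ_iff).2 (Or.inr (Or.inl (by simp [h]))))]
    exact inA_base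
  · refine posS_comp_dbl (c := 1) hg ?_ hx
    filter_upwards [((continuous_apply 0).continuousAt (x := x)).eventually (lt_mem_nhds h)]
      with y hy
    rw [concat, if_neg (not_le.2 hy), dbl]

lemma dt_Tw_pos (x : V) : 0 < dt Tw x := by
  have h : HasFDerivAt (fun y => eV (Tw y))
      (rows !![6, 0, 0, 0; 0, 6, 0, 0; 0, 0, 6, 0;
        12 * (6 * x 0 - 3), 12 * (6 * x 1 - 3), 12 * (6 * x 2 - 3), 5]) x := by
    have e : (fun y => eV (Tw y)) =
        fun y => ![6 * y 0 - 3, 6 * y 1 - 3, 6 * y 2 - 3, hw y] := by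
      funext y
      exact Lw.symm_apply_apply _
    have p : ∀ i, HasFDerivAt (fun y : V => 6 * y i - 3)
        ((6 : ℝ) • ContinuousLinearMap.proj (R := ℝ) (φ := fun _ : Fin 4 => ℝ) i) x := fun i =>
      ((hasFDerivAt_apply i x).const_mul 6).sub_const 3
    rw [e, hasFDerivAt_pi']
    intro i
    fin_cases i
    · refine (p 0).congr_fderiv (ContinuousLinearMap.ext fun v => ?_)
      simp [rows, dotProduct, Fin.sum_univ_succ]
    · refine (p 1).congr_fderiv (ContinuousLinearMap.ext fun v => ?_)
      simp [rows, dotProduct, Fin.sum_univ_succ]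
    · refine (p 2).congr_fderiv (ContinuousLinearMap.ext fun v => ?_)
      simp [rows, dotProduct, Fin.sum_univ_succ]
    · refine HasFDerivAt.congr_fderiv (((((p 0).pow 2).add ((p 1).pow 2)).add
        ((p 2).pow 2)).sub_const 3 |>.add ((hasFDerivAt_apply 3 x).const_mul 5))
        (ContinuousLinearMap.ext fun v => ?_)
      simp [rows, dotProduct, Fin.sum_univ_succ]
      ring
  rw [dt, h.fderiv, det_rows]
  simp [Matrix.det_succ_row_zero, Fin.sum_univ_succ]

lemma contDiff_Tw : ContDiff ℝ 2 Tw := by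
  have h : ContDiff ℝ 2 fun y : V => (![6 * y 0 - 3, 6 * y 1 - 3, 6 * y 2 - 3, hw y] : V) := by
    rw [contDiff_pi]
    intro i
    fin_cases i <;> simp [hw] <;> fun_prop
  exact (LinearMap.toContinuousLinearMap (Lw : V →ₗ[ℝ] ℂ × ℂ)).contDiff.comp h

lemma clV_of_mem {y : V} (hy : ∀ i, 0 < y i ∧ y i < 1) : clV y = y :=
  funext fun i => cl_of_mem (hy i).1.le (hy i).2.le

lemma wmap_mem_posS : wmap ∈ PosS := by
  intro x hx
  refine ⟨Tw, contDiff_Tw.contDiffAt, dt_Tw_pos x, ?_⟩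
  have hA : IsOpen {y : V | ¬ InA (wmap y)} := (isClosed_inA.preimage wmap_mem.1).isOpen_compl
  filter_upwards [hA.mem_nhds hx] with y hy
  rw [wmap, clV_of_mem (mem_cube_of_not_inB fun h => hy ((basedS_subset_freeS wmap_mem).2 y h))]

lemma wmap_center : wmap ![1 / 2, 1 / 2, 1 / 2, 3 / 5] = EE 0 := by
  rw [wmap, clV_of_mem]
  · congr 1
    rw [Tw, Lw_eq_zero_iff]
    ext i
    fin_cases i <;> simp [hw] <;> norm_num
  · intro i
    fin_cases i <;> norm_num

section

variable {S : Type} [TopologicalSpace S] {b : S} (Φ : S ≃ₜ Sph) (hΦ : Φ b = b0) {pt : Fib b}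
  (hpt : ∀ t, pt.1.2 t = (b, b))

lemma exists_pos_pow (n : ℕ) : ∃ f : BasedS, f.1 ∈ PosS ∧ (∃ x, f.1 x = EE 0) ∧
    mk Φ hΦ hpt f = mk Φ hΦ hpt ⟨wmap, wmap_mem⟩ ^ (n + 1) := by
  induction n with
  | zero => exact ⟨⟨wmap, wmap_mem⟩, wmap_mem_posS, ⟨_, wmap_center⟩, by simp⟩
  | succ n ih =>
    obtain ⟨f, hf, ⟨x, hx⟩, hm⟩ := ih
    refine ⟨⟨_, concat_mem f.2 wmap_mem⟩, concat_mem_posS hf f.2 wmap_mem_posS,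
      ⟨![x 0 / 2, x 1, x 2, x 3], ?_⟩, ?_⟩
    · have hA : ¬ InA (f.1 x) := by
        rw [hx, inA_EE_iff]
        simp
      have h1 := (mem_cube_of_not_inB
        (fun h => hA ((basedS_subset_freeS f.2).2 x h)) 0).2
      have h2 : (![x 0 / 2, x 1, x 2, x 3] : V) 0 ≤ 1 / 2 := by
        simp only [Matrix.cons_val_zero]
        linarith
      refine (if_pos h2).trans (Eq.trans (congrArg f.1 ?_) hx)
      ext i
      fin_cases i <;> simp
      ring
    · rw [mk_concat Φ hΦ hpt f ⟨wmap, wmap_mem⟩, hm, ← pow_succ']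

lemma mk_wmap_pow_ne_one (n : ℕ) : mk Φ hΦ hpt ⟨wmap, wmap_mem⟩ ^ (n + 1) ≠ 1 := by
  obtain ⟨f, hf, ⟨x, hx⟩, hm⟩ := exists_pos_pow Φ hΦ hpt n
  intro h
  rw [← hm, ← mk_const Φ hΦ hpt] at h
  exact not_htpy_const f.2 hf hx (htpy_of_mk_eq Φ hΦ hpt h)

/-- The third homotopy group of the homotopy fibre is infinite cyclic. -/
theorem nonempty_mulEquiv (Φ : S ≃ₜ Sph) (hΦ : Φ b = b0) (hpt : ∀ t, pt.1.2 t = (b, b)) :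
    Nonempty (π_ 3 (Fib b) pt ≃* Multiplicative ℤ) := by
  have hfin : ¬ IsOfFinOrder (mk Φ hΦ hpt ⟨wmap, wmap_mem⟩) := by
    rw [isOfFinOrder_iff_pow_eq_one]
    rintro ⟨n, hn, h⟩
    obtain ⟨m, rfl⟩ := Nat.exists_eq_succ_of_ne_zero hn.ne'
    exact mk_wmap_pow_ne_one Φ hΦ hpt m h
  refine ⟨(MulEquiv.ofBijective (zpowersHom _ (mk Φ hΦ hpt ⟨wmap, wmap_mem⟩)) ⟨?_, ?_⟩).symm⟩
  · intro m n h
    exact Multiplicative.toAdd.injective (injective_zpow_iff_not_isOfFinOrder.2 hfin h)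
  · intro x
    obtain ⟨f, rfl⟩ := mk_surjective Φ hΦ hpt x
    obtain ⟨n, hn⟩ := Subgroup.mem_zpowers_iff.1 (mem_zpowers_wmap
      (fun _ _ => mk_eq_of_htpy Φ hΦ hpt) (mk_concat Φ hΦ hpt) (mk_const Φ hΦ hpt)
      (mk_comp_rfl0 Φ hΦ hpt) f)
    exact ⟨Multiplicative.ofAdd n, hn⟩

end

/-- The unit sphere of Euclidean space is homeomorphic to the model sphere, with the base point at
the north pole. -/
lemma exists_homeomorph (b : Metric.sphere (0 : EuclideanSpace ℝ (Fin 3)) 1) :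
    ∃ Φ : Metric.sphere (0 : EuclideanSpace ℝ (Fin 3)) 1 ≃ₜ Sph, Φ b = b0 := by
  have hb : ‖(b : EuclideanSpace ℝ (Fin 3))‖ = 1 := mem_sphere_zero_iff_norm.1 b.2
  obtain ⟨B, hB⟩ := Orthonormal.exists_orthonormalBasis_extension_of_card_eq (𝕜 := ℝ)
    (E := EuclideanSpace ℝ (Fin 3)) (ι := Fin 3) (by simp)
    (v := fun _ => (b : EuclideanSpace ℝ (Fin 3))) (s := {2})
    ⟨fun _ => hb, fun i j hij => absurd (Subsingleton.elim i j) hij⟩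
  have hB2 : B 2 = b := hB 2 rfl
  let e : EuclideanSpace ℝ (Fin 3) ≃ₜ ℂ × ℝ :=
    { toFun := fun v => (⟨B.repr v 0, B.repr v 1⟩, B.repr v 2)
      invFun := fun p => B.repr.symm !₂[p.1.re, p.1.im, p.2]
      left_inv := fun v => by
        apply B.repr.injective
        rw [LinearIsometryEquiv.apply_symm_apply]
        ext i
        fin_cases i <;> rfl
      right_inv := fun p => by simp
      continuous_toFun := by
        have h : ∀ i, Continuous fun v : EuclideanSpace ℝ (Fin 3) => B.repr v i := fun i =>
          (EuclideanSpace.proj i).continuous.comp B.repr.continuous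
        exact (Complex.equivRealProdCLM.symm.continuous.comp ((h 0).prodMk (h 1))).prodMk (h 2)
      continuous_invFun := by
        refine B.repr.symm.continuous.comp ((PiLp.continuous_toLp 2 _).comp ?_)
        refine continuous_pi fun i => ?_
        fin_cases i
        · exact Complex.continuous_re.comp continuous_fst
        · exact Complex.continuous_im.comp continuous_fst
        · exact continuous_snd }
  have he : ∀ v, v ∈ Metric.sphere (0 : EuclideanSpace ℝ (Fin 3)) 1 ↔ e v ∈ Sph := by
    intro v
    have h : ‖v‖ ^ 2 = B.repr v 0 ^ 2 + B.repr v 1 ^ 2 + B.repr v 2 ^ 2 := by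
      rw [← B.repr.norm_map, EuclideanSpace.norm_sq_eq, Fin.sum_univ_three]
      simp
    have h' : e v ∈ Sph ↔ ‖v‖ ^ 2 = 1 := by
      show ‖(⟨B.repr v 0, B.repr v 1⟩ : ℂ)‖ ^ 2 + B.repr v 2 ^ 2 = 1 ↔ _
      rw [h, Complex.sq_norm, Complex.normSq_mk]
      ring_nf
    rw [h', mem_sphere_zero_iff_norm]
    constructor
    · intro h; rw [h]; norm_num
    · intro h; nlinarith [norm_nonneg v]
  refine ⟨e.subtype he, Subtype.ext ?_⟩
  show e b = (0, 1)
  have hr : B.repr b = EuclideanSpace.single 2 1 := by rw [← hB2, B.repr_self]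
  refine Prod.ext (Complex.ext ?_ ?_) ?_
  · show B.repr b 0 = 0
    rw [hr]; simp
  · show B.repr b 1 = 0
    rw [hr]; simp
  · show B.repr b 2 = 1
    rw [hr]; simp

end WedgeFiber

/-- Let `F` be the homotopy fiber of the inclusion `S² ∨ S² → S² × S²`, where `S²` is the
unit sphere in `ℝ³` with a basepoint `b`, the wedge `S² ∨ S²` is modeled as the subspace
`{(x, y) : x = b ∨ y = b}` of `S² × S²` (so the inclusion is the subtype inclusion), and the
homotopy fiber is the space of pairs `(w, γ)` of a point of the wedge and a path in
`S² × S²` from its image to the basepoint `(b, b)`.  Then `π₃(F) ≅ ℤ`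
(written multiplicatively). -/
theorem stmt_1 (S2 : Set (EuclideanSpace ℝ (Fin 3)))
    (hS2 : S2 = Metric.sphere (0 : EuclideanSpace ℝ (Fin 3)) 1) (b : S2)
    (Wedge : Set (S2 × S2)) (hW : Wedge = {p : S2 × S2 | p.1 = b ∨ p.2 = b})
    (F : Set (Wedge × C(unitInterval, S2 × S2)))
    (hF : F = {q : Wedge × C(unitInterval, S2 × S2) |
      q.2 0 = (q.1 : S2 × S2) ∧ q.2 1 = (b, b)})
    (pt : F)
    (hpt1 : (((pt : Wedge × C(unitInterval, S2 × S2)).1 : S2 × S2)) = (b, b))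
    (hpt2 : (pt : Wedge × C(unitInterval, S2 × S2)).2 =
      ContinuousMap.const unitInterval (b, b)) :
    Nonempty ((π_ 3 F pt) ≃* Multiplicative ℤ) := by
  subst hS2 hW hF
  obtain ⟨Φ, hΦ⟩ := WedgeFiber.exists_homeomorph b
  exact WedgeFiber.nonempty_mulEquiv Φ hΦ fun t => by rw [hpt2]; rfl
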